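/- arXiv:1509.08153 — 2 statements merged into one kernel-verified Lean document; each statement's English description precedes it below -/
import Mathlib

section
/- Let n ≥ 3, m ≥ 1, and let u = (u_1,…,u_m) be a C² solution of −Δu_i = |u|^{p−1} u_i on ℝⁿ (1 ≤ i ≤ m) that is stable outside a compact set. If either 1 < p < (n+2)/(n−2), or (n+2)/(n−2) < p < p_c(n), where p_c(n) = ∞ for n ≤ 10 and p_c(n) = ((n−2)² − 4n + 8√(n−1)) / ((n−2)(n−10)) for n ≥ 11, then u_i ≡ 0 for every i. -/
open MeasureTheory Metric Filter Real Set

noncomputable section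

/-- `n`-dimensional Euclidean space. -/
abbrev Euc (n : ℕ) := EuclideanSpace ℝ (Fin n)

/-- Laplacian of a scalar function on Euclidean space. -/
def lap {n : ℕ} (f : Euc n → ℝ) (x : Euc n) : ℝ :=
  ∑ i : Fin n, iteratedFDeriv ℝ 2 f x ![EuclideanSpace.single i 1, EuclideanSpace.single i 1]

/-- Stability (quadratic form) inequality for the second order Lane–Emden system, tested
against families of smooth compactly supported functions whose supports lie in `S`:
`Σ_i ∫ |u|^{p−1} φ_i² + (p−1) Σ_{i,j} ∫ |u|^{p−3} u_i u_j φ_i φ_j ≤ Σ_i ∫ |∇φ_i|²`.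
(Since `‖u x‖ ^ (p−3)` is interpreted with `Real.rpow`, the term `|u|^{p−3} u_i u_j`
vanishes on the set where `u = 0`, for any `p > 1`.) -/
def Stable1 (n m : ℕ) (p : ℝ) (u : Euc n → EuclideanSpace ℝ (Fin m))
    (S : Set (Euc n)) : Prop :=
  ∀ φ : Fin m → Euc n → ℝ,
    (∀ i, ContDiff ℝ (⊤ : ℕ∞) (φ i)) → (∀ i, HasCompactSupport (φ i)) →
    (∀ i, tsupport (φ i) ⊆ S) →
    (∑ i, ∫ x, ‖u x‖ ^ (p - 1) * (φ i x) ^ 2) +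
      (p - 1) * ∑ i, ∑ j, ∫ x, ‖u x‖ ^ (p - 3) * u x i * u x j * φ i x * φ j x
      ≤ ∑ i, ∫ x, ‖gradient (φ i) x‖ ^ 2

/-- The `k`-th partial derivative of a scalar function on Euclidean space. -/
def pd {n : ℕ} (k : Fin n) (f : Euc n → ℝ) (x : Euc n) : ℝ :=
  fderiv ℝ f x (EuclideanSpace.single k 1)

/-- The squared Euclidean norm of the gradient, in coordinates. -/
def gradSq {n : ℕ} (f : Euc n → ℝ) (x : Euc n) : ℝ := ∑ k, pd k f x ^ 2

section PartialDerivatives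

variable {n : ℕ}

theorem gradSq_nonneg (f : Euc n → ℝ) (x : Euc n) : 0 ≤ gradSq f x :=
  Finset.sum_nonneg fun _ _ => sq_nonneg _

theorem norm_gradient_sq (f : Euc n → ℝ) (x : Euc n) : ‖gradient f x‖ ^ 2 = gradSq f x := by
  rw [EuclideanSpace.real_norm_sq_eq]
  refine Finset.sum_congr rfl fun k _ => ?_
  congr 1
  have h : inner ℝ (gradient f x) (EuclideanSpace.single k 1) =
      fderiv ℝ f x (EuclideanSpace.single k 1) := by
    rw [gradient, InnerProductSpace.toDual_symm_apply]
  rw [EuclideanSpace.inner_single_right] at h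
  simpa [pd] using h

theorem contDiff_pd {f : Euc n → ℝ} {a b : WithTop ℕ∞} (hf : ContDiff ℝ b f) (h : a + 1 ≤ b)
    (k : Fin n) : ContDiff ℝ a (pd k f) :=
  (hf.fderiv_right h).clm_apply contDiff_const

theorem continuous_pd {f : Euc n → ℝ} (hf : ContDiff ℝ 1 f) (k : Fin n) : Continuous (pd k f) :=
  (contDiff_pd (a := 0) hf (by simp) k).continuous

theorem continuous_gradSq {f : Euc n → ℝ} (hf : ContDiff ℝ 1 f) : Continuous (gradSq f) :=
  continuous_finsetSum _ fun k _ => (continuous_pd hf k).pow 2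

theorem tsupport_pd_subset (f : Euc n → ℝ) (k : Fin n) : tsupport (pd k f) ⊆ tsupport f := by
  refine closure_minimal (fun x hx => ?_) (isClosed_tsupport f)
  refine support_fderiv_subset ℝ (f := f) ?_
  intro h
  exact hx (by simp [pd, h])

theorem pd_eq_zero_of_notMem {f : Euc n → ℝ} {x : Euc n} (hx : x ∉ tsupport f) (k : Fin n) :
    pd k f x = 0 :=
  image_eq_zero_of_notMem_tsupport fun h => hx (tsupport_pd_subset f k h)

theorem gradSq_eq_zero_of_notMem {f : Euc n → ℝ} {x : Euc n} (hx : x ∉ tsupport f) :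
    gradSq f x = 0 := by
  simp [gradSq, pd_eq_zero_of_notMem hx]

theorem hasCompactSupport_pd {f : Euc n → ℝ} (hf : HasCompactSupport f) (k : Fin n) :
    HasCompactSupport (pd k f) :=
  hf.of_isClosed_subset (isClosed_tsupport _) (tsupport_pd_subset f k)

theorem hasCompactSupport_gradSq {f : Euc n → ℝ} (hf : HasCompactSupport f) :
    HasCompactSupport (gradSq f) :=
  HasCompactSupport.intro hf fun _ hx => gradSq_eq_zero_of_notMem hx

theorem lap_eq_sum_pd {f : Euc n → ℝ} (hf : ContDiff ℝ 2 f) (x : Euc n) :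
    lap f x = ∑ k, pd k (pd k f) x := by
  refine Finset.sum_congr rfl fun k _ => ?_
  rw [iteratedFDeriv_two_apply]
  have h : DifferentiableAt ℝ (fderiv ℝ f) x :=
    (hf.fderiv_right (m := 1) (by norm_num)).differentiable one_ne_zero x
  unfold pd
  rw [fderiv_clm_apply h (differentiableAt_const _)]
  simp

theorem pd_pd_comm {f : Euc n → ℝ} (hf : ContDiff ℝ 2 f) (k l : Fin n) (x : Euc n) :
    pd k (pd l f) x = pd l (pd k f) x := by
  have h : DifferentiableAt ℝ (fderiv ℝ f) x :=
    (hf.fderiv_right (m := 1) (by norm_num)).differentiable one_ne_zero x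
  have hs := (hf.contDiffAt (x := x)).isSymmSndFDerivAt (by simp)
  have key : ∀ a b : Fin n, pd a (pd b f) x =
      fderiv ℝ (fderiv ℝ f) x (EuclideanSpace.single a 1) (EuclideanSpace.single b 1) := by
    intro a b
    unfold pd
    rw [fderiv_clm_apply h (differentiableAt_const _)]
    simp
  rw [key, key]
  exact hs _ _

theorem pd_add {f g : Euc n → ℝ} {x : Euc n} (hf : DifferentiableAt ℝ f x)
    (hg : DifferentiableAt ℝ g x) (k : Fin n) :
    pd k (fun y => f y + g y) x = pd k f x + pd k g x := by
  simp [pd, fderiv_fun_add hf hg]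

theorem pd_sub {f g : Euc n → ℝ} {x : Euc n} (hf : DifferentiableAt ℝ f x)
    (hg : DifferentiableAt ℝ g x) (k : Fin n) :
    pd k (fun y => f y - g y) x = pd k f x - pd k g x := by
  simp [pd, fderiv_fun_sub hf hg]

theorem pd_mul {f g : Euc n → ℝ} {x : Euc n} (hf : DifferentiableAt ℝ f x)
    (hg : DifferentiableAt ℝ g x) (k : Fin n) :
    pd k (fun y => f y * g y) x = pd k f x * g x + f x * pd k g x := by
  simp [pd, fderiv_fun_mul hf hg]
  ring

theorem pd_const_mul {f : Euc n → ℝ} {x : Euc n} (hf : DifferentiableAt ℝ f x) (c : ℝ)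
    (k : Fin n) : pd k (fun y => c * f y) x = c * pd k f x := by
  simp [pd, fderiv_const_mul hf]

theorem pd_sum {ι : Type*} {s : Finset ι} {f : ι → Euc n → ℝ} {x : Euc n}
    (hf : ∀ i ∈ s, DifferentiableAt ℝ (f i) x) (k : Fin n) :
    pd k (fun y => ∑ i ∈ s, f i y) x = ∑ i ∈ s, pd k (f i) x := by
  simp [pd, fderiv_fun_sum hf]

theorem pd_pow {f : Euc n → ℝ} {x : Euc n} (hf : DifferentiableAt ℝ f x) (a : ℕ) (k : Fin n) :
    pd k (fun y => f y ^ a) x = a * f x ^ (a - 1) * pd k f x := by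
  simp [pd, fderiv_fun_pow a hf]

theorem pd_coord (k l : Fin n) (x : Euc n) :
    pd k (fun y => y l) x = if k = l then 1 else 0 := by
  have h : (fun y : Euc n => y l) = EuclideanSpace.proj (𝕜 := ℝ) l := rfl
  rw [pd, h, ContinuousLinearMap.fderiv]
  simp [eq_comm]

theorem pd_comp_smul (f : Euc n → ℝ) (c : ℝ) (k : Fin n) (x : Euc n) :
    pd k (fun y => f (c • y)) x = c * pd k f (c • x) := by
  simp [pd, fderiv_comp_smul]

theorem gradSq_comp_smul (f : Euc n → ℝ) (c : ℝ) (x : Euc n) :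
    gradSq (fun y => f (c • y)) x = c ^ 2 * gradSq f (c • x) := by
  simp [gradSq, pd_comp_smul, mul_pow, Finset.mul_sum]

theorem gradSq_pow {f : Euc n → ℝ} {x : Euc n} (hf : DifferentiableAt ℝ f x) (a : ℕ) :
    gradSq (fun y => f y ^ a) x = a ^ 2 * f x ^ (2 * (a - 1)) * gradSq f x := by
  simp only [gradSq, pd_pow hf, Finset.mul_sum]
  refine Finset.sum_congr rfl fun k _ => ?_
  ring

theorem integral_pd_eq_zero {f : Euc n → ℝ} (hf : ContDiff ℝ 1 f) (hc : HasCompactSupport f)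
    (k : Fin n) : ∫ x, pd k f x = 0 := by
  have h1 : Integrable (fun x => fderiv ℝ f x (EuclideanSpace.single k 1)) :=
    (continuous_pd hf k).integrable_of_hasCompactSupport (hasCompactSupport_pd hc k)
  have h2 : Integrable f := hf.continuous.integrable_of_hasCompactSupport hc
  have h := integral_mul_fderiv_eq_neg_fderiv_mul_of_integrable (μ := (volume : Measure (Euc n)))
    (𝕜 := ℝ) (f := fun _ => 1) (g := f) (v := EuclideanSpace.single k 1)
    (by simp) (by simpa using h1) (by simpa using h2)
    (fun _ _ => differentiableAt_const _) (fun x _ => hf.differentiable one_ne_zero x)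
  simpa [pd] using h

theorem integral_sum_pd_eq_zero {F : Fin n → Euc n → ℝ} (hF : ∀ k, ContDiff ℝ 1 (F k))
    (hc : ∀ k, HasCompactSupport (F k)) : ∫ x, ∑ k, pd k (F k) x = 0 := by
  rw [integral_finsetSum _ fun k _ => (continuous_pd (hF k) k).integrable_of_hasCompactSupport
    (hasCompactSupport_pd (hc k) k)]
  exact Finset.sum_eq_zero fun k _ => integral_pd_eq_zero (hF k) (hc k) k

end PartialDerivatives

section Mollification

variable {n : ℕ}

open scoped Convolution in
theorem exists_smooth_approx {f : Euc n → ℝ} (hf : ContDiff ℝ 1 f) (hc : HasCompactSupport f)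
    {ε : ℝ} (hε : 0 < ε) :
    ∃ g : Euc n → ℝ, ContDiff ℝ (⊤ : ℕ∞) g ∧ HasCompactSupport g ∧
      tsupport g ⊆ cthickening ε (tsupport f) ∧ (∀ x, |g x - f x| ≤ ε) ∧
      ∀ k x, |pd k g x - pd k f x| ≤ ε := by
  have hu := Metric.uniformContinuous_iff.1
    (hc.uniformContinuous_of_continuous hf.continuous) ε hε
  have hv : ∀ k, ∃ δ > 0, ∀ ⦃a b : Euc n⦄, dist a b < δ → dist (pd k f a) (pd k f b) < ε :=
    fun k => Metric.uniformContinuous_iff.1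
      ((hasCompactSupport_pd hc k).uniformContinuous_of_continuous (continuous_pd hf k)) ε hε
  obtain ⟨δ₁, hδ₁, h₁⟩ := hu
  choose δ₂ hδ₂ h₂ using hv
  obtain ⟨δ, hδ, hδε, hδ₁', hδ₂'⟩ : ∃ δ > 0, δ ≤ ε ∧ δ ≤ δ₁ ∧ ∀ k, δ ≤ δ₂ k := by
    have hle : ∀ a : ℝ, 0 < a → ∀ᶠ δ in nhdsWithin (0 : ℝ) (Ioi 0), δ ≤ a := fun a ha => by
      filter_upwards [Ioc_mem_nhdsGT ha] with x hx using hx.2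
    have hfin := (hle ε hε).and ((hle δ₁ hδ₁).and (eventually_all.2 fun k => hle _ (hδ₂ k)))
    obtain ⟨δ, h, h'⟩ := (hfin.and self_mem_nhdsWithin).exists
    exact ⟨δ, h', h⟩
  let φ : ContDiffBump (0 : Euc n) := ⟨δ / 2, δ, by positivity, by linarith⟩
  have hloc : LocallyIntegrable (φ.normed volume) (volume : Measure (Euc n)) :=
    φ.continuous_normed.locallyIntegrable
  have hts : tsupport (φ.normed volume ⋆[ContinuousLinearMap.lsmul ℝ ℝ, volume] f) ⊆
      cthickening ε (tsupport f) := by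
    refine closure_minimal ?_ isClosed_cthickening
    refine (support_convolution_subset _).trans ?_
    rintro _ ⟨y, hy, z, hz, rfl⟩
    rw [φ.support_normed_eq] at hy
    refine thickening_subset_cthickening ε _ (mem_thickening_iff.2 ⟨z, subset_closure hz, ?_⟩)
    have : ‖y‖ < δ := by simpa using hy
    simpa using this.trans_le hδε
  refine ⟨φ.normed volume ⋆[ContinuousLinearMap.lsmul ℝ ℝ, volume] f,
    φ.hasCompactSupport_normed.contDiff_convolution_left _ φ.contDiff_normed
      hf.continuous.locallyIntegrable, ?_, hts, fun x => ?_, fun k x => ?_⟩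
  · exact hc.isCompact.cthickening.of_isClosed_subset (isClosed_tsupport _) hts
  · refine φ.dist_normed_convolution_le hf.continuous.aestronglyMeasurable fun y hy => ?_
    exact (h₁ ((mem_ball.1 hy).trans_le hδ₁')).le
  · have hd := hc.hasFDerivAt_convolution_right (ContinuousLinearMap.lsmul ℝ ℝ) hloc hf x
    have he : pd k (φ.normed volume ⋆[ContinuousLinearMap.lsmul ℝ ℝ, volume] f) x =
        (φ.normed volume ⋆[ContinuousLinearMap.lsmul ℝ ℝ, volume] pd k f) x := by
      rw [pd, hd.fderiv, convolution_precompR_apply _ hloc (hc.fderiv ℝ)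
        (hf.continuous_fderiv one_ne_zero)]
      rfl
    rw [he]
    refine φ.dist_normed_convolution_le (continuous_pd hf k).aestronglyMeasurable fun y hy => ?_
    exact (h₂ k ((mem_ball.1 hy).trans_le (hδ₂' k))).le

/-- A compactly supported `C¹` function is a limit of smooth functions supported in a fixed
compact subset of a given neighbourhood of its support, boundedly with first derivatives. -/
theorem exists_smooth_seq {f : Euc n → ℝ} (hf : ContDiff ℝ 1 f) (hc : HasCompactSupport f)
    {S : Set (Euc n)} (hS : IsOpen S) (hfS : tsupport f ⊆ S) :
    ∃ (g : ℕ → Euc n → ℝ) (K : Set (Euc n)) (M : ℝ), IsCompact K ∧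
      (∀ j, ContDiff ℝ (⊤ : ℕ∞) (g j)) ∧ (∀ j, tsupport (g j) ⊆ K) ∧ K ⊆ S ∧
      (∀ j x, |g j x| ≤ M) ∧ (∀ j x, gradSq (g j) x ≤ M) ∧
      (∀ x, Tendsto (fun j => g j x) atTop (nhds (f x))) ∧
      (∀ x, Tendsto (fun j => gradSq (g j) x) atTop (nhds (gradSq f x))) := by
  obtain ⟨δ, hδ, hδS⟩ := hc.isCompact.exists_cthickening_subset_open hS hfS
  have hex : ∀ j : ℕ, ∃ g : Euc n → ℝ, ContDiff ℝ (⊤ : ℕ∞) g ∧ HasCompactSupport g ∧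
      tsupport g ⊆ cthickening (min δ (1 / ((j : ℝ) + 1))) (tsupport f) ∧
      (∀ x, |g x - f x| ≤ min δ (1 / ((j : ℝ) + 1))) ∧
      ∀ k x, |pd k g x - pd k f x| ≤ min δ (1 / ((j : ℝ) + 1)) :=
    fun j => exists_smooth_approx hf hc (lt_min hδ (by positivity))
  choose g hg _ hgs hg0 hg1 using hex
  obtain ⟨M₀, hM₀⟩ := hc.exists_bound_of_continuous hf.continuous
  have hbd : ∀ k, ∃ C, ∀ x, ‖pd k f x‖ ≤ C := fun k =>
    (hasCompactSupport_pd hc k).exists_bound_of_continuous (continuous_pd hf k)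
  choose M₁ hM₁ using hbd
  have hlim : ∀ {a : ℕ → ℝ} {b : ℝ}, (∀ j : ℕ, |a j - b| ≤ min δ (1 / ((j : ℝ) + 1))) →
      Tendsto a atTop (nhds b) := by
    intro a b h
    rw [tendsto_iff_dist_tendsto_zero]
    exact squeeze_zero (fun _ => dist_nonneg) (fun j => (h j).trans (min_le_right _ _))
      tendsto_one_div_add_atTop_nhds_zero_nat
  refine ⟨g, cthickening δ (tsupport f), max (M₀ + δ) (∑ k, (M₁ k + δ) ^ 2),
    hc.isCompact.cthickening, hg,
    fun j => (hgs j).trans (cthickening_mono (min_le_left _ _) _), hδS,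
    fun j x => le_max_of_le_left ?_, fun j x => le_max_of_le_right ?_,
    fun x => hlim fun j => hg0 j x,
    fun x => ?_⟩
  · have h1 := (hg0 j x).trans (min_le_left _ _)
    have h2 := hM₀ x
    rw [Real.norm_eq_abs] at h2
    have h3 : |g j x| ≤ |g j x - f x| + |f x| := by simpa using abs_add_le (g j x - f x) (f x)
    linarith
  · refine Finset.sum_le_sum fun k _ => ?_
    have h1 := (hg1 j k x).trans (min_le_left _ _)
    have h2 := hM₁ k x
    rw [Real.norm_eq_abs] at h2
    have h3 : |pd k (g j) x| ≤ |pd k (g j) x - pd k f x| + |pd k f x| := by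
      simpa using abs_add_le (pd k (g j) x - pd k f x) (pd k f x)
    rw [← sq_abs]
    exact pow_le_pow_left₀ (abs_nonneg _) (by linarith) 2
  · exact tendsto_finsetSum _ fun k _ => (hlim fun j => hg1 j k x).pow 2

end Mollification

section Stability

variable {n m : ℕ}

theorem tendsto_integral_mul_mul {w W : Euc n → ℝ} (hw : Measurable w) (hW : Continuous W)
    (hwW : ∀ x, |w x| ≤ W x) {K : Set (Euc n)} (hK : IsCompact K) {M M' : ℝ}
    {a b : ℕ → Euc n → ℝ} {a' b' : Euc n → ℝ} (ha : ∀ j, Continuous (a j))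
    (hb : ∀ j, Continuous (b j)) (haK : ∀ j, ∀ x ∉ K, a j x = 0) (haM : ∀ j x, |a j x| ≤ M)
    (hbM : ∀ j x, |b j x| ≤ M') (haa : ∀ x, Tendsto (fun j => a j x) atTop (nhds (a' x)))
    (hbb : ∀ x, Tendsto (fun j => b j x) atTop (nhds (b' x))) :
    Tendsto (fun j => ∫ x, w x * a j x * b j x) atTop (nhds (∫ x, w x * a' x * b' x)) := by
  refine tendsto_integral_of_dominated_convergence (K.indicator fun x => W x * M * M')
    (fun j => ?_) ?_ (fun j => Eventually.of_forall fun x => ?_)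
    (Eventually.of_forall fun x => ((haa x).const_mul _).mul (hbb x))
  · exact ((hw.mul (ha j).measurable).mul (hb j).measurable).aestronglyMeasurable
  · rw [integrable_indicator_iff hK.measurableSet]
    exact ((hW.mul continuous_const).mul continuous_const).continuousOn.integrableOn_compact hK
  · by_cases hx : x ∈ K
    · rw [indicator_of_mem hx, Real.norm_eq_abs, abs_mul, abs_mul]
      have h0 := (abs_nonneg _).trans (hwW x)
      have h1 := (abs_nonneg _).trans (haM j x)
      gcongr
      exacts [hwW x, haM j x, hbM j x]
    · simp [indicator_of_notMem hx, haK j x hx]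

theorem abs_coord_le_norm (y : EuclideanSpace ℝ (Fin m)) (i : Fin m) : |y i| ≤ ‖y‖ := by
  simpa using PiLp.norm_apply_le y i

theorem abs_norm_rpow_mul_coord_le {p : ℝ} (hp : 1 < p) (y : EuclideanSpace ℝ (Fin m))
    (i j : Fin m) : |‖y‖ ^ (p - 3) * y i * y j| ≤ ‖y‖ ^ (p - 1) := by
  rcases eq_or_ne y 0 with rfl | hy
  · simp [Real.zero_rpow (sub_ne_zero.2 hp.ne')]
  · have hpos : 0 < ‖y‖ := norm_pos_iff.2 hy
    have h : ‖y‖ ^ (p - 1) = ‖y‖ ^ (p - 3) * ‖y‖ * ‖y‖ := by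
      rw [← Real.rpow_add_one hpos.ne', ← Real.rpow_add_one hpos.ne']
      ring_nf
    rw [h, abs_mul, abs_mul, abs_of_nonneg (by positivity : 0 ≤ ‖y‖ ^ (p - 3))]
    gcongr <;> exact abs_coord_le_norm _ _

theorem Stable1.of_contDiff_one {p : ℝ} (hp : 1 < p) {u : Euc n → EuclideanSpace ℝ (Fin m)}
    (hu : Continuous u) {S : Set (Euc n)} (hS : IsOpen S) (h : Stable1 n m p u S)
    (φ : Fin m → Euc n → ℝ) (hφ : ∀ i, ContDiff ℝ 1 (φ i)) (hc : ∀ i, HasCompactSupport (φ i))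
    (hφS : ∀ i, tsupport (φ i) ⊆ S) :
    (∑ i, ∫ x, ‖u x‖ ^ (p - 1) * φ i x * φ i x) +
      (p - 1) * ∑ i, ∑ j, ∫ x, ‖u x‖ ^ (p - 3) * u x i * u x j * φ i x * φ j x
      ≤ ∑ i, ∫ x, gradSq (φ i) x := by
  choose g K M hK hg hgK hKS hgM hgM' hlim hlim' using
    fun i => exists_smooth_seq (hφ i) (hc i) hS (hφS i)
  have hz : ∀ i j, ∀ x ∉ K i, g i j x = 0 := fun i j x hx =>
    image_eq_zero_of_notMem_tsupport fun h => hx (hgK i j h)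
  have hst : ∀ j, (∑ i, ∫ x, ‖u x‖ ^ (p - 1) * g i j x * g i j x) +
      (p - 1) * ∑ i, ∑ k, ∫ x, ‖u x‖ ^ (p - 3) * u x i * u x k * g i j x * g k j x
      ≤ ∑ i, ∫ x, gradSq (g i j) x := by
    intro j
    have := h (fun i => g i j) (fun i => hg i j)
      (fun i => (hK i).of_isClosed_subset (isClosed_tsupport _) (hgK i j))
      (fun i => (hgK i j).trans (hKS i))
    simp only [norm_gradient_sq] at this
    simpa only [pow_two, ← mul_assoc] using this
  have hcont : Continuous fun x => ‖u x‖ ^ (p - 1) :=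
    hu.norm.rpow_const fun _ => Or.inr (by linarith)
  refine le_of_tendsto_of_tendsto' (b := atTop) (Tendsto.add (tendsto_finsetSum _ fun i _ => ?_)
    (Tendsto.const_mul _ (tendsto_finsetSum _ fun i _ => tendsto_finsetSum _ fun k _ => ?_)))
    (tendsto_finsetSum _ fun i _ => ?_) hst
  · refine tendsto_integral_mul_mul hcont.measurable hcont (fun x => ?_) (hK i)
      (fun j => (hg i j).continuous) (fun j => (hg i j).continuous) (hz i) (hgM i) (hgM i)
      (hlim i) (hlim i)
    rw [abs_of_nonneg (by positivity)]
  · have hc' : ∀ i, Measurable fun x => u x i := fun i =>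
      (((EuclideanSpace.proj (𝕜 := ℝ) i).continuous).comp hu).measurable
    exact tendsto_integral_mul_mul (((hu.norm.measurable.pow_const _).mul (hc' i)).mul (hc' k))
      hcont (fun x => abs_norm_rpow_mul_coord_le hp (u x) i k) (hK i)
      (fun j => (hg i j).continuous) (fun j => (hg k j).continuous) (hz i) (hgM i) (hgM k)
      (hlim i) (hlim k)
  · have := tendsto_integral_mul_mul (w := fun _ => 1) (W := fun _ => 1) (b := fun _ _ => 1)
      (b' := fun _ => 1) (M' := 1) measurable_const continuous_const (by simp) (hK i)
      (fun j => continuous_gradSq ((hg i j).of_le (by norm_cast)))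
      (fun _ => continuous_const)
      (fun j x hx => gradSq_eq_zero_of_notMem fun h => hx (hgK i j h))
      (fun j x => by rw [abs_of_nonneg (gradSq_nonneg _ _)]; exact hgM' i j x) (by simp)
      (hlim' i) (fun _ => tendsto_const_nhds)
    simpa using this

/-- Stability tested with `ψ u`. -/
theorem Stable1.mul_scalar {p : ℝ} (hp : 1 < p) {u : Euc n → EuclideanSpace ℝ (Fin m)}
    (hu : ContDiff ℝ 1 u) {S : Set (Euc n)} (hS : IsOpen S) (h : Stable1 n m p u S)
    {ψ : Euc n → ℝ} (hψ : ContDiff ℝ 1 ψ) (hc : HasCompactSupport ψ) (hψS : tsupport ψ ⊆ S) :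
    p * ∫ x, ‖u x‖ ^ (p + 1) * ψ x ^ 2 ≤ ∫ x, ∑ i, gradSq (fun y => u y i * ψ y) x := by
  have hui : ∀ i, ContDiff ℝ 1 fun y => u y i := contDiff_euclidean.1 hu
  have hφ : ∀ i, ContDiff ℝ 1 fun y => u y i * ψ y := fun i => (hui i).mul hψ
  have hφc : ∀ i, HasCompactSupport fun y => u y i * ψ y := fun i => hc.mul_left
  have key := h.of_contDiff_one hp hu.continuous hS (fun i y => u y i * ψ y) hφ hφc
    (fun i => (tsupport_mul_subset_right).trans hψS)
  rw [← integral_finsetSum _ fun i _ => (continuous_gradSq (hφ i)).integrable_of_hasCompactSupport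
    (hasCompactSupport_gradSq (hφc i))] at key
  refine le_trans (le_of_eq ?_) key
  have hcont : Continuous fun x => ‖u x‖ ^ (p - 1) :=
    hu.continuous.norm.rpow_const fun _ => Or.inr (by linarith)
  rw [← integral_finsetSum]
  swap
  · intro i _
    exact ((hcont.mul (hφ i).continuous).mul (hφ i).continuous).integrable_of_hasCompactSupport
      (hφc i).mul_left
  have hint : ∀ i j, Integrable fun x =>
      ‖u x‖ ^ (p - 3) * u x i * u x j * (u x i * ψ x) * (u x j * ψ x) := by
    intro i j
    have hb : Integrable fun x => ‖u x‖ ^ (p - 1) * |u x i * ψ x| * |u x j * ψ x| :=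
      ((hcont.mul (hφ i).continuous.abs).mul
        (hφ j).continuous.abs).integrable_of_hasCompactSupport
        ((hφc j).comp_left abs_zero).mul_left
    refine hb.mono' (((((hu.continuous.norm.measurable.pow_const _).mul
      (hui i).continuous.measurable).mul (hui j).continuous.measurable).mul
      (hφ i).continuous.measurable).mul (hφ j).continuous.measurable).aestronglyMeasurable
      (Eventually.of_forall fun x => ?_)
    rw [Real.norm_eq_abs, abs_mul, abs_mul]
    gcongr
    exact abs_norm_rpow_mul_coord_le hp (u x) i j
  simp only [← integral_finsetSum _ fun j _ => hint _ j]
  rw [← integral_finsetSum _ fun i _ => integrable_finsetSum _ fun j _ => hint i j,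
    ← integral_const_mul, ← integral_const_mul, ← integral_add]
  · refine integral_congr_ae (Eventually.of_forall fun x => ?_)
    have hsq : ∑ i, u x i ^ 2 = ‖u x‖ ^ 2 := (EuclideanSpace.real_norm_sq_eq _).symm
    have e1 : ∑ i, ‖u x‖ ^ (p - 1) * (u x i * ψ x) * (u x i * ψ x) =
        ‖u x‖ ^ (p - 1) * ψ x ^ 2 * ‖u x‖ ^ 2 := by
      rw [← hsq, Finset.mul_sum]
      exact Finset.sum_congr rfl fun i _ => by ring
    have e2 : ∑ i, ∑ j, ‖u x‖ ^ (p - 3) * u x i * u x j * (u x i * ψ x) * (u x j * ψ x) =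
        ‖u x‖ ^ (p - 3) * ψ x ^ 2 * (‖u x‖ ^ 2 * ‖u x‖ ^ 2) := by
      rw [← hsq, Finset.sum_mul_sum, Finset.mul_sum]
      refine Finset.sum_congr rfl fun i _ => ?_
      rw [Finset.mul_sum]
      exact Finset.sum_congr rfl fun j _ => by ring
    simp only [e1, e2]
    rcases eq_or_ne (u x) 0 with h0 | h0
    · simp [h0, Real.zero_rpow (by linarith : p + 1 ≠ 0)]
    · have hpos : 0 < ‖u x‖ := norm_pos_iff.2 h0
      have r1 : ‖u x‖ ^ (p - 1) = ‖u x‖ ^ (p - 3) * ‖u x‖ ^ 2 := by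
        rw [← Real.rpow_add_natCast hpos.ne']; norm_num; ring_nf
      have r2 : ‖u x‖ ^ (p + 1) = ‖u x‖ ^ (p - 3) * (‖u x‖ ^ 2 * ‖u x‖ ^ 2) := by
        rw [← pow_add, ← Real.rpow_add_natCast hpos.ne']; norm_num; ring_nf
      rw [r1, r2]
      ring
  · exact integrable_finsetSum _ fun i _ =>
      ((hcont.mul (hφ i).continuous).mul (hφ i).continuous).integrable_of_hasCompactSupport
      (hφc i).mul_left
  · exact (integrable_finsetSum _ fun i _ => integrable_finsetSum _ fun j _ => hint i j).const_mul _

end Stability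

section RadialFunctions

variable {n : ℕ}

theorem pd_comp_norm_sq {h : ℝ → ℝ} {h' : ℝ} {x : Euc n} (hh : HasDerivAt h h' (‖x‖ ^ 2))
    (k : Fin n) : pd k (fun y => h (‖y‖ ^ 2)) x = h' * (2 * x k) := by
  have h1 := hh.comp_hasFDerivAt x (hasStrictFDerivAt_norm_sq x).hasFDerivAt
  have h2 : fderiv ℝ (fun y : Euc n => h (‖y‖ ^ 2)) x = h' • (2 • innerSL ℝ x) := h1.fderiv
  rw [pd, h2]
  simp [EuclideanSpace.inner_single_right]

theorem contDiff_one_add_norm_sq_inv {a : WithTop ℕ∞} :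
    ContDiff ℝ a fun y : Euc n => (1 + ‖y‖ ^ 2)⁻¹ :=
  (contDiff_const.add (contDiff_norm_sq ℝ)).inv fun y => by positivity

theorem contDiff_coord {a : WithTop ℕ∞} (k : Fin n) : ContDiff ℝ a fun y : Euc n => y k :=
  (EuclideanSpace.proj (𝕜 := ℝ) k).contDiff

theorem pd_one_add_norm_sq_inv (x : Euc n) (k : Fin n) :
    pd k (fun y => (1 + ‖y‖ ^ 2)⁻¹) x = -2 * x k * ((1 + ‖x‖ ^ 2)⁻¹) ^ 2 := by
  have h : HasDerivAt (fun t : ℝ => (1 + t)⁻¹) (-1 / (1 + ‖x‖ ^ 2) ^ 2) (‖x‖ ^ 2) :=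
    ((hasDerivAt_id _).const_add 1).fun_inv (by positivity)
  rw [pd_comp_norm_sq h k]
  field_simp

/-- Hardy's inequality with the weight `|x|⁻²` replaced by `(1 + |x|²)⁻¹`. -/
theorem hardy_inequality (hn : 2 ≤ n) {w : Euc n → ℝ} (hw : ContDiff ℝ 1 w)
    (hc : HasCompactSupport w) :
    (((n : ℝ) - 2) / 2) ^ 2 * ∫ x, w x ^ 2 * (1 + ‖x‖ ^ 2)⁻¹ ≤ ∫ x, gradSq w x := by
  set N : ℝ := ((n : ℝ) - 2) / 2 with hN
  have hn' : (2 : ℝ) ≤ n := by exact_mod_cast hn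
  have hN0 : 0 ≤ N := by rw [hN]; linarith
  let F : Fin n → Euc n → ℝ := fun k y => w y ^ 2 * (y k * (1 + ‖y‖ ^ 2)⁻¹)
  have hF : ∀ k, ContDiff ℝ 1 (F k) := fun k =>
    (hw.pow 2).mul ((contDiff_coord k).mul contDiff_one_add_norm_sq_inv)
  have hw2 : HasCompactSupport fun y => w y ^ 2 := hc.comp_left (g := fun t => t ^ 2) (by simp)
  have hFc : ∀ k, HasCompactSupport (F k) := fun k => hw2.mul_right
  have hdiv := integral_sum_pd_eq_zero hF hFc
  have hFd : ∀ k x, pd k (F k) x = 2 * w x * pd k w x * (x k * (1 + ‖x‖ ^ 2)⁻¹) +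
      w x ^ 2 * ((1 + ‖x‖ ^ 2)⁻¹ - 2 * x k ^ 2 * ((1 + ‖x‖ ^ 2)⁻¹) ^ 2) := by
    intro k x
    have d1 := (hw.differentiable one_ne_zero) x
    have d2 := ((contDiff_coord (a := 1) k).differentiable one_ne_zero) x
    have d3 := ((contDiff_one_add_norm_sq_inv (n := n) (a := 1)).differentiable one_ne_zero) x
    change pd k (fun y => w y ^ 2 * (y k * (1 + ‖y‖ ^ 2)⁻¹)) x = _
    rw [pd_mul (d1.fun_pow 2) (d2.fun_mul d3), pd_mul d2 d3, pd_pow d1, pd_coord,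
      pd_one_add_norm_sq_inv,
      if_pos rfl]
    push_cast
    ring
  have hint1 : Integrable fun x => w x ^ 2 * (1 + ‖x‖ ^ 2)⁻¹ :=
    ((hw.pow 2).continuous.mul
      (contDiff_one_add_norm_sq_inv (a := 0)).continuous).integrable_of_hasCompactSupport
      hw2.mul_right
  have hint2 : Integrable (gradSq w) := (continuous_gradSq hw).integrable_of_hasCompactSupport
    (hasCompactSupport_gradSq hc)
  have hint3 : Integrable fun x => ∑ k, pd k (F k) x := integrable_finsetSum _ fun k _ =>
    (continuous_pd (hF k) k).integrable_of_hasCompactSupport (hasCompactSupport_pd (hFc k) k)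
  have hle : ∫ x, N ^ 2 * (w x ^ 2 * (1 + ‖x‖ ^ 2)⁻¹) ≤
      ∫ x, (gradSq w x + N * ∑ k, pd k (F k) x) := by
    refine integral_mono (hint1.const_mul _) (hint2.add (hint3.const_mul _)) fun x => ?_
    simp only [hFd]
    set ρ : ℝ := (1 + ‖x‖ ^ 2)⁻¹ with hρ
    have hρ0 : 0 < ρ := by positivity
    have hr : ∑ k, x k ^ 2 = ‖x‖ ^ 2 := (EuclideanSpace.real_norm_sq_eq x).symm
    have hρ1 : ‖x‖ ^ 2 * ρ = 1 - ρ := by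
      have : (1 + ‖x‖ ^ 2) * ρ = 1 := mul_inv_cancel₀ (by positivity)
      linarith
    have hsq : 0 ≤ ∑ k, (pd k w x + N * w x * x k * ρ) ^ 2 :=
      Finset.sum_nonneg fun _ _ => sq_nonneg _
    have hexp : ∑ k, (pd k w x + N * w x * x k * ρ) ^ 2 =
        gradSq w x + 2 * N * ρ * w x * ∑ k, pd k w x * x k + N ^ 2 * w x ^ 2 * ρ ^ 2 * ‖x‖ ^ 2 := by
      rw [← hr, gradSq, Finset.mul_sum, Finset.mul_sum, ← Finset.sum_add_distrib,
        ← Finset.sum_add_distrib]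
      exact Finset.sum_congr rfl fun k _ => by ring
    have hsum : ∑ k, (2 * w x * pd k w x * (x k * ρ) + w x ^ 2 * (ρ - 2 * x k ^ 2 * ρ ^ 2)) =
        2 * ρ * w x * ∑ k, pd k w x * x k + w x ^ 2 * ρ * n - 2 * w x ^ 2 * ρ ^ 2 * ‖x‖ ^ 2 := by
      have hcard : (n : ℝ) = ∑ _k : Fin n, (1 : ℝ) := by simp
      rw [← hr, hcard, Finset.mul_sum, Finset.mul_sum, Finset.mul_sum, ← Finset.sum_add_distrib,
        ← Finset.sum_sub_distrib]
      exact Finset.sum_congr rfl fun k _ => by ring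
    rw [hsum]
    rw [hexp] at hsq
    have hn2 : (n : ℝ) = 2 * N + 2 := by rw [hN]; ring
    rw [hn2]
    have hrr : ρ ^ 2 * ‖x‖ ^ 2 = ρ * (1 - ρ) := by rw [← hρ1]; ring
    have hpos : 0 ≤ (N ^ 2 + 2 * N) * w x ^ 2 * ρ ^ 2 := by positivity
    have e1 : N ^ 2 * w x ^ 2 * ρ ^ 2 * ‖x‖ ^ 2 = N ^ 2 * w x ^ 2 * (ρ * (1 - ρ)) := by
      rw [← hrr]; ring
    have e2 : 2 * w x ^ 2 * ρ ^ 2 * ‖x‖ ^ 2 = 2 * w x ^ 2 * (ρ * (1 - ρ)) := by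
      rw [← hrr]; ring
    rw [e1] at hsq
    rw [e2]
    nlinarith
  rw [integral_const_mul, integral_add hint2 (hint3.const_mul _), integral_const_mul, hdiv] at hle
  linarith

end RadialFunctions

section Energy

variable {n m : ℕ} {p : ℝ} {u : Euc n → EuclideanSpace ℝ (Fin m)}

theorem sum_coord_mul_lap (hp : 1 < p)
    (hsol : ∀ (i : Fin m) (x : Euc n), - lap (fun z => u z i) x = ‖u x‖ ^ (p - 1) * u x i)
    (x : Euc n) : ∑ i, u x i * lap (fun z => u z i) x = -‖u x‖ ^ (p + 1) := by
  have h : ∀ i, u x i * lap (fun z => u z i) x = -‖u x‖ ^ (p - 1) * u x i ^ 2 := fun i => by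
    linear_combination -u x i * hsol i x
  simp only [h]
  rw [← Finset.mul_sum, ← EuclideanSpace.real_norm_sq_eq, neg_mul, neg_inj,
    ← Real.rpow_natCast, ← Real.rpow_add' (norm_nonneg _) (by norm_num; linarith)]
  norm_num
  ring_nf

theorem continuous_norm_rpow_add_one (hp : 1 < p) (hu : Continuous u) :
    Continuous fun x => ‖u x‖ ^ (p + 1) :=
  hu.norm.rpow_const fun _ => Or.inr (by linarith)

theorem integral_sum_gradSq_mul (hp : 1 < p) (hu : ContDiff ℝ 2 u)
    (hsol : ∀ (i : Fin m) (x : Euc n), - lap (fun z => u z i) x = ‖u x‖ ^ (p - 1) * u x i)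
    {ψ : Euc n → ℝ} (hψ : ContDiff ℝ 1 ψ) (hc : HasCompactSupport ψ) :
    ∫ x, ∑ i, gradSq (fun y => u y i * ψ y) x =
      (∫ x, ‖u x‖ ^ (p + 1) * ψ x ^ 2) + ∫ x, ‖u x‖ ^ 2 * gradSq ψ x := by
  have hui : ∀ i, ContDiff ℝ 2 fun y => u y i := contDiff_euclidean.1 hu
  have hui1 : ∀ i, ContDiff ℝ 1 fun y => u y i := fun i => (hui i).of_le (by norm_num)
  have hpd : ∀ i k, ContDiff ℝ 1 (pd k fun y => u y i) := fun i k =>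
    contDiff_pd (hui i) (by norm_num) k
  have hψ2 : HasCompactSupport fun y => ψ y ^ 2 := hc.comp_left (g := fun t => t ^ 2) (by simp)
  let F : Fin n → Euc n → ℝ := fun k y => (∑ i, u y i * pd k (fun z => u z i) y) * ψ y ^ 2
  have hF : ∀ k, ContDiff ℝ 1 (F k) := fun k =>
    (ContDiff.sum fun i _ => (hui1 i).mul (hpd i k)).mul (hψ.pow 2)
  have hFc : ∀ k, HasCompactSupport (F k) := fun k => hψ2.mul_left
  have hdiv := integral_sum_pd_eq_zero hF hFc
  have hpt : ∀ x, ∑ i, gradSq (fun y => u y i * ψ y) x =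
      ∑ k, pd k (F k) x + (‖u x‖ ^ (p + 1) * ψ x ^ 2 + ‖u x‖ ^ 2 * gradSq ψ x) := by
    intro x
    have d1 : ∀ i, DifferentiableAt ℝ (fun y => u y i) x := fun i =>
      (hui1 i).differentiable one_ne_zero x
    have d2 : ∀ i k, DifferentiableAt ℝ (pd k fun y => u y i) x := fun i k =>
      (hpd i k).differentiable one_ne_zero x
    have d3 : DifferentiableAt ℝ ψ x := hψ.differentiable one_ne_zero x
    have hFd : ∀ k, pd k (F k) x = (∑ i, (pd k (fun z => u z i) x ^ 2 * ψ x ^ 2 +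
        u x i * pd k (pd k fun z => u z i) x * ψ x ^ 2 +
        2 * u x i * pd k (fun z => u z i) x * ψ x * pd k ψ x)) := by
      intro k
      change pd k (fun y => (∑ i, u y i * pd k (fun z => u z i) y) * ψ y ^ 2) x = _
      rw [pd_mul (.fun_sum fun i _ => (d1 i).fun_mul (d2 i k)) (d3.fun_pow 2),
        pd_sum fun i _ => (d1 i).fun_mul (d2 i k), pd_pow d3, Finset.sum_mul, Finset.sum_mul,
        ← Finset.sum_add_distrib]
      refine Finset.sum_congr rfl fun i _ => ?_
      rw [pd_mul (d1 i) (d2 i k)]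
      push_cast
      ring
    have hl := sum_coord_mul_lap hp hsol x
    simp only [lap_eq_sum_pd (hui _)] at hl
    rw [← neg_eq_iff_eq_neg] at hl
    rw [← hl, EuclideanSpace.real_norm_sq_eq]
    simp only [hFd, gradSq]
    rw [Finset.sum_comm (s := (Finset.univ : Finset (Fin n))), neg_mul, Finset.sum_mul,
      Finset.sum_mul, ← Finset.sum_neg_distrib, ← Finset.sum_add_distrib,
      ← Finset.sum_add_distrib]
    refine Finset.sum_congr rfl fun i _ => ?_
    rw [Finset.mul_sum, Finset.mul_sum, Finset.sum_mul, ← Finset.sum_neg_distrib,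
      ← Finset.sum_add_distrib, ← Finset.sum_add_distrib]
    refine Finset.sum_congr rfl fun k _ => ?_
    rw [pd_mul (d1 i) d3]
    ring
  have hint1 : Integrable fun x => ∑ k, pd k (F k) x := integrable_finsetSum _ fun k _ =>
    (continuous_pd (hF k) k).integrable_of_hasCompactSupport (hasCompactSupport_pd (hFc k) k)
  have hint2 : Integrable fun x => ‖u x‖ ^ (p + 1) * ψ x ^ 2 :=
    ((continuous_norm_rpow_add_one hp hu.continuous).mul
      (hψ.continuous.pow 2)).integrable_of_hasCompactSupport hψ2.mul_left
  have hint3 : Integrable fun x => ‖u x‖ ^ 2 * gradSq ψ x :=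
    ((hu.continuous.norm.pow 2).mul
      (continuous_gradSq hψ)).integrable_of_hasCompactSupport (hasCompactSupport_gradSq hc).mul_left
  simp only [hpt]
  rw [integral_add hint1 (hint2.fun_add hint3), hdiv, integral_add hint2 hint3, zero_add]

end Energy

section StableEnergy

variable {n m : ℕ} {p : ℝ} {u : Euc n → EuclideanSpace ℝ (Fin m)} {S : Set (Euc n)}
  {ψ : Euc n → ℝ}

theorem hasCompactSupport_sq (hc : HasCompactSupport ψ) : HasCompactSupport fun y => ψ y ^ 2 :=
  hc.comp_left (g := fun t => t ^ 2) (by simp)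

theorem integrable_norm_rpow_mul_sq (hp : 1 < p) (hu : Continuous u) (hψ : Continuous ψ)
    (hc : HasCompactSupport ψ) : Integrable fun x => ‖u x‖ ^ (p + 1) * ψ x ^ 2 :=
  ((continuous_norm_rpow_add_one hp hu).mul (hψ.pow 2)).integrable_of_hasCompactSupport
    (hasCompactSupport_sq hc).mul_left

theorem integrable_norm_sq_mul_gradSq (hu : Continuous u) (hψ : ContDiff ℝ 1 ψ)
    (hc : HasCompactSupport ψ) : Integrable fun x => ‖u x‖ ^ 2 * gradSq ψ x :=
  ((hu.norm.pow 2).mul (continuous_gradSq hψ)).integrable_of_hasCompactSupport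
    (hasCompactSupport_gradSq hc).mul_left

theorem stable_energy_le (hp : 1 < p) (hu : ContDiff ℝ 2 u)
    (hsol : ∀ (i : Fin m) (x : Euc n), - lap (fun z => u z i) x = ‖u x‖ ^ (p - 1) * u x i)
    (hS : IsOpen S) (h : Stable1 n m p u S) (hψ : ContDiff ℝ 1 ψ) (hc : HasCompactSupport ψ)
    (hψS : tsupport ψ ⊆ S) :
    (p - 1) * ∫ x, ‖u x‖ ^ (p + 1) * ψ x ^ 2 ≤ ∫ x, ‖u x‖ ^ 2 * gradSq ψ x := by
  have h1 := h.mul_scalar hp (hu.of_le (by norm_num)) hS hψ hc hψS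
  rw [integral_sum_gradSq_mul hp hu hsol hψ hc] at h1
  linarith

theorem stable_dirichlet_le (hp : 1 < p) (hu : ContDiff ℝ 2 u)
    (hsol : ∀ (i : Fin m) (x : Euc n), - lap (fun z => u z i) x = ‖u x‖ ^ (p - 1) * u x i)
    (hS : IsOpen S) (h : Stable1 n m p u S) (hψ : ContDiff ℝ 1 ψ) (hc : HasCompactSupport ψ)
    (hψS : tsupport ψ ⊆ S) :
    (p - 1) * ∫ x, ∑ i, gradSq (fun y => u y i * ψ y) x ≤ p * ∫ x, ‖u x‖ ^ 2 * gradSq ψ x := by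
  have h1 := stable_energy_le hp hu hsol hS h hψ hc hψS
  rw [integral_sum_gradSq_mul hp hu hsol hψ hc]
  linarith

theorem stable_hardy_le (hn : 2 ≤ n) (hp : 1 < p) (hu : ContDiff ℝ 2 u)
    (hsol : ∀ (i : Fin m) (x : Euc n), - lap (fun z => u z i) x = ‖u x‖ ^ (p - 1) * u x i)
    (hS : IsOpen S) (h : Stable1 n m p u S) (hψ : ContDiff ℝ 1 ψ) (hc : HasCompactSupport ψ)
    (hψS : tsupport ψ ⊆ S) :
    (p - 1) * ((((n : ℝ) - 2) / 2) ^ 2 * ∫ x, ‖u x‖ ^ 2 * ψ x ^ 2 * (1 + ‖x‖ ^ 2)⁻¹) ≤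
      p * ∫ x, ‖u x‖ ^ 2 * gradSq ψ x := by
  refine le_trans ?_ (stable_dirichlet_le hp hu hsol hS h hψ hc hψS)
  refine mul_le_mul_of_nonneg_left ?_ (by linarith)
  have hui : ∀ i, ContDiff ℝ 1 fun y => u y i := contDiff_euclidean.1 (hu.of_le (by norm_num))
  have hφ : ∀ i, ContDiff ℝ 1 fun y => u y i * ψ y := fun i => (hui i).mul hψ
  have hφc : ∀ i, HasCompactSupport fun y => u y i * ψ y := fun i => hc.mul_left
  rw [integral_finsetSum _ fun i _ => (continuous_gradSq (hφ i)).integrable_of_hasCompactSupport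
    (hasCompactSupport_gradSq (hφc i))]
  have hint : ∀ i, Integrable fun x => (u x i * ψ x) ^ 2 * (1 + ‖x‖ ^ 2)⁻¹ := fun i =>
    (((hφ i).continuous.pow 2).mul
      (contDiff_one_add_norm_sq_inv (a := 0)).continuous).integrable_of_hasCompactSupport
      (hasCompactSupport_sq (hφc i)).mul_right
  have hsum : ∀ x, ‖u x‖ ^ 2 * ψ x ^ 2 * (1 + ‖x‖ ^ 2)⁻¹ =
      ∑ i, (u x i * ψ x) ^ 2 * (1 + ‖x‖ ^ 2)⁻¹ := fun x => by
    rw [EuclideanSpace.real_norm_sq_eq, Finset.sum_mul, Finset.sum_mul]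
    exact Finset.sum_congr rfl fun i _ => by ring
  simp only [hsum]
  rw [integral_finsetSum _ fun i _ => hint i, Finset.mul_sum]
  exact Finset.sum_le_sum fun i _ => hardy_inequality hn (hφ i) (hφc i)

theorem continuous_sum_gradSq (hu : ContDiff ℝ 1 u) :
    Continuous fun x => ∑ i, gradSq (fun y => u y i) x :=
  continuous_finsetSum _ fun i _ => continuous_gradSq (contDiff_euclidean.1 hu i)

theorem stable_gradSq_le (hp : 1 < p) (hu : ContDiff ℝ 2 u)
    (hsol : ∀ (i : Fin m) (x : Euc n), - lap (fun z => u z i) x = ‖u x‖ ^ (p - 1) * u x i)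
    (hS : IsOpen S) (h : Stable1 n m p u S) (hψ : ContDiff ℝ 1 ψ) (hc : HasCompactSupport ψ)
    (hψS : tsupport ψ ⊆ S) :
    ∫ x, (∑ i, gradSq (fun y => u y i) x) * ψ x ^ 2 ≤
      (2 * (p / (p - 1)) + 2) * ∫ x, ‖u x‖ ^ 2 * gradSq ψ x := by
  have h1 := stable_dirichlet_le hp hu hsol hS h hψ hc hψS
  have hu1 : ContDiff ℝ 1 u := hu.of_le (by norm_num)
  have hui : ∀ i, ContDiff ℝ 1 fun y => u y i := contDiff_euclidean.1 hu1
  have hφ : ∀ i, ContDiff ℝ 1 fun y => u y i * ψ y := fun i => (hui i).mul hψ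
  have hφc : ∀ i, HasCompactSupport fun y => u y i * ψ y := fun i => hc.mul_left
  have hint1 : Integrable fun x => (∑ i, gradSq (fun y => u y i) x) * ψ x ^ 2 :=
    ((continuous_sum_gradSq hu1).mul (hψ.continuous.pow 2)).integrable_of_hasCompactSupport
      (hasCompactSupport_sq hc).mul_left
  have hint2 : Integrable fun x => ∑ i, gradSq (fun y => u y i * ψ y) x :=
    integrable_finsetSum _ fun i _ => (continuous_gradSq (hφ i)).integrable_of_hasCompactSupport
      (hasCompactSupport_gradSq (hφc i))
  have hint3 := integrable_norm_sq_mul_gradSq hu.continuous hψ hc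
  have hle : ∫ x, (∑ i, gradSq (fun y => u y i) x) * ψ x ^ 2 ≤
      ∫ x, (2 * ∑ i, gradSq (fun y => u y i * ψ y) x + 2 * (‖u x‖ ^ 2 * gradSq ψ x)) := by
    refine integral_mono hint1 ((hint2.const_mul 2).add (hint3.const_mul 2)) fun x => ?_
    simp only [gradSq]
    rw [EuclideanSpace.real_norm_sq_eq, Finset.sum_mul, Finset.sum_mul, Finset.mul_sum,
      Finset.mul_sum, ← Finset.sum_add_distrib]
    refine Finset.sum_le_sum fun i _ => ?_
    rw [Finset.sum_mul, Finset.mul_sum, Finset.mul_sum, Finset.mul_sum, ← Finset.sum_add_distrib]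
    refine Finset.sum_le_sum fun k _ => ?_
    rw [pd_mul ((hui i).differentiable one_ne_zero x) (hψ.differentiable one_ne_zero x)]
    nlinarith [sq_nonneg (pd k (fun y => u y i) x * ψ x + 2 * (u x i * pd k ψ x))]
  rw [integral_add (hint2.const_mul 2) (hint3.const_mul 2), integral_const_mul,
    integral_const_mul] at hle
  have hp1 : 0 < p - 1 := by linarith
  have h2 : ∫ x, ∑ i, gradSq (fun y => u y i * ψ y) x ≤
      p / (p - 1) * ∫ x, ‖u x‖ ^ 2 * gradSq ψ x := by
    rw [div_mul_eq_mul_div, le_div_iff₀ hp1]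
    linarith
  linarith

end StableEnergy

section Cutoffs

variable {n : ℕ}

/-- A smooth cutoff `ball` equal to one on the unit ball and supported in the ball of radius two,
together with a smooth cutoff `annulus` equal to one wherever `ball` is not locally constant. -/
structure CutoffPair (n : ℕ) where
  ball : Euc n → ℝ
  annulus : Euc n → ℝ
  contDiff_ball : ContDiff ℝ (⊤ : ℕ∞) ball
  contDiff_annulus : ContDiff ℝ (⊤ : ℕ∞) annulus
  ball_nonneg : ∀ x, 0 ≤ ball x
  ball_le_one : ∀ x, ball x ≤ 1
  annulus_nonneg : ∀ x, 0 ≤ annulus x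
  annulus_le_one : ∀ x, annulus x ≤ 1
  ball_eq_one : ∀ x, ‖x‖ ≤ 1 → ball x = 1
  ball_eq_zero : ∀ x, 2 ≤ ‖x‖ → ball x = 0
  annulus_eq_one : ∀ x, 1 ≤ ‖x‖ → ‖x‖ ≤ 2 → annulus x = 1
  annulus_eq_zero_of_le : ∀ x, ‖x‖ ≤ 1 / 2 → annulus x = 0
  annulus_eq_zero_of_ge : ∀ x, 4 ≤ ‖x‖ → annulus x = 0

theorem nonempty_cutoffPair (n : ℕ) : Nonempty (CutoffPair n) := by
  let f : ContDiffBump (0 : Euc n) := ⟨1, 2, one_pos, one_lt_two⟩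
  have h1 : ∀ x : Euc n, ‖x‖ ≤ 1 → f x = 1 := fun x hx =>
    f.one_of_mem_closedBall (by simpa using hx)
  have h0 : ∀ x : Euc n, 2 ≤ ‖x‖ → f x = 0 := fun x hx =>
    f.zero_of_le_dist (by simpa using hx)
  have hs1 : ∀ x : Euc n, ‖(2⁻¹ : ℝ) • x‖ = 2⁻¹ * ‖x‖ := fun x => by simp [norm_smul]
  have hs2 : ∀ x : Euc n, ‖(2 : ℝ) • x‖ = 2 * ‖x‖ := fun x => by simp [norm_smul]
  refine ⟨⟨f, fun x => f ((2⁻¹ : ℝ) • x) - f ((2 : ℝ) • x), f.contDiff,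
    (f.contDiff.comp (contDiff_const_smul _)).sub (f.contDiff.comp (contDiff_const_smul _)),
    fun _ => f.nonneg, fun _ => f.le_one, fun x => ?_, fun x => ?_, h1, h0, fun x hx hx' => ?_,
    fun x hx => ?_, fun x hx => ?_⟩⟩
  · rcases le_total ‖x‖ 1 with hx | hx
    · rw [h1 ((2⁻¹ : ℝ) • x) (by rw [hs1]; linarith)]
      linarith [f.le_one (x := (2 : ℝ) • x)]
    · rw [h0 ((2 : ℝ) • x) (by rw [hs2]; linarith)]
      linarith [f.nonneg (x := (2⁻¹ : ℝ) • x)]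
  · linarith [f.le_one (x := (2⁻¹ : ℝ) • x), f.nonneg (x := (2 : ℝ) • x)]
  · rw [h1 ((2⁻¹ : ℝ) • x) (by rw [hs1]; linarith), h0 ((2 : ℝ) • x) (by rw [hs2]; linarith)]
    norm_num
  · rw [h1 ((2⁻¹ : ℝ) • x) (by rw [hs1]; linarith [norm_nonneg x]),
      h1 ((2 : ℝ) • x) (by rw [hs2]; linarith)]
    norm_num
  · rw [h0 ((2⁻¹ : ℝ) • x) (by rw [hs1]; linarith), h0 ((2 : ℝ) • x) (by rw [hs2]; linarith)]
    norm_num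

theorem hasCompactSupport_of_norm_ge {f : Euc n → ℝ} {r : ℝ} (hf : ∀ x, r ≤ ‖x‖ → f x = 0) :
    HasCompactSupport f :=
  HasCompactSupport.intro (isCompact_closedBall (0 : Euc n) r) fun x hx =>
    hf x (not_lt.1 fun h => hx (by simpa using h.le))

theorem tsupport_subset_of_norm_lt {f : Euc n → ℝ} {r : ℝ} (hf : ∀ x, ‖x‖ < r → f x = 0) :
    tsupport f ⊆ {x | r ≤ ‖x‖} :=
  closure_minimal (fun x hx => not_lt.1 fun h => hx (hf x h))
    (isClosed_le continuous_const continuous_norm)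

theorem pd_eq_zero_of_eventuallyEq_const {f : Euc n → ℝ} {x : Euc n} {c : ℝ}
    (h : f =ᶠ[nhds x] fun _ => c) (k : Fin n) : pd k f x = 0 := by
  simp [pd, h.fderiv_eq]

namespace CutoffPair

variable (c : CutoffPair n)

theorem hasCompactSupport_ball : HasCompactSupport c.ball :=
  hasCompactSupport_of_norm_ge c.ball_eq_zero

theorem hasCompactSupport_annulus : HasCompactSupport c.annulus :=
  hasCompactSupport_of_norm_ge c.annulus_eq_zero_of_ge

theorem contDiff_ball_one : ContDiff ℝ 1 c.ball := c.contDiff_ball.of_le (by norm_cast)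

theorem contDiff_annulus_one : ContDiff ℝ 1 c.annulus := c.contDiff_annulus.of_le (by norm_cast)

theorem pd_ball_eq_zero {x : Euc n} (hx : ‖x‖ < 1 ∨ 2 < ‖x‖) (k : Fin n) :
    pd k c.ball x = 0 := by
  rcases hx with hx | hx
  · refine pd_eq_zero_of_eventuallyEq_const (c := 1) ?_ k
    filter_upwards [(isOpen_lt continuous_norm continuous_const).mem_nhds hx] with y hy
    exact c.ball_eq_one y (le_of_lt hy)
  · refine pd_eq_zero_of_eventuallyEq_const (c := 0) ?_ k
    filter_upwards [(isOpen_lt continuous_const continuous_norm).mem_nhds hx] with y hy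
    exact c.ball_eq_zero y (le_of_lt hy)

theorem exists_abs_pd_ball_le :
    ∃ C : ℝ, 0 < C ∧ ∀ (a : ℕ) k x, |pd k c.ball x| ≤ C * c.annulus x ^ a := by
  have hbd : ∀ k, ∃ C, ∀ x, ‖pd k c.ball x‖ ≤ C := fun k =>
    (hasCompactSupport_pd c.hasCompactSupport_ball k).exists_bound_of_continuous
      (continuous_pd c.contDiff_ball_one k)
  choose C hC using hbd
  have hC0 : ∀ k, 0 ≤ C k := fun k => (norm_nonneg _).trans (hC k 0)
  refine ⟨∑ k, C k + 1, by have := Finset.sum_nonneg fun k (_ : k ∈ Finset.univ) => hC0 k; linarith,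
    fun a k x => ?_⟩
  by_cases hx : 1 ≤ ‖x‖ ∧ ‖x‖ ≤ 2
  · rw [c.annulus_eq_one x hx.1 hx.2, one_pow, mul_one]
    have := Finset.single_le_sum (fun k _ => hC0 k) (Finset.mem_univ k)
    have := hC k x
    rw [Real.norm_eq_abs] at this
    linarith
  · rw [c.pd_ball_eq_zero (by by_contra! h; exact hx h), abs_zero]
    have := c.annulus_nonneg x
    have := Finset.sum_nonneg fun k (_ : k ∈ Finset.univ) => hC0 k
    positivity

theorem exists_gradSq_ball_le :
    ∃ C : ℝ, 0 < C ∧ ∀ (a : ℕ) x, gradSq c.ball x ≤ C * c.annulus x ^ a := by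
  obtain ⟨C, hC0, hC⟩ := c.exists_abs_pd_ball_le
  refine ⟨n * C ^ 2 + 1, by positivity, fun a x => ?_⟩
  have h1 : gradSq c.ball x ≤ ∑ _k : Fin n, C ^ 2 * c.annulus x ^ a := by
    refine Finset.sum_le_sum fun k _ => ?_
    rw [← sq_abs, pow_two, pow_two, mul_assoc]
    have h2 := hC a k x
    have h3 := hC 0 k x
    rw [pow_zero, mul_one] at h3
    exact mul_le_mul h3 h2 (abs_nonneg _) hC0.le
  have h4 : 0 ≤ c.annulus x ^ a := pow_nonneg (c.annulus_nonneg x) a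
  simp only [Finset.sum_const, Finset.card_univ, Fintype.card_fin, nsmul_eq_mul] at h1
  nlinarith

theorem exists_gradSq_annulus_le : ∃ C : ℝ, 0 < C ∧ ∀ x, gradSq c.annulus x ≤ C := by
  obtain ⟨C, hC⟩ := (hasCompactSupport_gradSq c.hasCompactSupport_annulus).exists_bound_of_continuous
    (continuous_gradSq c.contDiff_annulus_one)
  refine ⟨|C| + 1, by positivity, fun x => ?_⟩
  have := hC x
  rw [Real.norm_eq_abs] at this
  linarith [le_abs_self (gradSq c.annulus x), le_abs_self C]

end CutoffPair

end Cutoffs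

section AnnularMass

variable {n m : ℕ} {p : ℝ} {u : Euc n → EuclideanSpace ℝ (Fin m)} {R₀ : ℝ}

theorem subset_compl_closure_ball {r : ℝ} (hr : R₀ < r) :
    {x : Euc n | r ≤ ‖x‖} ⊆ (closure (ball (0 : Euc n) R₀))ᶜ := fun x hx h => by
  have h1 := closure_ball_subset_closedBall h
  rw [mem_closedBall_zero_iff] at h1
  exact absurd (hx.trans h1) (not_le.2 hr)

theorem norm_inv_smul {R : ℝ} (hR : 0 < R) (x : Euc n) : ‖R⁻¹ • x‖ = ‖x‖ / R := by
  rw [norm_smul, Real.norm_eq_abs, abs_of_pos (inv_pos.2 hR), div_eq_inv_mul]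

namespace CutoffPair

variable (c : CutoffPair n)

theorem annulus_smul_eq_zero_of_le {R : ℝ} (hR : 0 < R) {x : Euc n} (hx : ‖x‖ ≤ R / 2) :
    c.annulus (R⁻¹ • x) = 0 :=
  c.annulus_eq_zero_of_le _ (by rw [norm_inv_smul hR, div_le_iff₀ hR]; linarith)

theorem annulus_smul_eq_zero_of_ge {R : ℝ} (hR : 0 < R) {x : Euc n} (hx : 4 * R ≤ ‖x‖) :
    c.annulus (R⁻¹ • x) = 0 :=
  c.annulus_eq_zero_of_ge _ (by rw [norm_inv_smul hR, le_div_iff₀ hR]; linarith)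

theorem ball_smul_eq_one {R : ℝ} (hR : 0 < R) {x : Euc n} (hx : ‖x‖ ≤ R) :
    c.ball (R⁻¹ • x) = 1 :=
  c.ball_eq_one _ (by rw [norm_inv_smul hR, div_le_iff₀ hR]; linarith)

theorem ball_smul_eq_zero {R : ℝ} (hR : 0 < R) {x : Euc n} (hx : 2 * R ≤ ‖x‖) :
    c.ball (R⁻¹ • x) = 0 :=
  c.ball_eq_zero _ (by rw [norm_inv_smul hR, le_div_iff₀ hR]; linarith)

theorem contDiff_annulus_smul (R : ℝ) : ContDiff ℝ 1 fun x => c.annulus (R⁻¹ • x) :=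
  c.contDiff_annulus_one.comp (contDiff_const_smul _)

theorem contDiff_ball_smul (R : ℝ) : ContDiff ℝ 1 fun x => c.ball (R⁻¹ • x) :=
  c.contDiff_ball_one.comp (contDiff_const_smul _)

theorem hasCompactSupport_annulus_smul {R : ℝ} (hR : 0 < R) :
    HasCompactSupport fun x => c.annulus (R⁻¹ • x) :=
  hasCompactSupport_of_norm_ge fun _ hx => c.annulus_smul_eq_zero_of_ge hR hx

theorem hasCompactSupport_ball_smul {R : ℝ} (hR : 0 < R) :
    HasCompactSupport fun x => c.ball (R⁻¹ • x) :=
  hasCompactSupport_of_norm_ge fun _ hx => c.ball_smul_eq_zero hR hx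

theorem hasCompactSupport_annulus_smul_pow {R : ℝ} (hR : 0 < R) {a : ℕ} (ha : a ≠ 0) :
    HasCompactSupport fun x => c.annulus (R⁻¹ • x) ^ a :=
  (c.hasCompactSupport_annulus_smul hR).comp_left (g := fun t => t ^ a) (by simp [ha])

end CutoffPair

/-- The rescaled mass `R⁻² ∫ |u|²` localized to the annulus of radius comparable to `R`. -/
def annularMass (c : CutoffPair n) (u : Euc n → EuclideanSpace ℝ (Fin m)) (a : ℕ) (R : ℝ) : ℝ :=
  ∫ x, R⁻¹ ^ 2 * ‖u x‖ ^ 2 * c.annulus (R⁻¹ • x) ^ (2 * a)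

theorem annularMass_nonneg (c : CutoffPair n) (u : Euc n → EuclideanSpace ℝ (Fin m)) (a : ℕ)
    (R : ℝ) : 0 ≤ annularMass c u a R :=
  integral_nonneg fun x => by
    have := c.annulus_nonneg (R⁻¹ • x)
    positivity

theorem integrable_annularMass (c : CutoffPair n) (hu : Continuous u) {a : ℕ} (ha : a ≠ 0)
    {R : ℝ} (hR : 0 < R) :
    Integrable fun x => R⁻¹ ^ 2 * ‖u x‖ ^ 2 * c.annulus (R⁻¹ • x) ^ (2 * a) :=
  ((continuous_const.mul (hu.norm.pow 2)).mul
    ((c.contDiff_annulus_smul R).continuous.pow (2 * a))).integrable_of_hasCompactSupport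
    (c.hasCompactSupport_annulus_smul_pow hR (by simpa using ha)).mul_left

theorem exists_annular_energy_le (c : CutoffPair n) (hp : 1 < p) (hu : ContDiff ℝ 2 u)
    (hsol : ∀ (i : Fin m) (x : Euc n), - lap (fun z => u z i) x = ‖u x‖ ^ (p - 1) * u x i)
    (hR₀ : 0 < R₀) (h : Stable1 n m p u (closure (ball (0 : Euc n) R₀))ᶜ) {a : ℕ} (ha : a ≠ 0) :
    ∃ K : ℝ, 0 < K ∧ ∀ R, 2 * (R₀ + 1) ≤ R →
      ∫ x, ‖u x‖ ^ (p + 1) * (c.annulus (R⁻¹ • x) ^ (a + 1)) ^ 2 ≤ K * annularMass c u a R ∧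
      ∫ x, (∑ i, gradSq (fun y => u y i) x) * (c.annulus (R⁻¹ • x) ^ (a + 1)) ^ 2 ≤
        K * annularMass c u a R := by
  obtain ⟨C, hC0, hC⟩ := c.exists_gradSq_annulus_le
  have hp1 : 0 < p - 1 := by linarith
  set D : ℝ := ((a + 1 : ℕ) : ℝ) ^ 2 * C with hD
  have hD0 : 0 < D := by positivity
  have hq : 0 < 2 * (p / (p - 1)) + 2 := by positivity
  refine ⟨D / (p - 1) + (2 * (p / (p - 1)) + 2) * D, by positivity, fun R hR => ?_⟩
  have hR0 : 0 < R := by linarith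
  have hψ : ContDiff ℝ 1 fun x => c.annulus (R⁻¹ • x) ^ (a + 1) := (c.contDiff_annulus_smul R).pow _
  have hc : HasCompactSupport fun x => c.annulus (R⁻¹ • x) ^ (a + 1) :=
    c.hasCompactSupport_annulus_smul_pow hR0 a.succ_ne_zero
  have hS : tsupport (fun x => c.annulus (R⁻¹ • x) ^ (a + 1)) ⊆
      (closure (ball (0 : Euc n) R₀))ᶜ :=
    (tsupport_subset_of_norm_lt (r := R / 2) fun x hx => by
      rw [c.annulus_smul_eq_zero_of_le hR0 hx.le, zero_pow a.succ_ne_zero]).trans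
      (subset_compl_closure_ball (by linarith))
  have hgrad : ∫ x, ‖u x‖ ^ 2 * gradSq (fun y => c.annulus (R⁻¹ • y) ^ (a + 1)) x ≤
      D * annularMass c u a R := by
    rw [annularMass, ← integral_const_mul]
    refine integral_mono (integrable_norm_sq_mul_gradSq hu.continuous hψ hc)
      ((integrable_annularMass c hu.continuous ha hR0).const_mul D) fun x => ?_
    beta_reduce
    rw [gradSq_pow ((c.contDiff_annulus_smul R).differentiable one_ne_zero x),
      gradSq_comp_smul, Nat.add_sub_cancel, hD]
    have h1 := hC (R⁻¹ • x)
    have h2 := pow_nonneg (c.annulus_nonneg (R⁻¹ • x)) (2 * a)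
    calc _ = (((a + 1 : ℕ) : ℝ) ^ 2 * (R⁻¹ ^ 2 * ‖u x‖ ^ 2 * c.annulus (R⁻¹ • x) ^ (2 * a))) *
          gradSq c.annulus (R⁻¹ • x) := by ring
      _ ≤ (((a + 1 : ℕ) : ℝ) ^ 2 * (R⁻¹ ^ 2 * ‖u x‖ ^ 2 * c.annulus (R⁻¹ • x) ^ (2 * a))) * C :=
        mul_le_mul_of_nonneg_left h1 (by positivity)
      _ = _ := by ring
  have hSo : IsOpen (closure (ball (0 : Euc n) R₀))ᶜ := isClosed_closure.isOpen_compl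
  have hI := annularMass_nonneg c u a R
  have e1 := stable_energy_le hp hu hsol hSo h hψ hc hS
  have e2 := stable_gradSq_le hp hu hsol hSo h hψ hc hS
  have e3 : 0 ≤ D / (p - 1) * annularMass c u a R := by positivity
  have e4 : 0 ≤ (2 * (p / (p - 1)) + 2) * D * annularMass c u a R := by positivity
  constructor
  · have e5 : ∫ x, ‖u x‖ ^ (p + 1) * (c.annulus (R⁻¹ • x) ^ (a + 1)) ^ 2 ≤
        D / (p - 1) * annularMass c u a R := by
      rw [div_mul_eq_mul_div, le_div_iff₀ hp1]
      linarith
    linarith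
  · have e5 := mul_le_mul_of_nonneg_left hgrad hq.le
    linarith

/-- Splitting according to whether `v ^ (p - 1) * χ ^ 2` exceeds `L * σ`. -/
theorem mul_sq_mul_pow_le (hp : 1 < p) {L σ v χ : ℝ} (hL : 0 < L) (hσ : 0 < σ) (hv : 0 ≤ v)
    (hχ : 0 ≤ χ) (hχ1 : χ ≤ 1) {a : ℕ} (ha : 2 / (p - 1) + 1 ≤ a) :
    σ * v ^ 2 * χ ^ (2 * a) ≤
      L⁻¹ * (v ^ (p + 1) * (χ ^ (a + 1)) ^ 2) + σ * (L * σ) ^ (2 / (p - 1)) * χ ^ 2 := by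
  have hp1 : 0 < p - 1 := by linarith
  have hvp : v ^ (p + 1) = v ^ (p - 1) * v ^ 2 := by
    rw [← Real.rpow_natCast, ← Real.rpow_add' hv (by norm_num; linarith)]
    norm_num
    ring_nf
  have h1 : 0 ≤ v ^ (p + 1) * (χ ^ (a + 1)) ^ 2 := by positivity
  have h2 : 0 ≤ σ * (L * σ) ^ (2 / (p - 1)) * χ ^ 2 := by positivity
  rcases le_total (L * σ) (v ^ (p - 1) * χ ^ 2) with hle | hle
  · have h3 : σ * v ^ 2 * χ ^ (2 * a) ≤ L⁻¹ * (v ^ (p + 1) * (χ ^ (a + 1)) ^ 2) := by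
      rw [inv_mul_eq_div, le_div_iff₀ hL, hvp]
      calc _ = (L * σ) * (v ^ 2 * χ ^ (2 * a)) := by ring
        _ ≤ (v ^ (p - 1) * χ ^ 2) * (v ^ 2 * χ ^ (2 * a)) :=
          mul_le_mul_of_nonneg_right hle (by positivity)
        _ = _ := by ring
    linarith
  · rcases hχ.eq_or_lt with rfl | hχ0
    · have : 2 * a ≠ 0 := by
        rintro h
        have : (a : ℝ) = 0 := by exact_mod_cast (by omega : a = 0)
        rw [this] at ha
        have : 0 < 2 / (p - 1) := by positivity
        linarith
      simp [this]
    · set t := 2 / (p - 1) with ht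
      have ht0 : 0 < t := by positivity
      have h4 : v ^ 2 * χ ^ (2 * t) ≤ (L * σ) ^ t := by
        have h5 := Real.rpow_le_rpow (by positivity) hle ht0.le
        rw [Real.mul_rpow (by positivity) (by positivity), ← Real.rpow_mul hv,
          ← Real.rpow_natCast, ← Real.rpow_mul hχ, ht, mul_div_cancel₀ _ hp1.ne'] at h5
        rw [← Real.rpow_natCast]
        exact_mod_cast h5
      have h6 : χ ^ (2 * a) ≤ χ ^ (2 * t) * χ ^ 2 := by
        rw [← Real.rpow_natCast, ← Real.rpow_natCast, ← Real.rpow_add hχ0]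
        refine Real.rpow_le_rpow_of_exponent_ge hχ0 hχ1 ?_
        push_cast
        linarith
      have h7 : σ * v ^ 2 * χ ^ (2 * a) ≤ σ * (L * σ) ^ t * χ ^ 2 :=
        calc _ ≤ σ * v ^ 2 * (χ ^ (2 * t) * χ ^ 2) := mul_le_mul_of_nonneg_left h6 (by positivity)
          _ = σ * (v ^ 2 * χ ^ (2 * t)) * χ ^ 2 := by ring
          _ ≤ _ := by gcongr
      have := inv_pos.2 hL
      have : 0 ≤ L⁻¹ * (v ^ (p + 1) * (χ ^ (a + 1)) ^ 2) := by positivity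
      linarith

theorem exists_annularMass_le (c : CutoffPair n) (hp : 1 < p) (hu : ContDiff ℝ 2 u)
    (hsol : ∀ (i : Fin m) (x : Euc n), - lap (fun z => u z i) x = ‖u x‖ ^ (p - 1) * u x i)
    (hR₀ : 0 < R₀) (h : Stable1 n m p u (closure (ball (0 : Euc n) R₀))ᶜ) {a : ℕ}
    (ha : 2 / (p - 1) + 1 ≤ a) :
    ∃ C : ℝ, 0 < C ∧ ∀ R, 2 * (R₀ + 1) ≤ R →
      annularMass c u a R ≤ C * R ^ ((n : ℝ) - 2 - 2 * (2 / (p - 1))) := by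
  have hp1 : 0 < p - 1 := by linarith
  have ha0 : a ≠ 0 := by
    rintro rfl
    have : 0 < 2 / (p - 1) := by positivity
    norm_num at ha
    linarith
  obtain ⟨K, hK0, hK⟩ := exists_annular_energy_le c hp hu hsol hR₀ h ha0
  set M : ℝ := ∫ x, c.annulus x ^ 2 with hM
  have hM0 : 0 ≤ M := integral_nonneg fun x => sq_nonneg _
  set t := 2 / (p - 1) with ht
  refine ⟨2 * (2 * K) ^ t * (M + 1), by positivity, fun R hR => ?_⟩
  have hR0 : 0 < R := by linarith
  have hχc := (c.contDiff_annulus_smul R).continuous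
  have hi1 : Integrable fun x =>
      (2 * K)⁻¹ * (‖u x‖ ^ (p + 1) * (c.annulus (R⁻¹ • x) ^ (a + 1)) ^ 2) :=
    (integrable_norm_rpow_mul_sq hp hu.continuous (hχc.pow (a + 1))
      (c.hasCompactSupport_annulus_smul_pow hR0 a.succ_ne_zero)).const_mul (2 * K)⁻¹
  have hi2 : Integrable fun x => R⁻¹ ^ 2 * (2 * K * R⁻¹ ^ 2) ^ t * c.annulus (R⁻¹ • x) ^ 2 :=
    ((hχc.pow 2).integrable_of_hasCompactSupport
      (c.hasCompactSupport_annulus_smul_pow hR0 two_ne_zero)).const_mul _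
  have hle := integral_mono (integrable_annularMass c hu.continuous ha0 hR0) (hi1.fun_add hi2)
    fun x => mul_sq_mul_pow_le hp (L := 2 * K) (σ := R⁻¹ ^ 2) (by positivity) (by positivity)
      (norm_nonneg (u x)) (c.annulus_nonneg (R⁻¹ • x)) (c.annulus_le_one _) ha
  rw [integral_add hi1 hi2, integral_const_mul, integral_const_mul,
    Measure.integral_comp_inv_smul_of_nonneg _ (fun y : Euc n => c.annulus y ^ 2) hR0.le,
    finrank_euclideanSpace_fin, smul_eq_mul, ← hM] at hle
  change annularMass c u a R ≤ _ at hle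
  have h1 : (2 * K)⁻¹ * ∫ x, ‖u x‖ ^ (p + 1) * (c.annulus (R⁻¹ • x) ^ (a + 1)) ^ 2 ≤
      annularMass c u a R / 2 := by
    rw [inv_mul_eq_div, div_le_iff₀ (by positivity)]
    linarith [(hK R hR).1]
  have h2 : R⁻¹ ^ 2 * (2 * K * R⁻¹ ^ 2) ^ t * (R ^ n * M) =
      (2 * K) ^ t * M * R ^ ((n : ℝ) - 2 - 2 * t) := by
    have e1 : R⁻¹ ^ 2 = R ^ (-2 : ℝ) := by
      rw [Real.rpow_neg hR0.le, inv_pow]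
      norm_cast
    have e2 : (n : ℝ) - 2 - 2 * t = -2 + -2 * t + n := by ring
    rw [Real.mul_rpow (by positivity) (by positivity), e1, ← Real.rpow_mul hR0.le, e2,
      Real.rpow_add hR0, Real.rpow_add hR0, Real.rpow_natCast]
    ring
  rw [h2] at hle
  have h3 : 0 ≤ (2 * K) ^ t * R ^ ((n : ℝ) - 2 - 2 * t) := by positivity
  linarith

end AnnularMass

section Pohozaev

/-- The derivative of `f` in the radial direction, `x ⬝ ∇f`. -/
def radialDeriv {n : ℕ} (f : Euc n → ℝ) (x : Euc n) : ℝ := ∑ l, x l * pd l f x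

/-- The scalar part of the Pohozaev vector field. -/
def scalarField {n : ℕ} (k : Fin n) (f : Euc n → ℝ) (x : Euc n) : ℝ :=
  radialDeriv f x * pd k f x - x k * (gradSq f x / 2) + ((n : ℝ) - 2) / 2 * (f x * pd k f x)

/-- The Pohozaev vector field of the system. -/
def pohozaevField {n m : ℕ} (p : ℝ) (u : Euc n → EuclideanSpace ℝ (Fin m)) (k : Fin n)
    (x : Euc n) : ℝ :=
  ∑ i, scalarField k (fun y => u y i) x + x k * (‖u x‖ ^ (p + 1) / (p + 1))

variable {n m : ℕ} {p : ℝ} {u : Euc n → EuclideanSpace ℝ (Fin m)}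

theorem contDiff_radialDeriv {f : Euc n → ℝ} (hf : ContDiff ℝ 2 f) :
    ContDiff ℝ 1 (radialDeriv f) :=
  ContDiff.sum fun l _ => (contDiff_coord l).mul (contDiff_pd hf (by norm_num) l)

theorem contDiff_gradSq {f : Euc n → ℝ} (hf : ContDiff ℝ 2 f) : ContDiff ℝ 1 (gradSq f) :=
  ContDiff.sum fun l _ => (contDiff_pd hf (by norm_num) l).pow 2

theorem contDiff_scalarField {f : Euc n → ℝ} (hf : ContDiff ℝ 2 f) (k : Fin n) :
    ContDiff ℝ 1 (scalarField k f) :=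
  (((contDiff_radialDeriv hf).mul (contDiff_pd hf (by norm_num) k)).sub
    ((contDiff_coord k).mul ((contDiff_gradSq hf).div_const 2))).add
    (contDiff_const.mul ((hf.of_le (by norm_num)).mul (contDiff_pd hf (by norm_num) k)))

theorem contDiff_pohozaevField (hp : 1 < p) (hu : ContDiff ℝ 2 u) (k : Fin n) :
    ContDiff ℝ 1 (pohozaevField p u k) :=
  (ContDiff.sum fun i _ => contDiff_scalarField (contDiff_euclidean.1 hu i) k).add
    ((contDiff_coord k).mul
      (((hu.of_le (by norm_num)).norm_rpow (by linarith : 1 < p + 1)).div_const (p + 1)))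

theorem pd_radialDeriv {f : Euc n → ℝ} (hf : ContDiff ℝ 2 f) (k : Fin n) (x : Euc n) :
    pd k (radialDeriv f) x = pd k f x + ∑ l, x l * pd k (pd l f) x := by
  have d1 : ∀ l, DifferentiableAt ℝ (fun y : Euc n => y l) x := fun l =>
    (contDiff_coord (a := 1) l).differentiable one_ne_zero x
  have d2 : ∀ l, DifferentiableAt ℝ (pd l f) x := fun l =>
    (contDiff_pd (a := 1) hf (by norm_num) l).differentiable one_ne_zero x
  change pd k (fun y => ∑ l, y l * pd l f y) x = _
  rw [pd_sum fun l _ => (d1 l).fun_mul (d2 l)]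
  simp only [pd_mul (d1 _) (d2 _), pd_coord, Finset.sum_add_distrib, ite_mul, one_mul, zero_mul,
    Finset.sum_ite_eq, Finset.mem_univ, if_true]

theorem pd_gradSq {f : Euc n → ℝ} (hf : ContDiff ℝ 2 f) (l : Fin n) (x : Euc n) :
    pd l (gradSq f) x = 2 * ∑ k, pd k f x * pd k (pd l f) x := by
  have d2 : ∀ l, DifferentiableAt ℝ (pd l f) x := fun l =>
    (contDiff_pd (a := 1) hf (by norm_num) l).differentiable one_ne_zero x
  change pd l (fun y => ∑ k, pd k f y ^ 2) x = _
  rw [pd_sum fun k _ => (d2 k).fun_pow 2, Finset.mul_sum]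
  refine Finset.sum_congr rfl fun k _ => ?_
  rw [pd_pow (d2 k), pd_pd_comm hf]
  push_cast
  ring

theorem sum_pd_coord_mul {g : Euc n → ℝ} {x : Euc n} (hg : DifferentiableAt ℝ g x) :
    ∑ k, pd k (fun y => y k * g y) x = n * g x + ∑ k, x k * pd k g x := by
  have d1 : ∀ l, DifferentiableAt ℝ (fun y : Euc n => y l) x := fun l =>
    (contDiff_coord (a := 1) l).differentiable one_ne_zero x
  simp [pd_mul (d1 _) hg, pd_coord, Finset.sum_add_distrib]

theorem sum_pd_scalarField {f : Euc n → ℝ} (hf : ContDiff ℝ 2 f) (x : Euc n) :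
    ∑ k, pd k (scalarField k f) x =
      (radialDeriv f x + ((n : ℝ) - 2) / 2 * f x) * lap f x := by
  have d0 : DifferentiableAt ℝ f x := hf.differentiable two_ne_zero x
  have d1 : ∀ l, DifferentiableAt ℝ (fun y : Euc n => y l) x := fun l =>
    (contDiff_coord (a := 1) l).differentiable one_ne_zero x
  have d2 : ∀ l, DifferentiableAt ℝ (pd l f) x := fun l =>
    (contDiff_pd (a := 1) hf (by norm_num) l).differentiable one_ne_zero x
  have d3 := (contDiff_radialDeriv hf).differentiable one_ne_zero x
  have d4 : DifferentiableAt ℝ (fun y => gradSq f y / 2) x :=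
    ((contDiff_gradSq hf).div_const 2).differentiable one_ne_zero x
  have h1 : ∀ k, pd k (scalarField k f) x =
      (pd k f x ^ 2 + (∑ l, x l * pd k (pd l f) x) * pd k f x +
        radialDeriv f x * pd k (pd k f) x) - pd k (fun y => y k * (gradSq f y / 2)) x +
        ((n : ℝ) - 2) / 2 * (pd k f x ^ 2 + f x * pd k (pd k f) x) := fun k => by
    change pd k (fun y => radialDeriv f y * pd k f y - y k * (gradSq f y / 2) +
      ((n : ℝ) - 2) / 2 * (f y * pd k f y)) x = _
    rw [pd_add ((d3.fun_mul (d2 k)).fun_sub ((d1 k).fun_mul d4))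
        ((d0.fun_mul (d2 k)).const_mul _),
      pd_sub (d3.fun_mul (d2 k)) ((d1 k).fun_mul d4), pd_const_mul (d0.fun_mul (d2 k)),
      pd_mul d3 (d2 k), pd_mul d0 (d2 k), pd_radialDeriv hf]
    ring
  have h2 : ∀ l, pd l (fun y => gradSq f y / 2) x = ∑ k, pd k f x * pd k (pd l f) x := fun l => by
    have : (fun y => gradSq f y / 2) = fun y => 2⁻¹ * gradSq f y := by
      ext y
      ring
    rw [this, pd_const_mul ((contDiff_gradSq hf).differentiable one_ne_zero x), pd_gradSq hf]
    ring
  have h3 : ∑ k, (∑ l, x l * pd k (pd l f) x) * pd k f x =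
      ∑ l, x l * ∑ k, pd k f x * pd k (pd l f) x := by
    simp only [Finset.sum_mul, Finset.mul_sum]
    rw [Finset.sum_comm]
    exact Finset.sum_congr rfl fun l _ => Finset.sum_congr rfl fun k _ => by ring
  simp only [h1]
  rw [Finset.sum_add_distrib, Finset.sum_sub_distrib, Finset.sum_add_distrib,
    Finset.sum_add_distrib, ← Finset.mul_sum, ← Finset.mul_sum, Finset.sum_add_distrib,
    ← Finset.mul_sum, sum_pd_coord_mul d4, lap_eq_sum_pd hf, h3]
  simp only [h2]
  change gradSq f x + _ + _ - _ + ((n : ℝ) - 2) / 2 * (gradSq f x + _) = _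
  ring

theorem pd_norm_rpow (hp : 1 < p) (hu : ContDiff ℝ 1 u) (k : Fin n) (x : Euc n) :
    pd k (fun y => ‖u y‖ ^ (p + 1) / (p + 1)) x =
      ‖u x‖ ^ (p - 1) * ∑ i, u x i * pd k (fun y => u y i) x := by
  have hd := hu.differentiable one_ne_zero
  have h1 : (fun y => ‖u y‖ ^ (p + 1) / (p + 1)) = fun y => (p + 1)⁻¹ * ‖u y‖ ^ (p + 1) := by
    ext y
    ring
  have hp1 : p + 1 ≠ 0 := by linarith
  have h2 : ∀ i, (fderiv ℝ u x (EuclideanSpace.single k 1)) i = pd k (fun y => u y i) x := by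
    intro i
    have := ((EuclideanSpace.proj (𝕜 := ℝ) i).hasFDerivAt.comp x (hd x).hasFDerivAt).fderiv
    change fderiv ℝ (fun y => u y i) x = _ at this
    rw [pd, this]
    rfl
  rw [h1, pd_const_mul (hd.norm_rpow (by linarith) x), pd, hd.fderiv_norm_rpow (by linarith)]
  have h3 : p + 1 - 2 = p - 1 := by ring
  simp only [_root_.smul_apply, ContinuousLinearMap.comp_apply, innerSL_apply_apply,
    PiLp.inner_apply, smul_eq_mul, h2, h3]
  rw [← mul_assoc, inv_mul_cancel_left₀ hp1]
  congr 1
  exact Finset.sum_congr rfl fun i _ => by simp [mul_comm]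

theorem sum_pd_pohozaevField (hp : 1 < p) (hu : ContDiff ℝ 2 u)
    (hsol : ∀ (i : Fin m) (x : Euc n), - lap (fun z => u z i) x = ‖u x‖ ^ (p - 1) * u x i)
    (x : Euc n) :
    ∑ k, pd k (pohozaevField p u k) x =
      ((n : ℝ) / (p + 1) - ((n : ℝ) - 2) / 2) * ‖u x‖ ^ (p + 1) := by
  have hui : ∀ i, ContDiff ℝ 2 fun y => u y i := contDiff_euclidean.1 hu
  have hu1 : ContDiff ℝ 1 u := hu.of_le (by norm_num)
  have d1 : DifferentiableAt ℝ (fun y => ‖u y‖ ^ (p + 1) / (p + 1)) x :=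
    ((hu1.norm_rpow (by linarith : 1 < p + 1)).div_const (p + 1)).differentiable one_ne_zero x
  have d2 : ∀ k, DifferentiableAt ℝ (fun y : Euc n => y k) x := fun k =>
    (contDiff_coord (a := 1) k).differentiable one_ne_zero x
  have d3 : ∀ i k, DifferentiableAt ℝ (fun y => scalarField k (fun z => u z i) y) x := fun i k =>
    (contDiff_scalarField (hui i) k).differentiable one_ne_zero x
  have h1 : ∀ k, pd k (pohozaevField p u k) x =
      ∑ i, pd k (scalarField k fun z => u z i) x +
        pd k (fun y => y k * (‖u y‖ ^ (p + 1) / (p + 1))) x := fun k => by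
    change pd k (fun y => ∑ i, scalarField k (fun z => u z i) y +
      y k * (‖u y‖ ^ (p + 1) / (p + 1))) x = _
    rw [pd_add (.fun_sum fun i _ => d3 i k) ((d2 k).fun_mul d1), pd_sum fun i _ => d3 i k]
  simp only [h1]
  rw [Finset.sum_add_distrib, sum_pd_coord_mul d1, Finset.sum_comm]
  simp only [sum_pd_scalarField (hui _), pd_norm_rpow hp hu1]
  have h2 : ∑ k, x k * (‖u x‖ ^ (p - 1) * ∑ i, u x i * pd k (fun y => u y i) x) =
      -∑ i, radialDeriv (fun y => u y i) x * lap (fun z => u z i) x := by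
    simp only [radialDeriv, Finset.mul_sum, Finset.sum_mul]
    rw [Finset.sum_comm, ← Finset.sum_neg_distrib]
    refine Finset.sum_congr rfl fun i _ => ?_
    rw [← Finset.sum_neg_distrib]
    refine Finset.sum_congr rfl fun k _ => ?_
    linear_combination (-x k * pd k (fun y => u y i) x) * hsol i x
  have h3 : ∑ i, (radialDeriv (fun y => u y i) x + ((n : ℝ) - 2) / 2 * u x i) *
      lap (fun z => u z i) x = ∑ i, radialDeriv (fun y => u y i) x * lap (fun z => u z i) x +
        ((n : ℝ) - 2) / 2 * ∑ i, u x i * lap (fun z => u z i) x := by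
    rw [Finset.mul_sum, ← Finset.sum_add_distrib]
    exact Finset.sum_congr rfl fun i _ => by ring
  rw [h2, h3, sum_coord_mul_lap hp hsol]
  ring

theorem abs_scalarField_le {f : Euc n → ℝ} (hn : 2 ≤ n) {R : ℝ} (hR : 0 < R) {x : Euc n}
    (hx : ‖x‖ ≤ 4 * R) (k : Fin n) :
    |scalarField k f x| ≤ R * ((5 * n + 4) * gradSq f x + n * (R⁻¹ ^ 2 * f x ^ 2)) := by
  have hn' : (2 : ℝ) ≤ n := by exact_mod_cast hn
  have hg := gradSq_nonneg f x
  have hsq : ∀ l, pd l f x ^ 2 ≤ gradSq f x := fun l =>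
    Finset.single_le_sum (f := fun l => pd l f x ^ 2) (fun _ _ => sq_nonneg _) (Finset.mem_univ l)
  have hc : ∀ l, |x l| ≤ 4 * R := fun l => (abs_coord_le_norm x l).trans hx
  have h1 : |radialDeriv f x * pd k f x| ≤ n * (4 * R * gradSq f x) := by
    rw [radialDeriv, Finset.sum_mul]
    refine (Finset.abs_sum_le_sum_abs _ _).trans ?_
    have : ∀ l ∈ Finset.univ, |x l * pd l f x * pd k f x| ≤ 4 * R * gradSq f x := fun l _ => by
      rw [mul_assoc, abs_mul]
      refine mul_le_mul (hc l) ?_ (abs_nonneg _) (by positivity)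
      rw [abs_le]
      constructor <;>
        nlinarith [hsq l, hsq k, sq_nonneg (pd l f x + pd k f x), sq_nonneg (pd l f x - pd k f x)]
    simpa using Finset.sum_le_card_nsmul _ _ _ this
  have h2 : |x k * (gradSq f x / 2)| ≤ 4 * R * gradSq f x := by
    rw [abs_mul, abs_of_nonneg (by positivity : 0 ≤ gradSq f x / 2)]
    exact mul_le_mul (hc k) (by linarith) (by positivity) (by positivity)
  have h3 : |((n : ℝ) - 2) / 2 * (f x * pd k f x)| ≤
      n * (R * (R⁻¹ ^ 2 * f x ^ 2 + gradSq f x)) := by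
    rw [abs_mul, abs_of_nonneg (by linarith : 0 ≤ ((n : ℝ) - 2) / 2)]
    refine mul_le_mul (by linarith) ?_ (abs_nonneg _) (by positivity)
    have e : f x * pd k f x = R * ((R⁻¹ * f x) * pd k f x) := by field_simp
    rw [e, abs_mul, abs_of_pos hR]
    refine mul_le_mul_of_nonneg_left ?_ hR.le
    rw [abs_le]
    constructor <;>
      nlinarith [hsq k, sq_nonneg (R⁻¹ * f x + pd k f x), sq_nonneg (R⁻¹ * f x - pd k f x)]
  have h4 := abs_add_le (radialDeriv f x * pd k f x - x k * (gradSq f x / 2))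
    (((n : ℝ) - 2) / 2 * (f x * pd k f x))
  have h5 := abs_sub (radialDeriv f x * pd k f x) (x k * (gradSq f x / 2))
  rw [scalarField]
  linarith

theorem abs_pohozaevField_le (hn : 2 ≤ n) (hp : 1 < p) {R : ℝ} (hR : 0 < R) {x : Euc n}
    (hx : ‖x‖ ≤ 4 * R) (k : Fin n) :
    |pohozaevField p u k x| ≤ R * ((5 * n + 4) *
      (∑ i, gradSq (fun y => u y i) x + ‖u x‖ ^ (p + 1) + R⁻¹ ^ 2 * ‖u x‖ ^ 2)) := by
  have h1 : |∑ i, scalarField k (fun y => u y i) x| ≤ R * ((5 * n + 4) *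
      ∑ i, gradSq (fun y => u y i) x + n * (R⁻¹ ^ 2 * ‖u x‖ ^ 2)) := by
    rw [EuclideanSpace.real_norm_sq_eq, Finset.mul_sum, Finset.mul_sum, Finset.mul_sum,
      ← Finset.sum_add_distrib, Finset.mul_sum]
    exact (Finset.abs_sum_le_sum_abs _ _).trans
      (Finset.sum_le_sum fun i _ => abs_scalarField_le hn hR hx k)
  have h2 : |x k * (‖u x‖ ^ (p + 1) / (p + 1))| ≤ 4 * R * ‖u x‖ ^ (p + 1) := by
    rw [abs_mul, abs_of_nonneg (div_nonneg (by positivity) (by linarith) :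
      0 ≤ ‖u x‖ ^ (p + 1) / (p + 1))]
    exact mul_le_mul ((abs_coord_le_norm x k).trans hx)
      (div_le_self (by positivity) (by linarith)) (div_nonneg (by positivity) (by linarith))
      (by positivity)
  have h3 := abs_add_le (∑ i, scalarField k (fun y => u y i) x)
    (x k * (‖u x‖ ^ (p + 1) / (p + 1)))
  have h4 : 0 ≤ R * (5 * n * ‖u x‖ ^ (p + 1) + (4 * n + 4) * (R⁻¹ ^ 2 * ‖u x‖ ^ 2)) := by
    positivity
  rw [pohozaevField]
  linarith

end Pohozaev

section PohozaevLiouville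

variable {n m : ℕ} {p : ℝ} {u : Euc n → EuclideanSpace ℝ (Fin m)} {R₀ : ℝ}

theorem exists_abs_integral_pohozaev_le (c : CutoffPair n) (hn : 2 ≤ n) (hp : 1 < p)
    (hu : ContDiff ℝ 2 u)
    (hsol : ∀ (i : Fin m) (x : Euc n), - lap (fun z => u z i) x = ‖u x‖ ^ (p - 1) * u x i)
    (hR₀ : 0 < R₀) (h : Stable1 n m p u (closure (ball (0 : Euc n) R₀))ᶜ) {a : ℕ} (ha : a ≠ 0) :
    ∃ C : ℝ, ∀ R, 2 * (R₀ + 1) ≤ R →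
      |((n : ℝ) / (p + 1) - ((n : ℝ) - 2) / 2) * ∫ x, ‖u x‖ ^ (p + 1) * c.ball (R⁻¹ • x)| ≤
        C * annularMass c u a R := by
  obtain ⟨B, hB0, hB⟩ := c.exists_abs_pd_ball_le
  obtain ⟨K, hK0, hK⟩ := exists_annular_energy_le c hp hu hsol hR₀ h ha
  refine ⟨n * (B * (5 * n + 4)) * (2 * K + 1), fun R hR => ?_⟩
  have hR0 : 0 < R := by linarith
  have hu1 : ContDiff ℝ 1 u := hu.of_le (by norm_num)
  have hζ := c.contDiff_ball_smul R
  have hζc := c.hasCompactSupport_ball_smul hR0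
  have hP := contDiff_pohozaevField hp hu
  have hF : ∀ k, ContDiff ℝ 1 fun y => pohozaevField p u k y * c.ball (R⁻¹ • y) := fun k =>
    (hP k).mul hζ
  have hFc : ∀ k, HasCompactSupport fun y => pohozaevField p u k y * c.ball (R⁻¹ • y) := fun k =>
    hζc.mul_left
  have hdiv := integral_sum_pd_eq_zero hF hFc
  have hpt : ∀ x, ∑ k, pd k (fun y => pohozaevField p u k y * c.ball (R⁻¹ • y)) x =
      ((n : ℝ) / (p + 1) - ((n : ℝ) - 2) / 2) * (‖u x‖ ^ (p + 1) * c.ball (R⁻¹ • x)) +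
        ∑ k, pohozaevField p u k x * pd k (fun y => c.ball (R⁻¹ • y)) x := fun x => by
    have : ∀ k, pd k (fun y => pohozaevField p u k y * c.ball (R⁻¹ • y)) x =
        pd k (pohozaevField p u k) x * c.ball (R⁻¹ • x) +
          pohozaevField p u k x * pd k (fun y => c.ball (R⁻¹ • y)) x := fun k =>
      pd_mul ((hP k).differentiable one_ne_zero x) (hζ.differentiable one_ne_zero x) k
    simp only [this]
    rw [Finset.sum_add_distrib, ← Finset.sum_mul, sum_pd_pohozaevField hp hu hsol, mul_assoc]
  have hi1 : Integrable fun x => ‖u x‖ ^ (p + 1) * c.ball (R⁻¹ • x) :=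
    ((continuous_norm_rpow_add_one hp hu.continuous).mul
      hζ.continuous).integrable_of_hasCompactSupport hζc.mul_left
  have hi2 : Integrable fun x =>
      ∑ k, pohozaevField p u k x * pd k (fun y => c.ball (R⁻¹ • y)) x :=
    integrable_finsetSum _ fun k _ => ((hP k).continuous.mul
      (continuous_pd hζ k)).integrable_of_hasCompactSupport (hasCompactSupport_pd hζc k).mul_left
  simp only [hpt] at hdiv
  rw [integral_add (hi1.const_mul _) hi2, integral_const_mul, add_eq_zero_iff_eq_neg] at hdiv
  rw [hdiv, abs_neg]
  have hχc := (c.contDiff_annulus_smul R).continuous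
  have hχs := c.hasCompactSupport_annulus_smul_pow hR0 a.succ_ne_zero
  have hj1 : Integrable fun x =>
      (∑ i, gradSq (fun y => u y i) x) * (c.annulus (R⁻¹ • x) ^ (a + 1)) ^ 2 :=
    ((continuous_sum_gradSq hu1).mul
      ((hχc.pow (a + 1)).pow 2)).integrable_of_hasCompactSupport (hasCompactSupport_sq hχs).mul_left
  have hj2 : Integrable fun x => ‖u x‖ ^ (p + 1) * (c.annulus (R⁻¹ • x) ^ (a + 1)) ^ 2 :=
    integrable_norm_rpow_mul_sq hp hu.continuous (hχc.pow (a + 1)) hχs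
  have hj3 := integrable_annularMass c hu.continuous ha hR0
  have hbound : ∀ x, |∑ k, pohozaevField p u k x * pd k (fun y => c.ball (R⁻¹ • y)) x| ≤
      n * (B * (5 * n + 4)) *
        ((∑ i, gradSq (fun y => u y i) x) * (c.annulus (R⁻¹ • x) ^ (a + 1)) ^ 2 +
        ‖u x‖ ^ (p + 1) * (c.annulus (R⁻¹ • x) ^ (a + 1)) ^ 2 +
        R⁻¹ ^ 2 * ‖u x‖ ^ 2 * c.annulus (R⁻¹ • x) ^ (2 * a)) := fun x => by
    refine (Finset.abs_sum_le_sum_abs _ _).trans ?_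
    set χ := c.annulus (R⁻¹ • x) with hχ
    have hχ0 : 0 ≤ χ := c.annulus_nonneg _
    set E := ∑ i, gradSq (fun y => u y i) x with hE
    have hE0 : 0 ≤ E := Finset.sum_nonneg fun i _ => gradSq_nonneg _ x
    have hterm : ∀ k ∈ Finset.univ,
        |pohozaevField p u k x * pd k (fun y => c.ball (R⁻¹ • y)) x| ≤
          B * (5 * n + 4) * (E * (χ ^ (a + 1)) ^ 2 + ‖u x‖ ^ (p + 1) * (χ ^ (a + 1)) ^ 2 +
            R⁻¹ ^ 2 * ‖u x‖ ^ 2 * χ ^ (2 * a)) := fun k _ => by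
      have h1 := hB (2 * (a + 1)) k (R⁻¹ • x)
      rw [← hχ] at h1
      rw [pd_comp_smul, abs_mul, abs_mul, abs_of_pos (inv_pos.2 hR0)]
      rcases le_total ‖x‖ (4 * R) with hx | hx
      · have h2 := abs_pohozaevField_le (u := u) hn hp hR0 hx k
        rw [← hE] at h2
        have h3 : χ ^ (2 * (a + 1)) ≤ χ ^ (2 * a) :=
          pow_le_pow_of_le_one hχ0 (c.annulus_le_one _) (by omega)
        calc _ ≤ R * ((5 * n + 4) * (E + ‖u x‖ ^ (p + 1) + R⁻¹ ^ 2 * ‖u x‖ ^ 2)) *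
              (R⁻¹ * (B * χ ^ (2 * (a + 1)))) := by gcongr
          _ = B * (5 * n + 4) * (E * (χ ^ (a + 1)) ^ 2 + ‖u x‖ ^ (p + 1) * (χ ^ (a + 1)) ^ 2 +
              R⁻¹ ^ 2 * ‖u x‖ ^ 2 * χ ^ (2 * (a + 1))) := by
            field_simp
            ring
          _ ≤ _ := by gcongr
      · have h4 : χ = 0 := c.annulus_smul_eq_zero_of_ge hR0 hx
        rw [h4, zero_pow (by omega), mul_zero] at h1
        have h5 := le_antisymm h1 (abs_nonneg _)
        rw [h5, mul_zero, mul_zero]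
        positivity
    have := Finset.sum_le_card_nsmul _ _ _ hterm
    rw [Finset.card_univ, Fintype.card_fin, nsmul_eq_mul, ← mul_assoc] at this
    exact this
  have hle := (abs_integral_le_integral_abs (μ := volume)
    (f := fun x => ∑ k, pohozaevField p u k x * pd k (fun y => c.ball (R⁻¹ • y)) x)).trans
    (integral_mono hi2.abs (((hj1.fun_add hj2).fun_add hj3).const_mul _) hbound)
  rw [integral_const_mul, integral_add (hj1.fun_add hj2) hj3, integral_add hj1 hj2] at hle
  obtain ⟨hK1, hK2⟩ := hK R hR
  change _ ≤ _ * (_ + annularMass c u a R) at hle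
  refine (hle.trans (mul_le_mul_of_nonneg_left
    (add_le_add_left (add_le_add hK2 hK1) _) (by positivity))).trans_eq ?_
  ring

theorem eq_zero_of_tendsto_annularMass (c : CutoffPair n) (hn : 2 ≤ n) (hp : 1 < p)
    (hcrit : (n : ℝ) / (p + 1) - ((n : ℝ) - 2) / 2 ≠ 0) (hu : ContDiff ℝ 2 u)
    (hsol : ∀ (i : Fin m) (x : Euc n), - lap (fun z => u z i) x = ‖u x‖ ^ (p - 1) * u x i)
    (hR₀ : 0 < R₀) (h : Stable1 n m p u (closure (ball (0 : Euc n) R₀))ᶜ) {a : ℕ} (ha : a ≠ 0)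
    (hlim : Tendsto (fun R => annularMass c u a R) atTop (nhds 0)) (x : Euc n) : u x = 0 := by
  obtain ⟨C, hC⟩ := exists_abs_integral_pohozaev_le c hn hp hu hsol hR₀ h ha
  set κ := (n : ℝ) / (p + 1) - ((n : ℝ) - 2) / 2 with hκ
  set T : ℝ := ‖x‖ + 1 with hT
  have hT0 : 0 < T := by positivity
  have hv := continuous_norm_rpow_add_one hp hu.continuous
  have hcont : ∀ R : ℝ, Continuous fun y => ‖u y‖ ^ (p + 1) * c.ball (R⁻¹ • y) := fun R =>
    hv.mul (c.contDiff_ball_smul R).continuous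
  have hcs : ∀ R : ℝ, 0 < R → HasCompactSupport fun y => ‖u y‖ ^ (p + 1) * c.ball (R⁻¹ • y) :=
    fun R hR => (c.hasCompactSupport_ball_smul hR).mul_left
  have hle : ∫ y, ‖u y‖ ^ (p + 1) * c.ball (T⁻¹ • y) ≤ 0 := by
    have hlim' : Tendsto (fun R => |κ|⁻¹ * (C * annularMass c u a R)) atTop (nhds 0) := by
      simpa using (hlim.const_mul C).const_mul |κ|⁻¹
    refine ge_of_tendsto hlim' ?_
    filter_upwards [eventually_ge_atTop (2 * (R₀ + 1)), eventually_ge_atTop (2 * T)] with R hR hRT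
    have hR0 : 0 < R := by linarith
    have h1 := hC R hR
    rw [abs_mul] at h1
    rw [inv_mul_eq_div, le_div_iff₀ (abs_pos.2 hcrit), mul_comm]
    refine le_trans (mul_le_mul_of_nonneg_left (le_trans ?_ (le_abs_self _)) (abs_nonneg _)) h1
    refine integral_mono ((hcont T).integrable_of_hasCompactSupport (hcs T hT0))
      ((hcont R).integrable_of_hasCompactSupport (hcs R hR0)) fun y => ?_
    refine mul_le_mul_of_nonneg_left ?_ (by positivity)
    rcases le_total (2 * T) ‖y‖ with hy | hy
    · rw [c.ball_smul_eq_zero hT0 hy]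
      exact c.ball_nonneg _
    · rw [c.ball_smul_eq_one hR0 (hy.trans hRT)]
      exact c.ball_le_one _
  by_contra hx
  refine absurd hle (not_le.2 ?_)
  refine (hcont T).integral_pos_of_hasCompactSupport_nonneg_nonzero (hcs T hT0) (x := x)
    (fun y => mul_nonneg (by positivity) (c.ball_nonneg _)) ?_
  rw [c.ball_smul_eq_one hT0 (by linarith), mul_one]
  have := norm_pos_iff.2 hx
  positivity

end PohozaevLiouville

section JosephLundgren

/-- The Joseph–Lundgren condition in terms of the scaling exponent `t = 2 / (p - 1)`. -/
theorem sq_lt_of_joseph_lundgren {n : ℕ} (hn : 3 ≤ n) {p : ℝ} (hp : 1 < p)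
    (hsup : ((n : ℝ) + 2) / ((n : ℝ) - 2) < p)
    (hpc : 11 ≤ n → p < (((n : ℝ) - 2) ^ 2 - 4 * (n : ℝ) + 8 * Real.sqrt ((n : ℝ) - 1)) /
      (((n : ℝ) - 2) * ((n : ℝ) - 10))) :
    2 / (p - 1) < ((n : ℝ) - 2) / 2 ∧ (((n : ℝ) - 2) / 2) ^ 2 <
      (2 / (p - 1) + 2) * (2 * (((n : ℝ) - 2) / 2) - 2 / (p - 1)) := by
  have hn' : (3 : ℝ) ≤ n := by exact_mod_cast hn
  have hp1 : 0 < p - 1 := by linarith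
  set t := 2 / (p - 1) with ht
  have ht0 : 0 < t := by positivity
  have htN : t < ((n : ℝ) - 2) / 2 := by
    rw [div_lt_iff₀ (by linarith)] at hsup
    rw [ht, div_lt_iff₀ hp1]
    linarith
  refine ⟨htN, ?_⟩
  by_cases h11 : 11 ≤ n
  · have hpc := hpc h11
    have h11' : (11 : ℝ) ≤ n := by exact_mod_cast h11
    set s := Real.sqrt ((n : ℝ) - 1) with hs
    have hs2 : s ^ 2 = (n : ℝ) - 1 := Real.sq_sqrt (by linarith)
    have hs3 : 3 < s := Real.lt_sqrt_of_sq_lt (by linarith)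
    have hns : (n : ℝ) = s ^ 2 + 1 := by linarith
    rw [lt_div_iff₀ (by nlinarith)] at hpc
    have h1 : (p - 1) * ((s + 1) * (s - 3)) < 4 := by
      have h2 : 0 < (s + 3) * (s - 1) := by nlinarith
      refine lt_of_mul_lt_mul_right (a := (s + 3) * (s - 1)) ?_ h2.le
      rw [hns] at hpc
      nlinarith
    have h3 : (s + 1) * (s - 3) / 2 < t := by
      rw [ht, lt_div_iff₀ hp1]
      linarith
    rw [hns] at htN ⊢
    nlinarith [mul_pos (sub_pos.2 h3) (by nlinarith : 0 < (s ^ 2 + 1 - 2) / 2 - 1 + s - t)]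
  · have h10 : (n : ℝ) ≤ 10 := by exact_mod_cast (by omega : n ≤ 10)
    set N : ℝ := ((n : ℝ) - 2) / 2 with hN
    have hN4 : N ≤ 4 := by rw [hN]; linarith
    nlinarith [mul_nonneg (sub_nonneg.2 htN.le) (sub_nonneg.2 hN4), mul_pos ht0 (sub_pos.2 htN)]

theorem exists_pos_mul_sq_lt {p N : ℝ} (hp : 1 < p)
    (h : N ^ 2 < (2 / (p - 1) + 2) * (2 * N - 2 / (p - 1))) :
    ∃ s > 0, p * ((1 + s) * (N - 2 / (p - 1) + s) ^ 2) < (p - 1) * N ^ 2 := by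
  have hp1 : 0 < p - 1 := by linarith
  set t := 2 / (p - 1) with ht
  have ht0 : 0 < t := by positivity
  have hpt : (p - 1) * t = 2 := mul_div_cancel₀ _ hp1.ne'
  have h0 : p * ((1 + 0) * (N - t + 0) ^ 2) < (p - 1) * N ^ 2 := by
    have h1 : p * 2 = (p - 1) * (t + 2) := by linarith
    have h2 : (t + 2) * (N - t) ^ 2 < 2 * N ^ 2 := by nlinarith
    nlinarith
  have hcont : Continuous fun s => p * ((1 + s) * (N - t + s) ^ 2) := by fun_prop
  have hev := (hcont.tendsto 0).eventually_lt_const h0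
  obtain ⟨s, hs, hs0⟩ := ((hev.filter_mono nhdsWithin_le_nhds).and
    (self_mem_nhdsWithin : Ioi (0 : ℝ) ∈ nhdsWithin 0 (Ioi 0))).exists
  exact ⟨s, hs0, hs⟩

end JosephLundgren

section RadialWeight

variable {n : ℕ}

/-- A smooth radial weight interpolating between the constant one and `|x| ^ (-e)`. -/
def radialWeight (e ε : ℝ) (x : Euc n) : ℝ := (1 + ε * ‖x‖ ^ 2) ^ (-e / 2)

variable {e ε : ℝ}

theorem contDiff_radialWeight (hε : 0 < ε) :
    ContDiff ℝ 1 (radialWeight e ε : Euc n → ℝ) :=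
  (contDiff_const.add (contDiff_const.mul (contDiff_norm_sq ℝ))).rpow_const_of_ne fun x => by
    positivity

theorem radialWeight_sq (hε : 0 < ε) (x : Euc n) :
    radialWeight e ε x ^ 2 = (1 + ε * ‖x‖ ^ 2) ^ (-e) := by
  rw [radialWeight, ← Real.rpow_natCast, ← Real.rpow_mul (by positivity)]
  norm_num

theorem radialWeight_sq_le_one (he : 0 < e) (hε : 0 < ε) (x : Euc n) :
    radialWeight e ε x ^ 2 ≤ 1 := by
  rw [radialWeight_sq hε]
  exact Real.rpow_le_one_of_one_le_of_nonpos (by nlinarith [sq_nonneg ‖x‖]) (by linarith)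

theorem radialWeight_sq_le (he : 0 < e) (hε : 0 < ε) {R : ℝ} (hR : 0 < R) {x : Euc n}
    (hx : R ≤ ‖x‖) : radialWeight e ε x ^ 2 ≤ (ε * R ^ 2) ^ (-e) := by
  rw [radialWeight_sq hε]
  refine Real.rpow_le_rpow_of_nonpos (by positivity) ?_ (by linarith)
  have : R ^ 2 ≤ ‖x‖ ^ 2 := by gcongr
  nlinarith

theorem le_radialWeight_sq (he : 0 < e) (hε : 0 < ε) {x : Euc n} (hx : ε * ‖x‖ ^ 2 ≤ 1) :
    (2 : ℝ) ^ (-e) ≤ radialWeight e ε x ^ 2 := by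
  rw [radialWeight_sq hε]
  exact Real.rpow_le_rpow_of_nonpos (by positivity) (by linarith) (by linarith)

theorem gradSq_radialWeight_le (hε : 0 < ε) (hε1 : ε ≤ 1) (x : Euc n) :
    gradSq (radialWeight e ε) x ≤ e ^ 2 * (radialWeight e ε x ^ 2 * (1 + ‖x‖ ^ 2)⁻¹) := by
  have hpos : 0 < 1 + ε * ‖x‖ ^ 2 := by positivity
  have hd : HasDerivAt (fun t : ℝ => (1 + ε * t) ^ (-e / 2))
      (ε * (-e / 2) * (1 + ε * ‖x‖ ^ 2) ^ (-e / 2 - 1)) (‖x‖ ^ 2) := by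
    have := (((hasDerivAt_id (‖x‖ ^ 2)).const_mul ε).const_add 1).rpow_const (p := -e / 2)
      (Or.inl hpos.ne')
    simpa using this
  have h1 : ∀ k, pd k (radialWeight e ε) x =
      -e * ε * (1 + ε * ‖x‖ ^ 2)⁻¹ * radialWeight e ε x * x k := fun k => by
    refine (pd_comp_norm_sq hd k).trans ?_
    rw [Real.rpow_sub_one hpos.ne', radialWeight]
    field_simp
  have h2 : gradSq (radialWeight e ε) x =
      e ^ 2 * (radialWeight e ε x ^ 2 * (ε ^ 2 * ((1 + ε * ‖x‖ ^ 2) ^ 2)⁻¹ * ‖x‖ ^ 2)) := by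
    simp only [gradSq, h1, mul_pow, inv_pow]
    rw [← Finset.mul_sum, ← EuclideanSpace.real_norm_sq_eq]
    ring
  rw [h2]
  refine mul_le_mul_of_nonneg_left (mul_le_mul_of_nonneg_left ?_ (sq_nonneg _)) (sq_nonneg _)
  rw [mul_right_comm, ← div_eq_mul_inv, ← one_div, div_le_div_iff₀ (by positivity) (by positivity)]
  nlinarith [mul_nonneg hε.le (sub_nonneg.2 hε1), sq_nonneg ‖x‖,
    mul_nonneg (mul_nonneg hε.le (sub_nonneg.2 hε1)) (sq_nonneg ‖x‖),
    mul_nonneg hε.le (sq_nonneg ‖x‖)]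

theorem gradSq_mul_le {f g : Euc n → ℝ} {x : Euc n} (hf : DifferentiableAt ℝ f x)
    (hg : DifferentiableAt ℝ g x) {δ : ℝ} (hδ : 0 < δ) :
    gradSq (fun y => f y * g y) x ≤
      (1 + δ) * (f x ^ 2 * gradSq g x) + (1 + δ⁻¹) * (g x ^ 2 * gradSq f x) := by
  simp only [gradSq, pd_mul hf hg, Finset.mul_sum]
  rw [← Finset.sum_add_distrib]
  refine Finset.sum_le_sum fun k _ => ?_
  have h1 : δ * δ⁻¹ = 1 := mul_inv_cancel₀ hδ.ne'
  have h2 : 0 ≤ δ⁻¹ * (δ * (f x * pd k g x) - pd k f x * g x) ^ 2 :=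
    mul_nonneg (inv_nonneg.2 hδ.le) (sq_nonneg _)
  have h3 : δ⁻¹ * (δ * (f x * pd k g x) - pd k f x * g x) ^ 2 =
      δ * (δ * δ⁻¹) * (f x * pd k g x) ^ 2 - 2 * (δ * δ⁻¹) * (f x * pd k g x) * (pd k f x * g x) +
        δ⁻¹ * (pd k f x * g x) ^ 2 := by ring
  rw [h3, h1] at h2
  linarith

theorem gradSq_sub_le {f g : Euc n → ℝ} {x : Euc n} (hf : DifferentiableAt ℝ f x)
    (hg : DifferentiableAt ℝ g x) :
    gradSq (fun y => f y - g y) x ≤ 2 * gradSq f x + 2 * gradSq g x := by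
  simp only [gradSq, pd_sub hf hg, Finset.mul_sum]
  rw [← Finset.sum_add_distrib]
  exact Finset.sum_le_sum fun k _ => by nlinarith [sq_nonneg (pd k f x + pd k g x)]

end RadialWeight

section Supercritical

variable {n m : ℕ} {p : ℝ} {u : Euc n → EuclideanSpace ℝ (Fin m)} {R₀ : ℝ}

/-- The difference of the cutoffs at scales `R` and `r`. -/
def CutoffPair.shell (c : CutoffPair n) (r R : ℝ) (x : Euc n) : ℝ :=
  c.ball (R⁻¹ • x) - c.ball (r⁻¹ • x)

namespace CutoffPair

variable (c : CutoffPair n)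

theorem contDiff_shell (r R : ℝ) : ContDiff ℝ 1 (c.shell r R) :=
  (c.contDiff_ball_smul R).sub (c.contDiff_ball_smul r)

theorem shell_eq_zero_of_lt {r R : ℝ} (hr : 0 < r) (hR : r ≤ R) {x : Euc n} (hx : ‖x‖ < r) :
    c.shell r R x = 0 := by
  rw [shell, c.ball_smul_eq_one hr hx.le, c.ball_smul_eq_one (hr.trans_le hR) (hx.le.trans hR),
    sub_self]

theorem shell_eq_zero_of_ge {r R : ℝ} (hr : 0 < r) (hR : r ≤ R) {x : Euc n} (hx : 2 * R ≤ ‖x‖) :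
    c.shell r R x = 0 := by
  rw [shell, c.ball_smul_eq_zero hr (by linarith), c.ball_smul_eq_zero (hr.trans_le hR) hx,
    sub_self]

theorem shell_eq_one {r R : ℝ} (hr : 0 < r) (hR : r ≤ R) {x : Euc n} (hx : 2 * r ≤ ‖x‖)
    (hx' : ‖x‖ ≤ R) : c.shell r R x = 1 := by
  rw [shell, c.ball_smul_eq_zero hr hx, c.ball_smul_eq_one (hr.trans_le hR) hx', sub_zero]

end CutoffPair

theorem weighted_mass_le (c : CutoffPair n) (hn : 2 ≤ n) (hp : 1 < p) (hu : ContDiff ℝ 2 u)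
    (hsol : ∀ (i : Fin m) (x : Euc n), - lap (fun z => u z i) x = ‖u x‖ ^ (p - 1) * u x i)
    (h : Stable1 n m p u (closure (ball (0 : Euc n) R₀))ᶜ) {r R e ε s : ℝ} (hr : 0 < r)
    (hr₀ : R₀ < r) (hR : r ≤ R) (hε : 0 < ε) (hε1 : ε ≤ 1) (hs : 0 < s) :
    ((p - 1) * (((n : ℝ) - 2) / 2) ^ 2 - p * ((1 + s) * e ^ 2)) *
      ∫ x, ‖u x‖ ^ 2 * (c.shell r R x * radialWeight e ε x) ^ 2 * (1 + ‖x‖ ^ 2)⁻¹ ≤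
    p * ((1 + s⁻¹) * 2) *
      ((∫ x, ‖u x‖ ^ 2 * (radialWeight e ε x ^ 2 * gradSq (fun y => c.ball (R⁻¹ • y)) x)) +
        ∫ x, ‖u x‖ ^ 2 * (radialWeight e ε x ^ 2 * gradSq (fun y => c.ball (r⁻¹ • y)) x)) := by
  have hR0 : 0 < R := hr.trans_le hR
  have hη := c.contDiff_shell r R
  have hβ : ContDiff ℝ 1 (radialWeight e ε : Euc n → ℝ) := contDiff_radialWeight hε
  have hηc : HasCompactSupport (c.shell r R) :=
    hasCompactSupport_of_norm_ge fun x hx => c.shell_eq_zero_of_ge hr hR hx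
  have hψ : ContDiff ℝ 1 fun x => c.shell r R x * radialWeight e ε x := hη.mul hβ
  have hψc : HasCompactSupport fun x => c.shell r R x * radialWeight e ε x := hηc.mul_right
  have hS : tsupport (fun x => c.shell r R x * radialWeight e ε x) ⊆
      (closure (ball (0 : Euc n) R₀))ᶜ :=
    (tsupport_subset_of_norm_lt (r := r) fun x hx => by
      rw [c.shell_eq_zero_of_lt hr hR hx, zero_mul]).trans (subset_compl_closure_ball hr₀)
  have key := stable_hardy_le hn hp hu hsol isClosed_closure.isOpen_compl h hψ hψc hS
  have hi1 : Integrable fun x =>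
      ‖u x‖ ^ 2 * (c.shell r R x * radialWeight e ε x) ^ 2 * (1 + ‖x‖ ^ 2)⁻¹ :=
    (((hu.continuous.norm.pow 2).mul (hψ.continuous.pow 2)).mul
      (contDiff_one_add_norm_sq_inv (a := 0)).continuous).integrable_of_hasCompactSupport
      (hasCompactSupport_sq hψc).mul_left.mul_right
  have hi2 : ∀ q : ℝ, 0 < q → Integrable fun x =>
      ‖u x‖ ^ 2 * (radialWeight e ε x ^ 2 * gradSq (fun y => c.ball (q⁻¹ • y)) x) := fun q hq =>
    ((hu.continuous.norm.pow 2).mul ((hβ.continuous.pow 2).mul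
      (continuous_gradSq (c.contDiff_ball_smul q)))).integrable_of_hasCompactSupport
      (hasCompactSupport_gradSq (c.hasCompactSupport_ball_smul hq)).mul_left.mul_left
  have hle : ∫ x, ‖u x‖ ^ 2 * gradSq (fun y => c.shell r R y * radialWeight e ε y) x ≤
      ∫ x, ((1 + s) * e ^ 2 *
          (‖u x‖ ^ 2 * (c.shell r R x * radialWeight e ε x) ^ 2 * (1 + ‖x‖ ^ 2)⁻¹) +
        (1 + s⁻¹) * 2 *
          (‖u x‖ ^ 2 * (radialWeight e ε x ^ 2 * gradSq (fun y => c.ball (R⁻¹ • y)) x) +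
          ‖u x‖ ^ 2 * (radialWeight e ε x ^ 2 * gradSq (fun y => c.ball (r⁻¹ • y)) x))) := by
    refine integral_mono (integrable_norm_sq_mul_gradSq hu.continuous hψ hψc)
      ((hi1.const_mul _).fun_add (((hi2 R hR0).fun_add (hi2 r hr)).const_mul _)) fun x => ?_
    have d1 := hη.differentiable one_ne_zero x
    have d2 := hβ.differentiable one_ne_zero x
    have g1 := gradSq_mul_le d1 d2 hs
    have g2 : gradSq (c.shell r R) x ≤ _ :=
      gradSq_sub_le ((c.contDiff_ball_smul R).differentiable one_ne_zero x)
        ((c.contDiff_ball_smul r).differentiable one_ne_zero x)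
    have g3 := gradSq_radialWeight_le (e := e) hε hε1 x
    have hs' : 0 < s⁻¹ := inv_pos.2 hs
    calc ‖u x‖ ^ 2 * gradSq (fun y => c.shell r R y * radialWeight e ε y) x ≤ ‖u x‖ ^ 2 *
          ((1 + s) * (c.shell r R x ^ 2 * (e ^ 2 * (radialWeight e ε x ^ 2 * (1 + ‖x‖ ^ 2)⁻¹))) +
          (1 + s⁻¹) * (radialWeight e ε x ^ 2 * (2 * gradSq (fun y => c.ball (R⁻¹ • y)) x +
            2 * gradSq (fun y => c.ball (r⁻¹ • y)) x))) := by
          refine mul_le_mul_of_nonneg_left (g1.trans ?_) (sq_nonneg _)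
          gcongr
      _ = _ := by ring
  rw [integral_add (hi1.const_mul _) (((hi2 R hR0).fun_add (hi2 r hr)).const_mul _),
    integral_const_mul, integral_const_mul, integral_add (hi2 R hR0) (hi2 r hr)] at hle
  have := mul_le_mul_of_nonneg_left hle (by linarith : 0 ≤ p)
  linarith

theorem integral_weight_gradSq_le (c : CutoffPair n) (hu : Continuous u) {B : ℝ} {a : ℕ}
    (ha : a ≠ 0) (hB : ∀ x, gradSq c.ball x ≤ B * c.annulus x ^ (2 * a)) {R e ε : ℝ} (hR : 0 < R)
    (he : 0 < e) (hε : 0 < ε) :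
    ∫ x, ‖u x‖ ^ 2 * (radialWeight e ε x ^ 2 * gradSq (fun y => c.ball (R⁻¹ • y)) x) ≤
      (ε * R ^ 2) ^ (-e) * B * annularMass c u a R := by
  rw [annularMass, ← integral_const_mul]
  refine integral_mono (((hu.norm.pow 2).mul (((contDiff_radialWeight hε).continuous.pow 2).mul
    (continuous_gradSq (c.contDiff_ball_smul R)))).integrable_of_hasCompactSupport
    (hasCompactSupport_gradSq (c.hasCompactSupport_ball_smul hR)).mul_left.mul_left)
    ((integrable_annularMass c hu ha hR).const_mul _) fun x => ?_
  beta_reduce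
  have h1 := hB (R⁻¹ • x)
  have h0 := gradSq_nonneg c.ball (R⁻¹ • x)
  rw [gradSq_comp_smul]
  have h2 : radialWeight e ε x ^ 2 * gradSq c.ball (R⁻¹ • x) ≤
      (ε * R ^ 2) ^ (-e) * (B * c.annulus (R⁻¹ • x) ^ (2 * a)) := by
    rcases lt_or_ge ‖x‖ R with hx | hx
    · have h3 : gradSq c.ball (R⁻¹ • x) = 0 := Finset.sum_eq_zero fun k _ => by
        rw [c.pd_ball_eq_zero (Or.inl (by rwa [norm_inv_smul hR, div_lt_one hR])) k]
        norm_num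
      rw [h3] at h1 ⊢
      rw [mul_zero]
      positivity
    · exact mul_le_mul (radialWeight_sq_le he hε hR hx) h1 h0 (by positivity)
  calc _ = (R⁻¹ ^ 2 * ‖u x‖ ^ 2) * (radialWeight e ε x ^ 2 * gradSq c.ball (R⁻¹ • x)) := by ring
    _ ≤ (R⁻¹ ^ 2 * ‖u x‖ ^ 2) *
        ((ε * R ^ 2) ^ (-e) * (B * c.annulus (R⁻¹ • x) ^ (2 * a))) :=
      mul_le_mul_of_nonneg_left h2 (by positivity)
    _ = _ := by ring

theorem continuous_norm_sq_mul_inv (hu : Continuous u) :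
    Continuous fun x => ‖u x‖ ^ 2 * (1 + ‖x‖ ^ 2)⁻¹ :=
  (hu.norm.pow 2).mul (contDiff_one_add_norm_sq_inv (a := 0)).continuous

theorem integral_closedBall_le (c : CutoffPair n) (hu : Continuous u) {r R e T : ℝ} (hr : 0 < r)
    (hR : r ≤ R) (he : 0 < e) (hT : 1 ≤ T) (hTR : T ≤ R) :
    ∫ x in closedBall (0 : Euc n) T, ‖u x‖ ^ 2 * (1 + ‖x‖ ^ 2)⁻¹ ≤
      2 ^ e * (∫ x, ‖u x‖ ^ 2 * (c.shell r R x * radialWeight e (T⁻¹ ^ 2) x) ^ 2 *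
        (1 + ‖x‖ ^ 2)⁻¹) +
      ∫ x in closedBall (0 : Euc n) (2 * r), ‖u x‖ ^ 2 * (1 + ‖x‖ ^ 2)⁻¹ := by
  have hT0 : 0 < T := by linarith
  have hε : 0 < T⁻¹ ^ 2 := by positivity
  have hf := continuous_norm_sq_mul_inv hu
  have hball : ∀ q : ℝ, IntegrableOn (fun x => ‖u x‖ ^ 2 * (1 + ‖x‖ ^ 2)⁻¹)
      (closedBall (0 : Euc n) q) := fun q =>
    hf.continuousOn.integrableOn_compact (isCompact_closedBall _ _)
  have hηc : HasCompactSupport (c.shell r R) :=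
    hasCompactSupport_of_norm_ge fun x hx => c.shell_eq_zero_of_ge hr hR hx
  have hψc : HasCompactSupport fun x => c.shell r R x * radialWeight e (T⁻¹ ^ 2) x :=
    hηc.mul_right
  have hi : Integrable fun x =>
      ‖u x‖ ^ 2 * (c.shell r R x * radialWeight e (T⁻¹ ^ 2) x) ^ 2 * (1 + ‖x‖ ^ 2)⁻¹ :=
    (((hu.norm.pow 2).mul (((c.contDiff_shell r R).continuous.mul
      (contDiff_radialWeight hε).continuous).pow 2)).mul
      (contDiff_one_add_norm_sq_inv (a := 0)).continuous).integrable_of_hasCompactSupport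
      (hasCompactSupport_sq hψc).mul_left.mul_right
  rw [← integral_indicator isClosed_closedBall.measurableSet,
    ← integral_indicator isClosed_closedBall.measurableSet, ← integral_const_mul,
    ← integral_add (hi.const_mul _)
      ((integrable_indicator_iff isClosed_closedBall.measurableSet).2 (hball _))]
  refine integral_mono ((integrable_indicator_iff isClosed_closedBall.measurableSet).2 (hball _))
    ((hi.const_mul _).fun_add
      ((integrable_indicator_iff isClosed_closedBall.measurableSet).2 (hball _))) fun x => ?_
  have h1 : 0 ≤ 2 ^ e * (‖u x‖ ^ 2 * (c.shell r R x * radialWeight e (T⁻¹ ^ 2) x) ^ 2 *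
      (1 + ‖x‖ ^ 2)⁻¹) := by positivity
  have h2 : 0 ≤ ‖u x‖ ^ 2 * (1 + ‖x‖ ^ 2)⁻¹ := by positivity
  by_cases hxr : ‖x‖ ≤ 2 * r
  · rw [indicator_of_mem (mem_closedBall_zero_iff.2 hxr)]
    by_cases hxT : ‖x‖ ≤ T
    · rw [indicator_of_mem (mem_closedBall_zero_iff.2 hxT)]
      linarith
    · rw [indicator_of_notMem (hxT <| mem_closedBall_zero_iff.1 ·)]
      linarith
  · rw [indicator_of_notMem (hxr <| mem_closedBall_zero_iff.1 ·), add_zero]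
    by_cases hxT : ‖x‖ ≤ T
    · rw [indicator_of_mem (mem_closedBall_zero_iff.2 hxT),
        c.shell_eq_one hr hR (not_le.1 hxr).le (hxT.trans hTR), one_mul]
      have h3 : (2 : ℝ) ^ (-e) ≤ radialWeight e (T⁻¹ ^ 2) x ^ 2 := by
        refine le_radialWeight_sq he hε ?_
        rw [← mul_pow, inv_mul_eq_div]
        exact pow_le_one₀ (by positivity) ((div_le_one hT0).2 hxT)
      rw [Real.rpow_neg zero_le_two, inv_le_iff_one_le_mul₀ (by positivity)] at h3
      calc _ = ‖u x‖ ^ 2 * (1 + ‖x‖ ^ 2)⁻¹ * 1 := by ring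
        _ ≤ ‖u x‖ ^ 2 * (1 + ‖x‖ ^ 2)⁻¹ * (radialWeight e (T⁻¹ ^ 2) x ^ 2 * 2 ^ e) :=
          mul_le_mul_of_nonneg_left h3 h2
        _ = _ := by ring
    · rwa [indicator_of_notMem (hxT <| mem_closedBall_zero_iff.1 ·)]

end Supercritical

section Decay

variable {n m : ℕ} {p : ℝ} {u : Euc n → EuclideanSpace ℝ (Fin m)} {R₀ : ℝ}

theorem integrable_norm_sq_mul_inv (c : CutoffPair n) (hn : 2 ≤ n) (hp : 1 < p)
    (ht : 2 / (p - 1) < ((n : ℝ) - 2) / 2)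
    (hJL : (((n : ℝ) - 2) / 2) ^ 2 <
      (2 / (p - 1) + 2) * (2 * (((n : ℝ) - 2) / 2) - 2 / (p - 1)))
    (hu : ContDiff ℝ 2 u)
    (hsol : ∀ (i : Fin m) (x : Euc n), - lap (fun z => u z i) x = ‖u x‖ ^ (p - 1) * u x i)
    (hR₀ : 0 < R₀) (h : Stable1 n m p u (closure (ball (0 : Euc n) R₀))ᶜ) :
    Integrable fun x => ‖u x‖ ^ 2 * (1 + ‖x‖ ^ 2)⁻¹ := by
  have hp1 : 0 < p - 1 := by linarith
  obtain ⟨s, hs, hsp⟩ := exists_pos_mul_sq_lt hp hJL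
  obtain ⟨a, ha⟩ := exists_nat_ge (2 / (p - 1) + 1)
  have ha0 : a ≠ 0 := by
    rintro rfl
    have : 0 < 2 / (p - 1) := by positivity
    norm_num at ha
    linarith
  obtain ⟨C, hC0, hC⟩ := exists_annularMass_le c hp hu hsol hR₀ h ha
  obtain ⟨B, hB0, hB⟩ := c.exists_gradSq_ball_le
  set e := ((n : ℝ) - 2) / 2 - 2 / (p - 1) + s with he
  have he0 : 0 < e := by linarith
  set r := R₀ + 1 with hr
  have hr0 : 0 < r := by linarith
  set δ := (p - 1) * (((n : ℝ) - 2) / 2) ^ 2 - p * ((1 + s) * e ^ 2) with hδ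
  have hδ0 : 0 < δ := by linarith
  set M := ∫ x, ‖u x‖ ^ 2 * gradSq (fun y => c.ball (r⁻¹ • y)) x with hM
  have hf := continuous_norm_sq_mul_inv hu.continuous
  have hcover := aecover_closedBall (μ := volume) (x := (0 : Euc n)) tendsto_id
  refine hcover.integrable_of_integral_bounded_of_nonneg_ae
    (2 ^ e * (p * ((1 + s⁻¹) * 2) * (1 + M) / δ) +
      ∫ x in closedBall (0 : Euc n) (2 * r), ‖u x‖ ^ 2 * (1 + ‖x‖ ^ 2)⁻¹)
    (fun T => hf.continuousOn.integrableOn_compact (isCompact_closedBall _ _))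
    (Eventually.of_forall fun x => by positivity) ?_
  filter_upwards [eventually_ge_atTop (1 : ℝ)] with T hT
  have hT0 : 0 < T := by linarith
  set ε := T⁻¹ ^ 2 with hε
  have hε0 : 0 < ε := by positivity
  have hε1 : ε ≤ 1 := pow_le_one₀ (by positivity) (inv_le_one_of_one_le₀ hT)
  have hlim : Tendsto (fun R : ℝ => ε ^ (-e) * B * C * R ^ (-(2 * s))) atTop (nhds 0) := by
    simpa using (tendsto_rpow_neg_atTop (by positivity : 0 < 2 * s)).const_mul (ε ^ (-e) * B * C)
  obtain ⟨R, hR1, hRT, hRr⟩ := ((hlim.eventually_le_const one_pos).and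
    ((eventually_ge_atTop T).and (eventually_ge_atTop (2 * (R₀ + 1))))).exists
  have hR0 : 0 < R := by linarith
  have hrR : r ≤ R := by linarith
  have hfar : ∫ x, ‖u x‖ ^ 2 * (radialWeight e ε x ^ 2 * gradSq (fun y => c.ball (R⁻¹ • y)) x) ≤
      1 := by
    refine (integral_weight_gradSq_le c hu.continuous ha0 (fun x => hB (2 * a) x) hR0 he0
      hε0).trans (le_trans ?_ hR1)
    have h1 := mul_le_mul_of_nonneg_left (hC R hRr)
      (by positivity : 0 ≤ (ε * R ^ 2) ^ (-e) * B)
    refine h1.trans_eq ?_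
    rw [mul_rpow hε0.le (by positivity), ← rpow_natCast R 2, ← rpow_mul hR0.le,
      show -(2 * s) = ((2 : ℕ) : ℝ) * -e + ((n : ℝ) - 2 - 2 * (2 / (p - 1))) by
        rw [he]; push_cast; ring, rpow_add hR0]
    ring
  have hg : Continuous (gradSq fun y => c.ball (r⁻¹ • y)) :=
    continuous_gradSq (c.contDiff_ball_smul r)
  have hgc : HasCompactSupport (gradSq fun y => c.ball (r⁻¹ • y)) :=
    hasCompactSupport_gradSq (c.hasCompactSupport_ball_smul hr0)
  have hnear : ∫ x, ‖u x‖ ^ 2 * (radialWeight e ε x ^ 2 * gradSq (fun y => c.ball (r⁻¹ • y)) x) ≤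
      M :=
    integral_mono
      (((hu.continuous.norm.pow 2).mul (((contDiff_radialWeight hε0).continuous.pow 2).mul
        hg)).integrable_of_hasCompactSupport hgc.mul_left.mul_left)
      (((hu.continuous.norm.pow 2).mul hg).integrable_of_hasCompactSupport hgc.mul_left)
      fun x => mul_le_mul_of_nonneg_left
        (mul_le_of_le_one_left (gradSq_nonneg _ _) (radialWeight_sq_le_one he0 hε0 x))
        (sq_nonneg _)
  have hmass := weighted_mass_le (e := e) c hn hp hu hsol h hr0 (by linarith) hrR hε0 hε1 hs
  refine (integral_closedBall_le c hu.continuous hr0 hrR he0 hT hRT).trans ?_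
  gcongr
  rw [le_div_iff₀ hδ0, mul_comm]
  refine hmass.trans (mul_le_mul_of_nonneg_left (add_le_add hfar hnear) ?_)
  have := inv_pos.2 hs
  have : 0 < p := by linarith
  positivity

theorem tendsto_annularMass_of_integrable (c : CutoffPair n) (hu : Continuous u) {a : ℕ}
    (ha : a ≠ 0) (hf : Integrable fun x => ‖u x‖ ^ 2 * (1 + ‖x‖ ^ 2)⁻¹) :
    Tendsto (fun R => annularMass c u a R) atTop (nhds 0) := by
  rw [← integral_zero (Euc n) ℝ]
  refine tendsto_integral_filter_of_dominated_convergence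
    (fun x => 17 * (‖u x‖ ^ 2 * (1 + ‖x‖ ^ 2)⁻¹)) ?_ ?_ (hf.const_mul _) ?_
  · filter_upwards [eventually_gt_atTop (0 : ℝ)] with R hR
    exact (integrable_annularMass c hu ha hR).aestronglyMeasurable
  · filter_upwards [eventually_ge_atTop (1 : ℝ)] with R hR
    refine Eventually.of_forall fun x => ?_
    have hR0 : 0 < R := by linarith
    have h0 := c.annulus_nonneg (R⁻¹ • x)
    rw [Real.norm_of_nonneg (by positivity)]
    rcases le_or_gt (4 * R) ‖x‖ with hx | hx
    · rw [c.annulus_smul_eq_zero_of_ge hR0 hx, zero_pow (by simpa using ha), mul_zero]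
      positivity
    · have h1 : R⁻¹ ^ 2 ≤ 17 * (1 + ‖x‖ ^ 2)⁻¹ := by
        rw [inv_pow, ← div_eq_mul_inv, le_div_iff₀ (by positivity), inv_mul_le_iff₀ (by positivity)]
        nlinarith [norm_nonneg x]
      calc _ ≤ R⁻¹ ^ 2 * ‖u x‖ ^ 2 :=
            mul_le_of_le_one_right (by positivity) (pow_le_one₀ h0 (c.annulus_le_one _))
        _ ≤ 17 * (1 + ‖x‖ ^ 2)⁻¹ * ‖u x‖ ^ 2 := by gcongr
        _ = _ := by ring
  · refine Eventually.of_forall fun x => tendsto_const_nhds.congr' ?_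
    filter_upwards [eventually_ge_atTop (2 * ‖x‖), eventually_gt_atTop (0 : ℝ)] with R hR hR0
    rw [c.annulus_smul_eq_zero_of_le hR0 (by linarith), zero_pow (by simpa using ha), mul_zero]

theorem tendsto_annularMass_of_subcritical (c : CutoffPair n) (hp : 1 < p)
    (hsub : (n : ℝ) - 2 < 2 * (2 / (p - 1))) (hu : ContDiff ℝ 2 u)
    (hsol : ∀ (i : Fin m) (x : Euc n), - lap (fun z => u z i) x = ‖u x‖ ^ (p - 1) * u x i)
    (hR₀ : 0 < R₀) (h : Stable1 n m p u (closure (ball (0 : Euc n) R₀))ᶜ) {a : ℕ}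
    (ha : 2 / (p - 1) + 1 ≤ a) :
    Tendsto (fun R => annularMass c u a R) atTop (nhds 0) := by
  obtain ⟨C, -, hC⟩ := exists_annularMass_le c hp hu hsol hR₀ h ha
  have hlim : Tendsto (fun R : ℝ => C * R ^ (-(2 * (2 / (p - 1)) - ((n : ℝ) - 2)))) atTop
      (nhds 0) := by
    simpa using (tendsto_rpow_neg_atTop (sub_pos.2 hsub)).const_mul C
  refine tendsto_of_tendsto_of_tendsto_of_le_of_le' tendsto_const_nhds hlim
    (Eventually.of_forall fun R => annularMass_nonneg c u a R) ?_
  filter_upwards [eventually_ge_atTop (2 * (R₀ + 1))] with R hR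
  rw [neg_sub]
  exact hC R hR

end Decay

/-- Liouville theorem for finite Morse index (stable outside a compact set) solutions of
the Lane–Emden system `−Δu_i = |u|^{p−1} u_i` in the noncritical subcritical and
supercritical-below-`p_c(n)` ranges (noncritical part of Theorem 2.1). -/
theorem statement4 (n m : ℕ) (hn : 3 ≤ n) (hm : 1 ≤ m) (p : ℝ) (hp : 1 < p)
    (hrange :
      p < ((n : ℝ) + 2) / ((n : ℝ) - 2) ∨
      (((n : ℝ) + 2) / ((n : ℝ) - 2) < p ∧
        (11 ≤ n →
          p < (((n : ℝ) - 2) ^ 2 - 4 * (n : ℝ) + 8 * Real.sqrt ((n : ℝ) - 1)) /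
              (((n : ℝ) - 2) * ((n : ℝ) - 10)))))
    (u : Euc n → EuclideanSpace ℝ (Fin m)) (hreg : ContDiff ℝ 2 u)
    (hsol : ∀ (i : Fin m) (x : Euc n), - lap (fun z => u z i) x = ‖u x‖ ^ (p - 1) * u x i)
    (hstab : ∃ R₀ : ℝ, 0 < R₀ ∧ Stable1 n m p u (closure (ball (0 : Euc n) R₀))ᶜ) :
    ∀ (i : Fin m) (x : Euc n), u x i = 0 := by
  obtain ⟨R₀, hR₀, h⟩ := hstab
  obtain ⟨c⟩ := nonempty_cutoffPair n
  have hn' : (3 : ℝ) ≤ n := by exact_mod_cast hn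
  have hn2 : (0 : ℝ) < n - 2 := by linarith
  have hp1 : 0 < p - 1 := by linarith
  obtain ⟨a, ha⟩ := exists_nat_ge (2 / (p - 1) + 1)
  have ha0 : a ≠ 0 := by
    rintro rfl
    have : 0 < 2 / (p - 1) := by positivity
    norm_num at ha
    linarith
  have hcrit : (n : ℝ) / (p + 1) - ((n : ℝ) - 2) / 2 ≠ 0 := by
    intro h0
    rw [sub_eq_zero, div_eq_div_iff (by linarith) two_ne_zero] at h0
    have hpc : p = ((n : ℝ) + 2) / ((n : ℝ) - 2) := by
      rw [eq_div_iff hn2.ne']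
      linarith
    rcases hrange with h1 | ⟨h1, -⟩ <;> linarith
  have hlim : Tendsto (fun R => annularMass c u a R) atTop (nhds 0) := by
    rcases hrange with hsub | ⟨hsup, hpc⟩
    · refine tendsto_annularMass_of_subcritical c hp ?_ hreg hsol hR₀ h ha
      rw [lt_div_iff₀ hn2] at hsub
      rw [← mul_div_assoc, lt_div_iff₀ hp1]
      linarith
    · obtain ⟨ht, hJL⟩ := sq_lt_of_joseph_lundgren hn hp hsup hpc
      exact tendsto_annularMass_of_integrable c hreg.continuous ha0
        (integrable_norm_sq_mul_inv c (by omega) hp ht hJL hreg hsol hR₀ h)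
  intro i x
  rw [eq_zero_of_tendsto_annularMass c (by omega) hp hcrit hreg hsol hR₀ h ha0 hlim x]
  rfl
end
end

section
/- Let n ≥ 3, m ≥ 1, p = (n+2)/(n−2), and let u = (u_1,…,u_m) be a C² solution of −Δu_i = |u|^{p−1} u_i on ℝⁿ that is stable outside a compact set. Then u has finite energy: ∫_{ℝⁿ} |u|^{p+1} dx = Σ_i ∫_{ℝⁿ} |∇u_i|² dx < ∞. If moreover u is stable on all of ℝⁿ, then u_i ≡ 0 for every i. -/
open MeasureTheory Metric Filter Real Set

noncomputable section

open scoped Topology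

open ContinuousLinearMap in
/-- A compactly supported `C¹` function is the limit, together with its derivative, of smooth
functions whose supports stay in a fixed compact subset of a given neighbourhood of its support. -/
theorem exists_smooth_approx_s5 {n : ℕ} {S : Set (Euc n)} (hS : IsOpen S) {g : Euc n → ℝ}
    (hg : ContDiff ℝ 1 g) (hgc : HasCompactSupport g) (hgS : tsupport g ⊆ S) :
    ∃ (K : Set (Euc n)) (C : ℝ) (φ : ℕ → Euc n → ℝ), IsCompact K ∧ K ⊆ S ∧
      (∀ k, ContDiff ℝ (⊤ : ℕ∞) (φ k)) ∧ (∀ k, tsupport (φ k) ⊆ K) ∧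
      (∀ k x, |φ k x| ≤ C) ∧ (∀ k x, ‖gradient (φ k) x‖ ≤ C) ∧
      (∀ x, Tendsto (fun k => φ k x) atTop (𝓝 (g x))) ∧
      (∀ x, Tendsto (fun k => gradient (φ k) x) atTop (𝓝 (gradient g x))) := by
  obtain ⟨δ, hδ, hδS⟩ := hgc.isCompact.exists_cthickening_subset_open hS hgS
  have hg' : Continuous (fderiv ℝ g) := hg.continuous_fderiv one_ne_zero
  obtain ⟨C₁, hC₁⟩ := hgc.exists_bound_of_continuous hg.continuous
  obtain ⟨C₂, hC₂⟩ := (hgc.fderiv ℝ).exists_bound_of_continuous hg'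
  let b : ℕ → ContDiffBump (0 : Euc n) := fun k =>
    ⟨δ / (k + 2) / 2, δ / (k + 2), by positivity, by
      have : 0 < δ / (k + 2) := by positivity
      linarith⟩
  have hb : Tendsto (fun k => (b k).rOut) atTop (𝓝 0) := by
    have : Tendsto (fun k : ℕ => δ / ((k : ℝ) + 2)) atTop (𝓝 0) :=
      tendsto_const_nhds.div_atTop
        (tendsto_atTop_add_const_right _ _ tendsto_natCast_atTop_atTop)
    exact this
  let φ : ℕ → Euc n → ℝ := fun k =>
    MeasureTheory.convolution ((b k).normed volume) g (lsmul ℝ ℝ) volume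
  have hloc : ∀ k, LocallyIntegrable ((b k).normed volume) (volume : Measure (Euc n)) := fun k =>
    (b k).continuous_normed.locallyIntegrable
  have hderiv : ∀ k x, fderiv ℝ (φ k) x =
      MeasureTheory.convolution ((b k).normed volume) (fderiv ℝ g) (lsmul ℝ ℝ) volume x := by
    intro k x
    rw [(hgc.hasFDerivAt_convolution_right (lsmul ℝ ℝ) (hloc k) hg x).fderiv]
    simp only [MeasureTheory.convolution]
    congr 1
  have hbound : ∀ {F : Type} [NormedAddCommGroup F] [NormedSpace ℝ F] [CompleteSpace F]
      (h : Euc n → F) (C : ℝ), Continuous h → (∀ x, ‖h x‖ ≤ C) → ∀ k x,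
      ‖MeasureTheory.convolution ((b k).normed volume) h (lsmul ℝ ℝ) volume x‖ ≤ C := by
    intro F _ _ _ h C hh hC k x
    rw [← dist_zero_right]
    exact dist_convolution_le ((norm_nonneg _).trans (hC 0)) (b k).support_normed_eq.subset
      (b k).nonneg_normed (b k).integral_normed hh.aestronglyMeasurable
      (fun y _ => by rw [dist_zero_right]; exact hC y)
  have hgrad : ∀ (f : Euc n → ℝ) x, gradient f x =
    (InnerProductSpace.toDual ℝ (Euc n)).symm (fderiv ℝ f x) := fun f x => rfl
  refine ⟨cthickening δ (tsupport g), max C₁ C₂, φ, hgc.isCompact.cthickening, hδS, ?_, ?_, ?_, ?_,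
    ?_, ?_⟩
  · intro k
    exact (b k).hasCompactSupport_normed.contDiff_convolution_left _ (b k).contDiff_normed
      hg.continuous.locallyIntegrable
  · intro k
    refine closure_minimal ?_ isClosed_cthickening
    refine (support_convolution_subset (L := lsmul ℝ ℝ)).trans ?_
    rw [(b k).support_normed_eq]
    rintro _ ⟨y, hy, z, hz, rfl⟩
    refine mem_cthickening_of_dist_le _ z _ _ (subset_tsupport _ hz) ?_
    rw [mem_ball_zero_iff] at hy
    have h1 : (b k).rOut ≤ δ := div_le_self hδ.le (by
      have : (0 : ℝ) ≤ k := Nat.cast_nonneg k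
      linarith)
    simpa using hy.le.trans h1
  · intro k x
    exact (hbound g C₁ hg.continuous hC₁ k x).trans (le_max_left _ _)
  · intro k x
    rw [hgrad, LinearIsometryEquiv.norm_map, hderiv]
    exact (hbound _ C₂ hg' hC₂ k x).trans (le_max_right _ _)
  · intro x
    exact ContDiffBump.convolution_tendsto_right_of_continuous hb hg.continuous x
  · intro x
    simp only [hgrad, hderiv]
    exact ((LinearIsometryEquiv.continuous _).tendsto _).comp
      (ContDiffBump.convolution_tendsto_right_of_continuous hb hg' x)

/-- Green's first identity against a compactly supported test function. -/
theorem integral_neg_lap_mul {n : ℕ} {f g : Euc n → ℝ} (hf : ContDiff ℝ 2 f)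
    (hg : ContDiff ℝ 1 g) (hgc : HasCompactSupport g) :
    ∫ x, -lap f x * g x = ∫ x, inner ℝ (gradient f x) (gradient g x) := by
  have hf' : ContDiff ℝ 1 (fderiv ℝ f) := hf.fderiv_right (by norm_num)
  have hg' : Continuous (fderiv ℝ g) := hg.continuous_fderiv one_ne_zero
  have hd : ∀ i : Fin n, ContDiff ℝ 1 (fun x => fderiv ℝ f x (EuclideanSpace.single i 1)) :=
    fun i => hf'.clm_apply contDiff_const
  have hlap : ∀ x, lap f x = ∑ i : Fin n, fderiv ℝ
      (fun y => fderiv ℝ f y (EuclideanSpace.single i 1)) x (EuclideanSpace.single i 1) := by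
    intro x
    refine Finset.sum_congr rfl fun i _ => ?_
    rw [iteratedFDeriv_two_apply, fderiv_clm_apply (hf'.differentiable one_ne_zero x)
      (differentiableAt_const _)]
    simp
  have hinner : ∀ x, inner ℝ (gradient f x) (gradient g x) = ∑ i : Fin n,
      fderiv ℝ f x (EuclideanSpace.single i 1) * fderiv ℝ g x (EuclideanSpace.single i 1) := by
    intro x
    have h : ∀ (h : Euc n → ℝ) i, gradient h x i = fderiv ℝ h x (EuclideanSpace.single i 1) := by
      intro h i
      rw [← inner_gradient_left, EuclideanSpace.inner_single_right]
      simp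
    rw [PiLp.inner_apply]
    simp [h, mul_comm]
  have hcont : ∀ i : Fin n, Continuous fun x => fderiv ℝ
      (fun y => fderiv ℝ f y (EuclideanSpace.single i 1)) x (EuclideanSpace.single i 1) :=
    fun i => ((hd i).continuous_fderiv one_ne_zero).clm_apply continuous_const
  have h1 : ∀ i : Fin n, Integrable (fun x => fderiv ℝ
      (fun y => fderiv ℝ f y (EuclideanSpace.single i 1)) x (EuclideanSpace.single i 1) * g x) :=
    fun i => ((hcont i).mul hg.continuous).integrable_of_hasCompactSupport hgc.mul_left
  have h2 : ∀ i : Fin n, Integrable (fun x => fderiv ℝ f x (EuclideanSpace.single i 1) *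
      fderiv ℝ g x (EuclideanSpace.single i 1)) := fun i =>
    ((hd i).continuous.mul (hg'.clm_apply continuous_const)).integrable_of_hasCompactSupport
      (hgc.fderiv_apply ℝ _).mul_left
  have h3 : ∀ i : Fin n, Integrable (fun x => fderiv ℝ f x (EuclideanSpace.single i 1) * g x) :=
    fun i => ((hd i).continuous.mul hg.continuous).integrable_of_hasCompactSupport hgc.mul_left
  simp only [hlap, hinner, neg_mul, Finset.sum_mul]
  rw [integral_neg, integral_finsetSum _ (fun i _ => h1 i), integral_finsetSum _ (fun i _ => h2 i),
    ← Finset.sum_neg_distrib]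
  refine Finset.sum_congr rfl fun i _ => ?_
  rw [integral_mul_fderiv_eq_neg_fderiv_mul_of_integrable (h1 i) (h2 i) (h3 i)
    (fun x _ => (hd i).differentiable one_ne_zero x)
    (fun x _ => hg.differentiable one_ne_zero x)]

theorem tendsto_integral_mul_of_bounded {n : ℕ} {K : Set (Euc n)} (hK : IsCompact K)
    {W V : Euc n → ℝ} (hW : Measurable W) (hV : Continuous V) (hWV : ∀ x, |W x| ≤ V x)
    {a : ℕ → Euc n → ℝ} {b : Euc n → ℝ} (ha : ∀ k, Continuous (a k)) {C : ℝ}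
    (haC : ∀ k x, |a k x| ≤ C) (haK : ∀ k, ∀ x ∉ K, a k x = 0)
    (hab : ∀ x, Tendsto (fun k => a k x) atTop (𝓝 (b x))) :
    Tendsto (fun k => ∫ x, W x * a k x) atTop (𝓝 (∫ x, W x * b x)) := by
  refine tendsto_integral_of_dominated_convergence (K.indicator fun x => V x * C)
    (fun k => (hW.mul (ha k).measurable).aestronglyMeasurable) ?_ ?_ ?_
  · rw [integrable_indicator_iff hK.measurableSet]
    exact (hV.mul continuous_const).continuousOn.integrableOn_compact hK
  · refine fun k => Eventually.of_forall fun x => ?_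
    by_cases hx : x ∈ K
    · rw [indicator_of_mem hx, Real.norm_eq_abs, abs_mul]
      exact mul_le_mul (hWV x) (haC k x) (abs_nonneg _) ((abs_nonneg _).trans (hWV x))
    · simp [indicator_of_notMem hx, haK k x hx]
  · exact Eventually.of_forall fun x => (hab x).const_mul _

theorem abs_coord_le {m : ℕ} (v : EuclideanSpace ℝ (Fin m)) (i : Fin m) : |v i| ≤ ‖v‖ := by
  simpa using PiLp.norm_apply_le v i

theorem abs_rpow_mul_coord_mul_coord_le {m : ℕ} (p : ℝ)
    (v : EuclideanSpace ℝ (Fin m)) (i j : Fin m) :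
    |‖v‖ ^ (p - 3) * v i * v j| ≤ ‖v‖ ^ (p - 1) := by
  rcases eq_or_ne v 0 with rfl | hv
  · simpa using Real.rpow_nonneg le_rfl _
  have hv' : 0 < ‖v‖ := norm_pos_iff.mpr hv
  have h : ‖v‖ ^ (p - 1) = ‖v‖ ^ (p - 3) * ‖v‖ * ‖v‖ := by
    rw [mul_assoc, ← sq, ← Real.rpow_natCast, ← Real.rpow_add hv']
    norm_num
    ring_nf
  rw [h, abs_mul, abs_mul, abs_of_nonneg (Real.rpow_nonneg (norm_nonneg v) _)]
  gcongr <;> exact abs_coord_le v _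

/-- The stability inequality extends from smooth to `C¹` test functions. -/
theorem Stable1.le_of_contDiff_one {n m : ℕ} {p : ℝ} (hp : 1 < p)
    {u : Euc n → EuclideanSpace ℝ (Fin m)} (hu : Continuous u) {S : Set (Euc n)} (hS : IsOpen S)
    (h : Stable1 n m p u S) {φ : Fin m → Euc n → ℝ} (hφ : ∀ i, ContDiff ℝ 1 (φ i))
    (hφc : ∀ i, HasCompactSupport (φ i)) (hφS : ∀ i, tsupport (φ i) ⊆ S) :
    (∑ i, ∫ x, ‖u x‖ ^ (p - 1) * (φ i x) ^ 2) +
      (p - 1) * ∑ i, ∑ j, ∫ x, ‖u x‖ ^ (p - 3) * u x i * u x j * φ i x * φ j x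
      ≤ ∑ i, ∫ x, ‖gradient (φ i) x‖ ^ 2 := by
  choose K C ψ hK hKS hψ hψK hψC hψC' hψl hψl' using
    fun i => exists_smooth_approx_s5 hS (hφ i) (hφc i) (hφS i)
  have hzero : ∀ i k, ∀ x ∉ K i, ψ i k x = 0 := fun i k x hx =>
    image_eq_zero_of_notMem_tsupport fun hx' => hx (hψK i k hx')
  have hzero' : ∀ i k, ∀ x ∉ K i, gradient (ψ i k) x = 0 := by
    intro i k x hx
    have : fderiv ℝ (ψ i k) x = 0 := image_eq_zero_of_notMem_tsupport fun hx' =>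
      hx (hψK i k (tsupport_fderiv_subset ℝ hx'))
    simp [gradient, this]
  have hcont : ∀ i k, Continuous (ψ i k) := fun i k => (hψ i k).continuous
  have hcont' : ∀ i k, Continuous (gradient (ψ i k)) := fun i k =>
    (LinearIsometryEquiv.continuous _).comp ((hψ i k).continuous_fderiv (by simp))
  have hum : ∀ i, Measurable fun x => u x i := fun i => by
    have : Continuous fun x => u x i := by fun_prop
    exact this.measurable
  have hV : Continuous fun x => ‖u x‖ ^ (p - 1) :=
    hu.norm.rpow_const fun x => Or.inr (by linarith)
  refine le_of_tendsto_of_tendsto' (b := (atTop : Filter ℕ)) ?_ ?_ fun k =>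
    h (fun i => ψ i k) (fun i => hψ i k)
    (fun i => (hK i).of_isClosed_subset (isClosed_tsupport _) (hψK i k))
    fun i => (hψK i k).trans (hKS i)
  · refine (tendsto_finsetSum _ fun i _ => ?_).add
      ((tendsto_finsetSum _ fun i _ => tendsto_finsetSum _ fun j _ => ?_).const_mul _)
    · refine tendsto_integral_mul_of_bounded (hK i) hV.measurable hV
        (fun x => (abs_of_nonneg (by positivity)).le) (fun k => (hcont i k).pow 2) (C := C i ^ 2)
        (fun k x => ?_) (fun k x hx => by simp [hzero i k x hx]) (fun x => (hψl i x).pow 2)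
      rw [abs_pow]
      exact pow_le_pow_left₀ (abs_nonneg _) (hψC i k x) 2
    · simp only [mul_assoc _ (_ : ℝ) (φ j _), mul_assoc _ (_ : ℝ) (ψ j _ _)]
      refine tendsto_integral_mul_of_bounded (hK i)
        (((hu.norm.measurable.pow_const _).mul (hum i)).mul (hum j)) hV
        (fun x => abs_rpow_mul_coord_mul_coord_le p (u x) i j)
        (fun k => (hcont i k).mul (hcont j k)) (C := C i * C j) (fun k x => ?_)
        (fun k x hx => by simp [hzero i k x hx]) (fun x => (hψl i x).mul (hψl j x))
      rw [abs_mul]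
      exact mul_le_mul (hψC i k x) (hψC j k x) (abs_nonneg _) ((abs_nonneg _).trans (hψC i k x))
  · refine tendsto_finsetSum _ fun i _ => ?_
    simpa using tendsto_integral_mul_of_bounded (hK i) (W := fun _ => 1) (V := fun _ => 1)
      measurable_const continuous_const (by simp) (fun k => (hcont' i k).norm.pow 2)
      (C := C i ^ 2) (fun k x => by
        rw [Pi.pow_apply, abs_pow, abs_norm]
        exact pow_le_pow_left₀ (norm_nonneg _) (hψC' i k x) 2)
      (fun k x hx => by simp [hzero' i k x hx]) (fun x => (hψl' i x).norm.pow 2)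

/-- The product rule for gradients. -/
theorem gradient_mul {n : ℕ} {f g : Euc n → ℝ} {x : Euc n} (hf : DifferentiableAt ℝ f x)
    (hg : DifferentiableAt ℝ g x) :
    gradient (fun y => f y * g y) x = f x • gradient g x + g x • gradient f x := by
  simp only [gradient]
  rw [fderiv_fun_mul hf hg]
  simp

theorem continuous_gradient {n : ℕ} {f : Euc n → ℝ} (hf : ContDiff ℝ 1 f) :
    Continuous (gradient f) :=
  (LinearIsometryEquiv.continuous _).comp (hf.continuous_fderiv one_ne_zero)

theorem HasCompactSupport.gradient {n : ℕ} {f : Euc n → ℝ} (hf : HasCompactSupport f) :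
    HasCompactSupport (gradient f) :=
  (hf.fderiv ℝ).comp_left (map_zero _)

/-- Testing `-Δf` against `fη²`. -/
theorem integral_neg_lap_mul_cutoff {n : ℕ} {f η : Euc n → ℝ} (hf : ContDiff ℝ 2 f)
    (hη : ContDiff ℝ 1 η) (hηc : HasCompactSupport η) :
    ∫ x, -lap f x * (f x * η x ^ 2) = ∫ x, (‖gradient f x‖ ^ 2 * η x ^ 2 +
      2 * (f x * η x * inner ℝ (gradient f x) (gradient η x))) := by
  have hf1 : ContDiff ℝ 1 f := hf.of_le (by norm_num)
  have hfd := hf1.differentiable one_ne_zero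
  have hηd := hη.differentiable one_ne_zero
  rw [integral_neg_lap_mul hf (hf1.mul (hη.pow 2))
    (hηc.comp_left (g := (· ^ 2)) (by simp)).mul_left]
  refine integral_congr_ae (Eventually.of_forall fun x => ?_)
  simp only [pow_two]
  rw [gradient_mul (hfd x) ((hηd x).fun_mul (hηd x)), gradient_mul (hηd x) (hηd x)]
  simp only [inner_add_right, inner_smul_right, real_inner_self_eq_norm_sq]
  ring

theorem integral_norm_gradient_mul_sq {n : ℕ} {f η : Euc n → ℝ} (hf : ContDiff ℝ 2 f)
    (hη : ContDiff ℝ 1 η) (hηc : HasCompactSupport η) :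
    ∫ x, ‖gradient (fun y => f y * η y) x‖ ^ 2 =
      (∫ x, -lap f x * (f x * η x ^ 2)) + ∫ x, f x ^ 2 * ‖gradient η x‖ ^ 2 := by
  have hf1 : ContDiff ℝ 1 f := hf.of_le (by norm_num)
  have hfd := hf1.differentiable one_ne_zero
  have hηd := hη.differentiable one_ne_zero
  have := continuous_gradient hf1
  have := continuous_gradient hη
  have := hf1.continuous
  have := hη.continuous
  rw [integral_neg_lap_mul_cutoff hf hη hηc, ← integral_add]
  · refine integral_congr_ae (Eventually.of_forall fun x => ?_)
    simp only
    rw [gradient_mul (hfd x) (hηd x), norm_add_sq_real]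
    simp only [norm_smul, inner_smul_left, inner_smul_right, mul_pow, Real.norm_eq_abs, sq_abs,
      real_inner_comm (gradient η x)]
    simp
    ring
  · refine Continuous.integrable_of_hasCompactSupport (by fun_prop) ?_
    refine hηc.mono' fun x hx => ?_
    by_contra hx'
    exact hx (by simp [image_eq_zero_of_notMem_tsupport hx'])
  · refine Continuous.integrable_of_hasCompactSupport (by fun_prop) ?_
    exact (hηc.gradient.comp_left (g := fun v => ‖v‖ ^ 2) (by simp)).mul_left

theorem sum_coord_sq {m : ℕ} (v : EuclideanSpace ℝ (Fin m)) : ∑ i, v i ^ 2 = ‖v‖ ^ 2 := by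
  rw [EuclideanSpace.norm_sq_eq]
  simp

theorem norm_rpow_mul_sq {m : ℕ} {p : ℝ} (hp : 1 < p) (v : EuclideanSpace ℝ (Fin m)) :
    ‖v‖ ^ (p - 1) * ‖v‖ ^ 2 = ‖v‖ ^ (p + 1) := by
  rcases eq_or_ne v 0 with rfl | hv
  · simp [Real.zero_rpow (show p + 1 ≠ 0 by linarith)]
  · rw [← Real.rpow_natCast, ← Real.rpow_add (norm_pos_iff.mpr hv)]
    norm_num
    ring_nf

theorem norm_rpow_mul_pow_four {m : ℕ} {p : ℝ} (hp : 1 < p) (v : EuclideanSpace ℝ (Fin m)) :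
    ‖v‖ ^ (p - 3) * (‖v‖ ^ 2 * ‖v‖ ^ 2) = ‖v‖ ^ (p + 1) := by
  rcases eq_or_ne v 0 with rfl | hv
  · simp [Real.zero_rpow (show p + 1 ≠ 0 by linarith)]
  · rw [← pow_add, ← Real.rpow_natCast, ← Real.rpow_add (norm_pos_iff.mpr hv)]
    norm_num
    ring_nf

/-- Testing stability with `u_i η` and the equation with `u_i η²`. -/
theorem Stable1.integral_rpow_mul_sq_le {n m : ℕ} {p : ℝ} (hp : 1 < p)
    {u : Euc n → EuclideanSpace ℝ (Fin m)} (hu : ContDiff ℝ 2 u)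
    (hsol : ∀ (i : Fin m) (x : Euc n), - lap (fun z => u z i) x = ‖u x‖ ^ (p - 1) * u x i)
    {S : Set (Euc n)} (hS : IsOpen S) (h : Stable1 n m p u S) {η : Euc n → ℝ}
    (hη : ContDiff ℝ 1 η) (hηc : HasCompactSupport η) (hηS : tsupport η ⊆ S) :
    (p - 1) * ∫ x, ‖u x‖ ^ (p + 1) * η x ^ 2 ≤ ∫ x, ‖u x‖ ^ 2 * ‖gradient η x‖ ^ 2 := by
  have hui : ∀ i, ContDiff ℝ 2 fun x => u x i := fun i => by fun_prop
  have hui1 : ∀ i, ContDiff ℝ 1 fun x => u x i := fun i => (hui i).of_le (by norm_num)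
  have huc : Continuous u := hu.continuous
  have hηcont := hη.continuous
  have hsupp2 : HasCompactSupport fun x => η x ^ 2 := hηc.comp_left (g := (· ^ 2)) (by simp)
  have hr1 : Continuous fun x => ‖u x‖ ^ (p - 1) :=
    huc.norm.rpow_const fun x => Or.inr (by linarith)
  have hr2 : Continuous fun x => ‖u x‖ ^ (p + 1) :=
    huc.norm.rpow_const fun x => Or.inr (by linarith)
  have key := h.le_of_contDiff_one hp huc hS (φ := fun i x => u x i * η x)
    (fun i => (hui1 i).mul hη) (fun i => hηc.mul_left)
    (fun i => (tsupport_mul_subset_right).trans hηS)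
  have hA : ∀ i, Integrable fun x => ‖u x‖ ^ (p - 1) * (u x i * η x) ^ 2 := fun i => by
    simp only [mul_pow, ← mul_assoc]
    exact Continuous.integrable_of_hasCompactSupport (by fun_prop) hsupp2.mul_left
  have hB : ∀ i j, Integrable fun x =>
      ‖u x‖ ^ (p - 3) * u x i * u x j * (u x i * η x) * (u x j * η x) := fun i j => by
    have hdom : Integrable fun x => ‖u x‖ ^ (p + 1) * η x ^ 2 :=
      (hr2.mul (hηcont.pow 2)).integrable_of_hasCompactSupport hsupp2.mul_left
    refine hdom.mono' ?_ (Eventually.of_forall fun x => ?_)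
    · have h1 : ∀ i, Measurable fun x => u x i := fun i => (hui i).continuous.measurable
      exact ((((((huc.norm.measurable.pow_const _).mul (h1 i)).mul (h1 j)).mul
        ((h1 i).mul hηcont.measurable)).mul
        ((h1 j).mul hηcont.measurable))).aestronglyMeasurable
    · rw [Real.norm_eq_abs, ← norm_rpow_mul_sq hp, mul_assoc _ (u x i * η x), abs_mul]
      rw [mul_assoc (‖u x‖ ^ (p - 1))]
      refine mul_le_mul (abs_rpow_mul_coord_mul_coord_le p _ _ _) ?_ (abs_nonneg _) (by positivity)
      have : u x i * η x * (u x j * η x) = u x i * u x j * η x ^ 2 := by ring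
      rw [this, abs_mul, abs_mul, abs_of_nonneg (sq_nonneg (η x)), sq ‖u x‖]
      gcongr <;> exact abs_coord_le _ _
  rw [← integral_finsetSum _ fun i _ => hA i] at key
  simp only [← integral_finsetSum _ fun j _ => hB _ j] at key
  rw [← integral_finsetSum _ fun i _ => integrable_finsetSum _ fun j _ => hB i j] at key
  have e1 : ∀ x, ∑ i, ‖u x‖ ^ (p - 1) * (u x i * η x) ^ 2 = ‖u x‖ ^ (p + 1) * η x ^ 2 := by
    intro x
    simp only [mul_pow]
    rw [← Finset.mul_sum, ← Finset.sum_mul, sum_coord_sq, ← norm_rpow_mul_sq hp]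
    ring
  have e2 : ∀ x, ∑ i, ∑ j, ‖u x‖ ^ (p - 3) * u x i * u x j * (u x i * η x) * (u x j * η x) =
      ‖u x‖ ^ (p + 1) * η x ^ 2 := by
    intro x
    have : ∀ i j, ‖u x‖ ^ (p - 3) * u x i * u x j * (u x i * η x) * (u x j * η x) =
        ‖u x‖ ^ (p - 3) * η x ^ 2 * (u x i ^ 2 * u x j ^ 2) := fun i j => by ring
    simp only [this]
    simp only [← Finset.mul_sum, ← Finset.sum_mul, sum_coord_sq]
    rw [← norm_rpow_mul_pow_four hp]
    ring
  have e3 : ∀ i, ∫ x, ‖gradient (fun y => u y i * η y) x‖ ^ 2 =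
      (∫ x, ‖u x‖ ^ (p - 1) * (u x i * η x) ^ 2) + ∫ x, u x i ^ 2 * ‖gradient η x‖ ^ 2 := by
    intro i
    rw [integral_norm_gradient_mul_sq (hui i) hη hηc]
    congr 1
    refine integral_congr_ae (Eventually.of_forall fun x => ?_)
    simp only
    rw [hsol i x]
    ring
  have hC : ∀ i, Integrable fun x => u x i ^ 2 * ‖gradient η x‖ ^ 2 := fun i => by
    have := continuous_gradient hη
    have := (hui i).continuous
    refine Continuous.integrable_of_hasCompactSupport (by fun_prop) ?_
    exact (hηc.gradient.comp_left (g := fun v => ‖v‖ ^ 2) (by simp)).mul_left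
  simp only [e3, Finset.sum_add_distrib] at key
  rw [← integral_finsetSum _ fun i _ => hA i, ← integral_finsetSum _ fun i _ => hC i] at key
  simp only [e1, e2, ← Finset.sum_mul, sum_coord_sq] at key
  linarith

/-- Young's inequality with exponents `(p + 1) / 2 = n / (n - 2)` and `n / 2`. -/
theorem sq_mul_sq_le_young {n : ℕ} (hn : 3 ≤ n) {p : ℝ}
    (hp : p = ((n : ℝ) + 2) / ((n : ℝ) - 2)) {ε a b : ℝ} (hε : 0 < ε) (ha : 0 ≤ a) (hb : 0 ≤ b) :
    a ^ 2 * b ^ 2 ≤ ε * a ^ (p + 1) + ε ^ (-(((n : ℝ) - 2) / 2)) * b ^ n := by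
  have hn' : (3 : ℝ) ≤ n := by exact_mod_cast hn
  have hn2 : (0 : ℝ) < n - 2 := by linarith
  rcases ha.eq_or_lt with rfl | ha'
  · rw [zero_pow two_ne_zero, zero_mul]
    positivity
  rcases le_or_gt (b ^ 2) (ε * a ^ (p - 1)) with h | h
  · have e : a ^ (p + 1) = a ^ 2 * a ^ (p - 1) := by
      rw [← Real.rpow_natCast, ← Real.rpow_add ha']
      norm_num
      ring_nf
    have h1 : a ^ 2 * b ^ 2 ≤ a ^ 2 * (ε * a ^ (p - 1)) := by gcongr
    have h2 : 0 ≤ ε ^ (-(((n : ℝ) - 2) / 2)) * b ^ n := by positivity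
    rw [e]
    linarith
  · have h1 : (a ^ (p - 1)) ^ (((n : ℝ) - 2) / 2) = a ^ 2 := by
      rw [← Real.rpow_mul ha, ← Real.rpow_natCast]
      congr 1
      rw [hp]
      field_simp
      norm_num
    have h2 : a ^ 2 ≤ (ε⁻¹ * b ^ 2) ^ (((n : ℝ) - 2) / 2) := by
      rw [← h1]
      refine Real.rpow_le_rpow (by positivity) ?_ (by positivity)
      rw [inv_mul_eq_div, le_div_iff₀ hε]
      linarith
    have h3 : (ε⁻¹ * b ^ 2) ^ (((n : ℝ) - 2) / 2) = ε ^ (-(((n : ℝ) - 2) / 2)) * b ^ (n - 2) := by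
      rw [Real.mul_rpow (by positivity) (by positivity), Real.inv_rpow hε.le, Real.rpow_neg hε.le,
        ← Real.rpow_natCast b 2, ← Real.rpow_mul hb, ← Real.rpow_natCast b (n - 2)]
      congr 2
      push_cast [show 2 ≤ n by lia]
      ring
    have h4 : b ^ n = b ^ (n - 2) * b ^ 2 := by
      rw [← pow_add]
      congr 1
      lia
    have h5 : 0 ≤ ε * a ^ (p + 1) := by positivity
    rw [h3] at h2
    have h6 : a ^ 2 * b ^ 2 ≤ ε ^ (-(((n : ℝ) - 2) / 2)) * b ^ (n - 2) * b ^ 2 := by gcongr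
    rw [h4]
    linarith

/-- A smooth cutoff equal to `1` on the ball of radius `R` and supported in the ball of radius
`2R`, with gradient at most `C / R`. -/
structure IsCutoff {n : ℕ} (C R : ℝ) (η : Euc n → ℝ) : Prop where
  contDiff : ContDiff ℝ 1 η
  nonneg : ∀ x, 0 ≤ η x
  le_one : ∀ x, η x ≤ 1
  eq_one : ∀ x, ‖x‖ ≤ R → η x = 1
  eq_zero : ∀ x, 2 * R ≤ ‖x‖ → η x = 0
  norm_gradient_le : ∀ x, ‖gradient η x‖ ≤ C / R

theorem exists_isCutoff (n : ℕ) : ∃ C : ℝ, ∀ R : ℝ, 0 < R →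
    ∃ η : Euc n → ℝ, IsCutoff C R η := by
  let b : ContDiffBump (0 : Euc n) := ⟨1, 2, one_pos, one_lt_two⟩
  have hb : ContDiff ℝ 1 b := b.contDiff
  obtain ⟨C, hC⟩ := (b.hasCompactSupport.gradient).exists_bound_of_continuous
    (continuous_gradient hb)
  refine ⟨C, fun R hR => ⟨fun x => b (R⁻¹ • x), ?_⟩⟩
  have hnorm : ∀ x : Euc n, ‖R⁻¹ • x‖ = ‖x‖ / R := fun x => by
    rw [norm_smul, norm_inv, Real.norm_of_nonneg hR.le, inv_mul_eq_div]
  refine ⟨hb.comp (contDiff_const_smul _), fun x => b.nonneg, fun x => b.le_one, fun x hx => ?_,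
    fun x hx => ?_, fun x => ?_⟩
  · refine b.one_of_mem_closedBall ?_
    rw [mem_closedBall_zero_iff, hnorm]
    exact (div_le_one hR).mpr hx
  · refine b.zero_of_le_dist ?_
    rw [dist_zero_right, hnorm]
    exact (le_div_iff₀ hR).mpr hx
  · have h1 : gradient (fun x => b (R⁻¹ • x)) x = R⁻¹ • gradient b (R⁻¹ • x) := by
      simp only [gradient]
      rw [fderiv_comp_smul]
      simp
    rw [h1, norm_smul, norm_inv, Real.norm_of_nonneg hR.le, inv_mul_eq_div]
    gcongr
    exact hC _

namespace IsCutoff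

variable {n : ℕ} {C R : ℝ} {η : Euc n → ℝ}

theorem hasCompactSupport (h : IsCutoff C R η) : HasCompactSupport η :=
  HasCompactSupport.intro (isCompact_closedBall 0 (2 * R)) fun x hx => h.eq_zero x (by
    rw [mem_closedBall_zero_iff, not_le] at hx
    exact hx.le)

theorem gradient_eq_zero_of_lt (h : IsCutoff C R η) {x : Euc n} (hx : ‖x‖ < R) :
    gradient η x = 0 := by
  have : η =ᶠ[𝓝 x] fun _ => 1 := by
    filter_upwards [isOpen_ball.mem_nhds (mem_ball_zero_iff.mpr hx)] with y hy
    exact h.eq_one y (mem_ball_zero_iff.mp hy).le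
  rw [this.gradient_eq, gradient_fun_const]

theorem gradient_eq_zero_of_gt (h : IsCutoff C R η) {x : Euc n} (hx : 2 * R < ‖x‖) :
    gradient η x = 0 := by
  have : η =ᶠ[𝓝 x] fun _ => 0 := by
    filter_upwards [(isOpen_lt continuous_const continuous_norm).mem_nhds hx] with y hy
    exact h.eq_zero y (le_of_lt hy)
  rw [this.gradient_eq, gradient_fun_const]

theorem integrable_norm_gradient_pow (h : IsCutoff C R η) (hn : n ≠ 0) :
    Integrable fun x => ‖gradient η x‖ ^ n :=
  ((continuous_gradient h.contDiff).norm.pow n).integrable_of_hasCompactSupport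
    (h.hasCompactSupport.gradient.comp_left (g := fun v => ‖v‖ ^ n) (by simp [hn]))

/-- The `n`-energy of a cutoff is bounded independently of its radius. -/
theorem integral_norm_gradient_pow_le (h : IsCutoff C R η) (hR : 0 < R) (hn : n ≠ 0) :
    ∫ x, ‖gradient η x‖ ^ n ≤ (2 * C) ^ n * volume.real (ball (0 : Euc n) 1) := by
  have hint : Integrable ((closedBall (0 : Euc n) (2 * R)).indicator fun _ => (C / R) ^ n) :=
    (integrable_indicator_iff measurableSet_closedBall).mpr
      (continuousOn_const.integrableOn_compact (isCompact_closedBall _ _))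
  calc ∫ x, ‖gradient η x‖ ^ n
      ≤ ∫ x, (closedBall (0 : Euc n) (2 * R)).indicator (fun _ => (C / R) ^ n) x := by
        refine integral_mono (h.integrable_norm_gradient_pow hn) hint fun x => ?_
        by_cases hx : x ∈ closedBall (0 : Euc n) (2 * R)
        · simp only [indicator_of_mem hx]
          exact pow_le_pow_left₀ (norm_nonneg _) (h.norm_gradient_le x) n
        · simp only [indicator_of_notMem hx]
          rw [mem_closedBall_zero_iff, not_le] at hx
          simp [h.gradient_eq_zero_of_gt hx, hn]
    _ = (2 * C) ^ n * volume.real (ball (0 : Euc n) 1) := by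
        rw [integral_indicator_const _ measurableSet_closedBall, Measure.real,
          Measure.addHaar_closedBall _ _ (by positivity), ENNReal.toReal_mul,
          ENNReal.toReal_ofReal (by positivity), finrank_euclideanSpace_fin, smul_eq_mul,
          Measure.real, div_pow, mul_pow, mul_pow]
        field_simp

end IsCutoff

theorem HasCompactSupport.pow_fun {n : ℕ} {f : Euc n → ℝ} (hf : HasCompactSupport f) {k : ℕ}
    (hk : k ≠ 0) : HasCompactSupport fun x => f x ^ k :=
  hf.mono fun _ hx => ne_zero_pow hk hx

/-- Conformally invariant estimate: stability controls `∫ |u|^{p+1} ψ^{2n}` by the `n`-energy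
of the test function `ψ`. -/
theorem Stable1.integral_rpow_mul_pow_le {n m : ℕ} (hn : 3 ≤ n) {p : ℝ}
    (hp : p = ((n : ℝ) + 2) / ((n : ℝ) - 2)) (hp1 : 1 < p)
    {u : Euc n → EuclideanSpace ℝ (Fin m)} (hu : ContDiff ℝ 2 u)
    (hsol : ∀ (i : Fin m) (x : Euc n), - lap (fun z => u z i) x = ‖u x‖ ^ (p - 1) * u x i)
    {S : Set (Euc n)} (hS : IsOpen S) (h : Stable1 n m p u S) {ψ : Euc n → ℝ}
    (hψ : ContDiff ℝ 1 ψ) (hψc : HasCompactSupport ψ) (hψS : tsupport ψ ⊆ S)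
    (hψ0 : ∀ x, 0 ≤ ψ x) (hψ1 : ∀ x, ψ x ≤ 1) :
    (p - 1) / 2 * ∫ x, ‖u x‖ ^ (p + 1) * (ψ x ^ n) ^ 2 ≤
      ((p - 1) / 2) ^ (-(((n : ℝ) - 2) / 2)) * n ^ n * ∫ x, ‖gradient ψ x‖ ^ n := by
  have hn0 : n ≠ 0 := by lia
  have hn' : (3 : ℝ) ≤ n := by exact_mod_cast hn
  have huc := hu.continuous
  have hψcont := hψ.continuous
  have hr : Continuous fun x => ‖u x‖ ^ (p + 1) :=
    huc.norm.rpow_const fun x => Or.inr (by linarith)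
  have hψn : HasCompactSupport fun x => ψ x ^ n := hψc.pow_fun hn0
  have hψg := continuous_gradient hψ
  have hψng := continuous_gradient (hψ.pow n)
  have hψnS : tsupport (fun x => ψ x ^ n) ⊆ S :=
    (closure_mono fun x (hx : ψ x ^ n ≠ 0) => ne_zero_pow hn0 hx).trans hψS
  have key := h.integral_rpow_mul_sq_le hp1 hu hsol hS (hψ.pow n) hψn hψnS
  have hgrad : ∀ x, ‖gradient (fun y => ψ y ^ n) x‖ = ψ x ^ (n - 1) * (n * ‖gradient ψ x‖) := by
    intro x
    have : gradient (fun y => ψ y ^ n) x = (n * ψ x ^ (n - 1)) • gradient ψ x := by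
      simp only [gradient]
      rw [fderiv_fun_pow n (hψ.differentiable one_ne_zero x)]
      simp
    rw [this, norm_smul, Real.norm_of_nonneg (by have := hψ0 x; positivity)]
    ring
  have hI1 : Integrable fun x => ‖u x‖ ^ (p + 1) * (ψ x ^ n) ^ 2 := by
    have hsupp : HasCompactSupport fun x => (ψ x ^ n) ^ 2 := hψn.pow_fun two_ne_zero
    exact Continuous.integrable_of_hasCompactSupport (by fun_prop) hsupp.mul_left
  have hI2 : Integrable fun x => ‖gradient ψ x‖ ^ n :=
    (hψg.norm.pow n).integrable_of_hasCompactSupport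
      (hψc.gradient.comp_left (g := fun v => ‖v‖ ^ n) (by simp [hn0]))
  have hI3 : Integrable fun x => ‖u x‖ ^ 2 * ‖gradient (fun y => ψ y ^ n) x‖ ^ 2 :=
    Continuous.integrable_of_hasCompactSupport (by fun_prop)
      (hψn.gradient.comp_left (g := fun v => ‖v‖ ^ 2) (by simp)).mul_left
  have hexp : 2 * (n : ℝ) ≤ ((n : ℝ) - 1) * (p + 1) := by
    have : p + 1 = 2 * n / (n - 2) := by
      rw [hp]
      field_simp [show (n : ℝ) - 2 ≠ 0 by linarith]
      ring
    rw [this, ← mul_div_assoc, le_div_iff₀ (by linarith)]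
    nlinarith
  set ε := (p - 1) / 2 with hε
  have hε0 : 0 < ε := by linarith
  have hle : ∀ x, ‖u x‖ ^ 2 * ‖gradient (fun y => ψ y ^ n) x‖ ^ 2 ≤
      ε * (‖u x‖ ^ (p + 1) * (ψ x ^ n) ^ 2) +
        ε ^ (-(((n : ℝ) - 2) / 2)) * n ^ n * ‖gradient ψ x‖ ^ n := by
    intro x
    have hx0 := hψ0 x
    have := sq_mul_sq_le_young hn hp hε0 (a := ‖u x‖ * ψ x ^ (n - 1)) (b := n * ‖gradient ψ x‖)
      (by positivity) (by positivity)
    have h1 : (‖u x‖ * ψ x ^ (n - 1)) ^ (p + 1) ≤ ‖u x‖ ^ (p + 1) * (ψ x ^ n) ^ 2 := by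
      rw [Real.mul_rpow (by positivity) (by positivity)]
      refine mul_le_mul_of_nonneg_left ?_ (by positivity)
      rw [← pow_mul, ← Real.rpow_natCast, ← Real.rpow_natCast, ← Real.rpow_mul hx0]
      refine Real.rpow_le_rpow_of_exponent_ge' hx0 (hψ1 x) (by positivity) ?_
      push_cast [show 1 ≤ n by lia]
      linarith
    rw [hgrad]
    calc ‖u x‖ ^ 2 * (ψ x ^ (n - 1) * (n * ‖gradient ψ x‖)) ^ 2
        = (‖u x‖ * ψ x ^ (n - 1)) ^ 2 * (n * ‖gradient ψ x‖) ^ 2 := by ring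
      _ ≤ _ := this
      _ ≤ _ := by
        rw [mul_pow, ← mul_assoc]
        gcongr
  have hmono := integral_mono hI3 ((hI1.const_mul ε).add (hI2.const_mul _)) hle
  rw [integral_add' (hI1.const_mul ε) (hI2.const_mul _), integral_const_mul, integral_const_mul]
    at hmono
  have : (p - 1) = 2 * ε := by rw [hε]; ring
  rw [this] at key
  linarith

/-- The `n`-energy of an annular cutoff is bounded independently of its radii. -/
theorem IsCutoff.integral_norm_gradient_mul_one_sub_pow_le {n : ℕ} {C R r : ℝ} {η ζ : Euc n → ℝ}
    (hη : IsCutoff C R η) (hζ : IsCutoff C r ζ) (hR : 0 < R) (hr : 0 < r) (hn : n ≠ 0) :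
    ∫ x, ‖gradient (fun y => η y * (1 - ζ y)) x‖ ^ n ≤
      2 ^ (n - 1) * ((2 * C) ^ n * volume.real (ball (0 : Euc n) 1) +
        (2 * C) ^ n * volume.real (ball (0 : Euc n) 1)) := by
  have i1 := hη.integrable_norm_gradient_pow hn
  have i2 := hζ.integrable_norm_gradient_pow hn
  have hle : ∀ x, ‖gradient (fun y => η y * (1 - ζ y)) x‖ ≤
      ‖gradient η x‖ + ‖gradient ζ x‖ := by
    intro x
    have h1 : gradient (fun y => 1 - ζ y) x = - gradient ζ x := by
      simp only [gradient]
      rw [fderiv_const_sub]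
      simp
    rw [gradient_mul (hη.contDiff.differentiable one_ne_zero x)
      ((hζ.contDiff.differentiable one_ne_zero x).const_sub 1), h1, add_comm ‖gradient η x‖]
    refine (norm_add_le _ _).trans (add_le_add ?_ ?_)
    · rw [norm_smul, norm_neg, Real.norm_of_nonneg (hη.nonneg x)]
      exact mul_le_of_le_one_left (norm_nonneg _) (hη.le_one x)
    · rw [norm_smul, Real.norm_of_nonneg (sub_nonneg.mpr (hζ.le_one x))]
      exact mul_le_of_le_one_left (norm_nonneg _) (sub_le_self _ (hζ.nonneg x))
  calc ∫ x, ‖gradient (fun y => η y * (1 - ζ y)) x‖ ^ n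
      ≤ ∫ x, 2 ^ (n - 1) * (‖gradient η x‖ ^ n + ‖gradient ζ x‖ ^ n) := by
        refine integral_mono_of_nonneg (Eventually.of_forall fun x => by positivity)
          ((i1.add i2).const_mul _) (Eventually.of_forall fun x => ?_)
        exact (pow_le_pow_left₀ (norm_nonneg _) (hle x) n).trans
          (add_pow_le (norm_nonneg _) (norm_nonneg _) n)
    _ ≤ _ := by
        rw [integral_const_mul, integral_add i1 i2]
        gcongr
        · exact hη.integral_norm_gradient_pow_le hR hn
        · exact hζ.integral_norm_gradient_pow_le hr hn

/-- Solutions stable outside a compact set have `|u|^{p+1}` integrable. -/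
theorem integrable_norm_rpow_of_stable {n m : ℕ} (hn : 3 ≤ n) {p : ℝ}
    (hp : p = ((n : ℝ) + 2) / ((n : ℝ) - 2)) (hp1 : 1 < p)
    {u : Euc n → EuclideanSpace ℝ (Fin m)} (hu : ContDiff ℝ 2 u)
    (hsol : ∀ (i : Fin m) (x : Euc n), - lap (fun z => u z i) x = ‖u x‖ ^ (p - 1) * u x i)
    {R₀ : ℝ} (hR₀ : 0 < R₀) (h : Stable1 n m p u (closure (ball (0 : Euc n) R₀))ᶜ) :
    Integrable fun x => ‖u x‖ ^ (p + 1) := by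
  have hn0 : n ≠ 0 := by lia
  have huc := hu.continuous
  have hr : Continuous fun x => ‖u x‖ ^ (p + 1) :=
    huc.norm.rpow_const fun x => Or.inr (by linarith)
  obtain ⟨C, hcut⟩ := exists_isCutoff n
  choose η hη using fun k : ℕ => hcut (k + 1) (by positivity)
  have hA : 0 < R₀ + 1 := by linarith
  obtain ⟨ζ, hζ⟩ := hcut (R₀ + 1) hA
  set M := (2 * C) ^ n * volume.real (ball (0 : Euc n) 1) with hM
  set ε := (p - 1) / 2 with hε
  have hε0 : 0 < ε := by linarith
  set D := ε ^ (-(((n : ℝ) - 2) / 2)) * (n : ℝ) ^ n with hD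
  have hD0 : 0 ≤ D := by positivity
  have hψ : ∀ k, ContDiff ℝ 1 fun x => η k x * (1 - ζ x) := fun k =>
    (hη k).contDiff.mul (contDiff_const.sub hζ.contDiff)
  have hψc : ∀ k, HasCompactSupport fun x => η k x * (1 - ζ x) := fun k =>
    (hη k).hasCompactSupport.mul_right
  have hψ0 : ∀ k x, 0 ≤ η k x * (1 - ζ x) := fun k x =>
    mul_nonneg ((hη k).nonneg x) (sub_nonneg.mpr (hζ.le_one x))
  have hψ1 : ∀ k x, η k x * (1 - ζ x) ≤ 1 := fun k x =>
    mul_le_one₀ ((hη k).le_one x) (sub_nonneg.mpr (hζ.le_one x))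
      (sub_le_self _ (hζ.nonneg x))
  have hψS : ∀ k, tsupport (fun x => η k x * (1 - ζ x)) ⊆ (closure (ball (0 : Euc n) R₀))ᶜ := by
    intro k
    have h1 : tsupport (fun x => η k x * (1 - ζ x)) ⊆ {x | R₀ + 1 ≤ ‖x‖} := by
      refine closure_minimal (fun x hx => ?_) (isClosed_le continuous_const continuous_norm)
      by_contra hx'
      exact hx (by simp [hζ.eq_one x (not_le.mp hx').le])
    intro x hx hx'
    have h2 := mem_closedBall_zero_iff.mp (closure_ball_subset_closedBall hx')
    have h3 : R₀ + 1 ≤ ‖x‖ := h1 hx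
    linarith
  have hgrad : ∀ k, ∫ x, ‖gradient (fun y => η k y * (1 - ζ y)) x‖ ^ n ≤
      2 ^ (n - 1) * (M + M) := fun k =>
    (hη k).integral_norm_gradient_mul_one_sub_pow_le hζ (by positivity) hA hn0
  set B := closedBall (0 : Euc n) (2 * (R₀ + 1)) with hB
  have hBint : Integrable (B.indicator fun x => ‖u x‖ ^ (p + 1)) :=
    (integrable_indicator_iff measurableSet_closedBall).mpr
      (hr.continuousOn.integrableOn_compact (isCompact_closedBall _ _))
  refine (aecover_closedBall (x := (0 : Euc n)) (r := fun k : ℕ => (k : ℝ) + 1)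
    (l := atTop) (tendsto_atTop_add_const_right _ _ tendsto_natCast_atTop_atTop)
    ).integrable_of_integral_bounded_of_nonneg_ae
    ((∫ x, B.indicator (fun x => ‖u x‖ ^ (p + 1)) x) + ε⁻¹ * (D * (2 ^ (n - 1) * (M + M))))
    (fun k => hr.continuousOn.integrableOn_compact (isCompact_closedBall _ _))
    (Eventually.of_forall fun x => by positivity) (Eventually.of_forall fun k => ?_)
  have hest := h.integral_rpow_mul_pow_le hn hp hp1 hu hsol isClosed_closure.isOpen_compl (hψ k)
    (hψc k) (hψS k) (hψ0 k) (hψ1 k)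
  rw [← hε, ← hD] at hest
  have hest' : ∫ x, ‖u x‖ ^ (p + 1) * ((η k x * (1 - ζ x)) ^ n) ^ 2 ≤
      ε⁻¹ * (D * (2 ^ (n - 1) * (M + M))) := by
    rw [inv_mul_eq_div, le_div_iff₀ hε0, mul_comm]
    exact hest.trans (mul_le_mul_of_nonneg_left (hgrad k) hD0)
  have hI : Integrable fun x => ‖u x‖ ^ (p + 1) * ((η k x * (1 - ζ x)) ^ n) ^ 2 := by
    have hsupp : HasCompactSupport fun x => ((η k x * (1 - ζ x)) ^ n) ^ 2 :=
      ((hψc k).pow_fun hn0).pow_fun two_ne_zero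
    have := (hψ k).continuous
    exact Continuous.integrable_of_hasCompactSupport (by fun_prop) hsupp.mul_left
  refine le_trans ?_ (add_le_add_right hest' _)
  rw [← integral_indicator measurableSet_closedBall, ← integral_add hBint hI]
  refine integral_mono ((integrable_indicator_iff measurableSet_closedBall).mpr
    (hr.continuousOn.integrableOn_compact (isCompact_closedBall _ _))) (hBint.add hI) fun x => ?_
  have hpos : 0 ≤ ‖u x‖ ^ (p + 1) := by positivity
  have hpos' : 0 ≤ ‖u x‖ ^ (p + 1) * ((η k x * (1 - ζ x)) ^ n) ^ 2 := by positivity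
  have hpos'' : 0 ≤ B.indicator (fun x => ‖u x‖ ^ (p + 1)) x :=
    indicator_nonneg (fun x _ => by positivity) x
  simp only
  by_cases hx : x ∈ closedBall (0 : Euc n) ((k : ℝ) + 1)
  · rw [indicator_of_mem hx]
    by_cases hxB : x ∈ B
    · rw [indicator_of_mem hxB]
      linarith
    · rw [hB, mem_closedBall_zero_iff, not_le] at hxB
      rw [(hη k).eq_one x (mem_closedBall_zero_iff.mp hx), hζ.eq_zero x hxB.le]
      simpa using hpos''
  · rw [indicator_of_notMem hx]
    linarith

/-- If `|u|^{p+1}` is integrable, the cutoff error `∫ |u|² |∇η_k|²` vanishes in the limit. -/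
theorem tendsto_integral_sq_mul_norm_gradient_sq {n m : ℕ} (hn : 3 ≤ n) {p : ℝ}
    (hp : p = ((n : ℝ) + 2) / ((n : ℝ) - 2)) {u : Euc n → EuclideanSpace ℝ (Fin m)}
    (hint : Integrable fun x => ‖u x‖ ^ (p + 1)) {C : ℝ} {η : ℕ → Euc n → ℝ}
    (hη : ∀ k : ℕ, IsCutoff C (k + 1) (η k)) :
    Tendsto (fun k => ∫ x, ‖u x‖ ^ 2 * ‖gradient (η k) x‖ ^ 2) atTop (𝓝 0) := by
  have hn0 : n ≠ 0 := by lia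
  have hn' : (3 : ℝ) ≤ n := by exact_mod_cast hn
  set M := (2 * C) ^ n * volume.real (ball (0 : Euc n) 1) with hM
  have htail : Tendsto (fun k : ℕ => ∫ x, ((ball (0 : Euc n) ((k : ℝ) + 1))ᶜ).indicator
      (fun x => ‖u x‖ ^ (p + 1)) x) atTop (𝓝 0) := by
    rw [← integral_zero (Euc n) ℝ]
    refine tendsto_integral_of_dominated_convergence (fun x => ‖u x‖ ^ (p + 1))
      (fun k => (hint.indicator measurableSet_ball.compl).aestronglyMeasurable) hint
      (fun k => Eventually.of_forall fun x => ?_) (Eventually.of_forall fun x => ?_)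
    · refine (norm_indicator_le_norm_self _ _).trans ?_
      rw [Real.norm_of_nonneg (by positivity)]
    · refine tendsto_const_nhds.congr' ?_
      obtain ⟨N, hN⟩ := exists_nat_gt ‖x‖
      filter_upwards [eventually_ge_atTop N] with k hk
      rw [indicator_of_notMem]
      rw [notMem_compl_iff, mem_ball_zero_iff]
      have : (N : ℝ) ≤ k := by exact_mod_cast hk
      linarith
  have hbound : ∀ ε : ℝ, 0 < ε → ∀ k : ℕ, ∫ x, ‖u x‖ ^ 2 * ‖gradient (η k) x‖ ^ 2 ≤
      ε * (∫ x, ((ball (0 : Euc n) ((k : ℝ) + 1))ᶜ).indicator (fun x => ‖u x‖ ^ (p + 1)) x) +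
        ε ^ (-(((n : ℝ) - 2) / 2)) * M := by
    intro ε hε k
    have i1 := (hint.indicator (measurableSet_ball (x := (0 : Euc n)) (ε := (k : ℝ) + 1)).compl)
    have i2 := (hη k).integrable_norm_gradient_pow hn0
    have h1 : ∫ x, ‖u x‖ ^ 2 * ‖gradient (η k) x‖ ^ 2 ≤
        ∫ x, (ε * ((ball (0 : Euc n) ((k : ℝ) + 1))ᶜ).indicator (fun x => ‖u x‖ ^ (p + 1)) x +
          ε ^ (-(((n : ℝ) - 2) / 2)) * ‖gradient (η k) x‖ ^ n) := by
      refine integral_mono_of_nonneg (Eventually.of_forall fun x => by positivity)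
        ((i1.const_mul _).add (i2.const_mul _)) (Eventually.of_forall fun x => ?_)
      simp only
      by_cases hx : x ∈ ball (0 : Euc n) ((k : ℝ) + 1)
      · rw [(hη k).gradient_eq_zero_of_lt (mem_ball_zero_iff.mp hx),
          indicator_of_notMem (by simpa using hx)]
        simp [hn0]
      · rw [indicator_of_mem hx]
        exact sq_mul_sq_le_young hn hp hε (norm_nonneg _) (norm_nonneg _)
    refine h1.trans ?_
    rw [integral_add (i1.const_mul _) (i2.const_mul _), integral_const_mul, integral_const_mul]
    gcongr
    exact (hη k).integral_norm_gradient_pow_le (by positivity) hn0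
  refine tendsto_order.2 ⟨fun a ha => Eventually.of_forall fun k =>
    ha.trans_le (integral_nonneg fun x => by positivity), fun a ha => ?_⟩
  have hsmall : Tendsto (fun ε : ℝ => ε ^ (-(((n : ℝ) - 2) / 2)) * M) atTop (𝓝 0) := by
    simpa using (tendsto_rpow_neg_atTop (y := ((n : ℝ) - 2) / 2) (by linarith)).mul_const M
  obtain ⟨ε, hε, hεa⟩ := ((eventually_gt_atTop (0 : ℝ)).and
    (hsmall.eventually_lt_const (half_pos ha))).exists
  have h2 := (htail.const_mul ε).eventually_lt_const (u := a / 2) (by simpa using half_pos ha)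
  filter_upwards [h2] with k hk
  have := hbound ε hε k
  linarith

theorem tendsto_integral_mul_cutoff_sq {n : ℕ} {w : Euc n → ℝ} (hw : Integrable w) {C : ℝ}
    {η : ℕ → Euc n → ℝ} (hη : ∀ k : ℕ, IsCutoff C (k + 1) (η k)) :
    Tendsto (fun k => ∫ x, w x * η k x ^ 2) atTop (𝓝 (∫ x, w x)) := by
  refine tendsto_integral_of_dominated_convergence (fun x => ‖w x‖)
    (fun k => hw.aestronglyMeasurable.mul ((hη k).contDiff.continuous.pow 2).aestronglyMeasurable)
    hw.norm (fun k => Eventually.of_forall fun x => ?_) (Eventually.of_forall fun x => ?_)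
  · rw [norm_mul, Real.norm_of_nonneg (sq_nonneg (η k x))]
    exact mul_le_of_le_one_right (norm_nonneg _)
      (pow_le_one₀ ((hη k).nonneg x) ((hη k).le_one x))
  · refine tendsto_const_nhds.congr' ?_
    obtain ⟨N, hN⟩ := exists_nat_gt ‖x‖
    filter_upwards [eventually_ge_atTop N] with k hk
    have : (N : ℝ) ≤ k := by exact_mod_cast hk
    rw [(hη k).eq_one x (by linarith)]
    simp

/-- Energy identity: if the cutoff errors vanish and `-Δf ⬝ f` is integrable, then
`∫ |∇f|² = ∫ -Δf ⬝ f`, both being finite. -/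
theorem integrable_norm_gradient_sq_and_integral_eq {n : ℕ} {f : Euc n → ℝ} (hf : ContDiff ℝ 2 f)
    (hw : Integrable fun x => -lap f x * f x) {C : ℝ} {η : ℕ → Euc n → ℝ}
    (hη : ∀ k : ℕ, IsCutoff C (k + 1) (η k))
    (hlim : Tendsto (fun k => ∫ x, f x ^ 2 * ‖gradient (η k) x‖ ^ 2) atTop (𝓝 0)) :
    Integrable (fun x => ‖gradient f x‖ ^ 2) ∧
      ∫ x, ‖gradient f x‖ ^ 2 = ∫ x, -lap f x * f x := by
  have hf1 : ContDiff ℝ 1 f := hf.of_le (by norm_num)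
  have hfc := hf.continuous
  have hfg := continuous_gradient hf1
  have hw' := tendsto_integral_mul_cutoff_sq hw hη
  have hi1 : ∀ k, Integrable fun x => ‖gradient f x‖ ^ 2 * η k x ^ 2 := fun k => by
    have := (hη k).contDiff.continuous
    exact Continuous.integrable_of_hasCompactSupport (by fun_prop)
      ((hη k).hasCompactSupport.comp_left (g := (· ^ 2)) (by simp)).mul_left
  have hi2 : ∀ k, Integrable fun x => f x ^ 2 * ‖gradient (η k) x‖ ^ 2 := fun k => by
    have := continuous_gradient (hη k).contDiff
    exact Continuous.integrable_of_hasCompactSupport (by fun_prop)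
      ((hη k).hasCompactSupport.gradient.comp_left (g := fun v => ‖v‖ ^ 2) (by simp)).mul_left
  have hi3 : ∀ k, Integrable fun x =>
      2 * (f x * η k x * inner ℝ (gradient f x) (gradient (η k) x)) := fun k => by
    have := continuous_gradient (hη k).contDiff
    have := (hη k).contDiff.continuous
    refine Continuous.integrable_of_hasCompactSupport (by fun_prop) ?_
    exact ((hη k).hasCompactSupport.mul_left.mul_right).mul_left
  have hest : ∀ t : ℝ, 0 < t → ∀ k,
      |(∫ x, ‖gradient f x‖ ^ 2 * η k x ^ 2) - ∫ x, -lap f x * f x * η k x ^ 2| ≤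
        t * (∫ x, ‖gradient f x‖ ^ 2 * η k x ^ 2) +
          t⁻¹ * ∫ x, f x ^ 2 * ‖gradient (η k) x‖ ^ 2 := by
    intro t ht k
    have h1 := integral_neg_lap_mul_cutoff hf (hη k).contDiff (hη k).hasCompactSupport
    simp only [← mul_assoc (-lap f _)] at h1
    rw [h1, integral_add (hi1 k) (hi3 k), sub_add_cancel_left, abs_neg, ← integral_const_mul,
      ← integral_const_mul, ← integral_add ((hi1 k).const_mul _) ((hi2 k).const_mul _)]
    refine (abs_integral_le_integral_abs).trans (integral_mono (hi3 k).abs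
      (((hi1 k).const_mul _).add ((hi2 k).const_mul _)) fun x => ?_)
    simp only
    rw [abs_mul, abs_mul, abs_mul, abs_two]
    have h2 := abs_real_inner_le_norm (gradient f x) (gradient (η k) x)
    have h3 : 2 * (|f x| * |η k x| * |inner ℝ (gradient f x) (gradient (η k) x)|) ≤
        2 * (|f x| * |η k x| * (‖gradient f x‖ * ‖gradient (η k) x‖)) := by gcongr
    refine h3.trans ?_
    rw [← sq_abs (η k x), ← sq_abs (f x)]
    have h4 : 0 ≤ t⁻¹ * (t * (‖gradient f x‖ * |η k x|) - |f x| * ‖gradient (η k) x‖) ^ 2 := by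
      positivity
    have h5 : t⁻¹ * (t * (‖gradient f x‖ * |η k x|) - |f x| * ‖gradient (η k) x‖) ^ 2 =
        t * (‖gradient f x‖ ^ 2 * |η k x| ^ 2) + t⁻¹ * (|f x| ^ 2 * ‖gradient (η k) x‖ ^ 2) -
        2 * (|f x| * |η k x| * (‖gradient f x‖ * ‖gradient (η k) x‖)) := by
      field_simp
      ring
    linarith
  have hint : Integrable fun x => ‖gradient f x‖ ^ 2 := by
    have hL := (hw'.const_mul 2).add (hlim.const_mul 4)
    refine (aecover_closedBall (x := (0 : Euc n)) (r := fun k : ℕ => (k : ℝ) + 1)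
      (l := atTop) (tendsto_atTop_add_const_right _ _ tendsto_natCast_atTop_atTop)
      ).integrable_of_integral_bounded_of_nonneg_ae _
      (fun k => (hfg.norm.pow 2).continuousOn.integrableOn_compact (isCompact_closedBall _ _))
      (Eventually.of_forall fun x => by positivity)
      ((hL.eventually_le_const (lt_add_one _)).mono fun k hk => le_trans ?_ hk)
    have h1 := hest (1 / 2) (by norm_num) k
    have h2 := (le_abs_self _).trans h1
    have h3 : ∫ x in closedBall (0 : Euc n) ((k : ℝ) + 1), ‖gradient f x‖ ^ 2 ≤
        ∫ x, ‖gradient f x‖ ^ 2 * η k x ^ 2 := by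
      rw [← integral_indicator measurableSet_closedBall]
      refine integral_mono ((integrable_indicator_iff measurableSet_closedBall).mpr
        ((hfg.norm.pow 2).continuousOn.integrableOn_compact (isCompact_closedBall _ _)))
        (hi1 k) fun x => ?_
      by_cases hx : x ∈ closedBall (0 : Euc n) ((k : ℝ) + 1)
      · simp [indicator_of_mem hx, (hη k).eq_one x (mem_closedBall_zero_iff.mp hx)]
      · rw [indicator_of_notMem hx]
        positivity
    rw [one_div, inv_inv] at h2
    linarith
  refine ⟨hint, ?_⟩
  have hg' := tendsto_integral_mul_cutoff_sq hint hη
  have hle : ∀ t : ℝ, 0 < t → |(∫ x, ‖gradient f x‖ ^ 2) - ∫ x, -lap f x * f x| ≤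
      t * ∫ x, ‖gradient f x‖ ^ 2 := by
    intro t ht
    have := le_of_tendsto_of_tendsto' (hg'.sub hw').abs
      ((hg'.const_mul t).add (hlim.const_mul t⁻¹)) (hest t ht)
    simpa using this
  have hlim0 : Tendsto (fun t : ℝ => t * ∫ x, ‖gradient f x‖ ^ 2) (𝓝[>] 0) (𝓝 0) := by
    have : Tendsto (fun t : ℝ => t * ∫ x, ‖gradient f x‖ ^ 2) (𝓝 0)
        (𝓝 (0 * ∫ x, ‖gradient f x‖ ^ 2)) := tendsto_id.mul_const _
    rw [zero_mul] at this
    exact this.mono_left nhdsWithin_le_nhds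
  have h0 := ge_of_tendsto hlim0 (eventually_mem_nhdsWithin.mono fun t ht => hle t ht)
  exact sub_eq_zero.mp (abs_nonpos_iff.mp h0)

/-- Sobolev-critical part of Theorem 2.1: for `p = (n+2)/(n−2)`, a solution of
`−Δu_i = |u|^{p−1} u_i` that is stable outside a compact set has finite energy
`∫ |u|^{p+1} = Σ_i ∫ |∇u_i|² < ∞`, and if moreover `u` is stable on all of `ℝⁿ`
then `u ≡ 0`. -/
theorem statement5 (n m : ℕ) (hn : 3 ≤ n) (hm : 1 ≤ m) (p : ℝ)
    (hp : p = ((n : ℝ) + 2) / ((n : ℝ) - 2))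
    (u : Euc n → EuclideanSpace ℝ (Fin m)) (hreg : ContDiff ℝ 2 u)
    (hsol : ∀ (i : Fin m) (x : Euc n), - lap (fun z => u z i) x = ‖u x‖ ^ (p - 1) * u x i)
    (hstab : ∃ R₀ : ℝ, 0 < R₀ ∧ Stable1 n m p u (closure (ball (0 : Euc n) R₀))ᶜ) :
    (Integrable (fun x => ‖u x‖ ^ (p + 1)) (volume : Measure (Euc n)) ∧
      (∀ i : Fin m,
        Integrable (fun x => ‖gradient (fun z => u z i) x‖ ^ 2) (volume : Measure (Euc n))) ∧
      ∫ x, ‖u x‖ ^ (p + 1) = ∑ i, ∫ x, ‖gradient (fun z => u z i) x‖ ^ 2) ∧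
    (Stable1 n m p u Set.univ → ∀ (i : Fin m) (x : Euc n), u x i = 0) := by
  have hn' : (3 : ℝ) ≤ n := by exact_mod_cast hn
  have hp1 : 1 < p := by
    rw [hp, lt_div_iff₀ (by linarith)]
    linarith
  obtain ⟨R₀, hR₀, hst⟩ := hstab
  have hint := integrable_norm_rpow_of_stable hn hp hp1 hreg hsol hR₀ hst
  obtain ⟨C, hcut⟩ := exists_isCutoff n
  choose η hη using fun k : ℕ => hcut (k + 1) (by positivity)
  have hlim := tendsto_integral_sq_mul_norm_gradient_sq hn hp hint hη
  have hui : ∀ i, ContDiff ℝ 2 fun x => u x i := fun i => by fun_prop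
  have hr : Continuous fun x => ‖u x‖ ^ (p + 1) :=
    hreg.continuous.norm.rpow_const fun x => Or.inr (by linarith)
  have hr1 : Continuous fun x => ‖u x‖ ^ (p - 1) :=
    hreg.continuous.norm.rpow_const fun x => Or.inr (by linarith)
  have hwint : ∀ i, Integrable fun x => ‖u x‖ ^ (p - 1) * u x i * u x i := fun i => by
    refine hint.mono' ((hr1.mul (hui i).continuous).mul
      (hui i).continuous).aestronglyMeasurable (Eventually.of_forall fun x => ?_)
    rw [← norm_rpow_mul_sq hp1, mul_assoc, norm_mul, Real.norm_of_nonneg (by positivity), norm_mul,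
      sq]
    gcongr <;> exact abs_coord_le _ i
  have henergy : ∀ i, Integrable (fun x => ‖gradient (fun z => u z i) x‖ ^ 2) ∧
      ∫ x, ‖gradient (fun z => u z i) x‖ ^ 2 = ∫ x, ‖u x‖ ^ (p - 1) * u x i * u x i := by
    intro i
    simp only [← hsol i]
    refine integrable_norm_gradient_sq_and_integral_eq (hui i)
      (by simpa only [hsol i] using hwint i) hη ?_
    refine squeeze_zero (fun k => integral_nonneg fun x => by positivity) (fun k => ?_) hlim
    have hg := continuous_gradient (hη k).contDiff
    have hu := hreg.continuous
    refine integral_mono_of_nonneg (Eventually.of_forall fun x => by positivity)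
      (Continuous.integrable_of_hasCompactSupport (by fun_prop)
        ((hη k).hasCompactSupport.gradient.comp_left (g := fun v => ‖v‖ ^ 2) (by simp)).mul_left)
      (Eventually.of_forall fun x => ?_)
    refine mul_le_mul_of_nonneg_right ?_ (by positivity)
    rw [← sq_abs (u x i)]
    exact pow_le_pow_left₀ (abs_nonneg _) (abs_coord_le _ i) 2
  refine ⟨⟨hint, fun i => (henergy i).1, ?_⟩, fun hs => ?_⟩
  · simp only [fun i => (henergy i).2]
    rw [← integral_finsetSum _ fun i _ => hwint i]
    refine integral_congr_ae (Eventually.of_forall fun x => ?_)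
    simp only [mul_assoc, ← sq]
    rw [← Finset.mul_sum, sum_coord_sq, norm_rpow_mul_sq hp1]
  · have hle : (p - 1) * ∫ x, ‖u x‖ ^ (p + 1) ≤ 0 :=
      le_of_tendsto_of_tendsto' ((tendsto_integral_mul_cutoff_sq hint hη).const_mul (p - 1)) hlim
        fun k => hs.integral_rpow_mul_sq_le hp1 hreg hsol isOpen_univ (hη k).contDiff
          (hη k).hasCompactSupport (subset_univ _)
    have hnn : 0 ≤ ∫ x, ‖u x‖ ^ (p + 1) := integral_nonneg fun x => by positivity
    have hzero : ∫ x, ‖u x‖ ^ (p + 1) = 0 := by nlinarith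
    rw [integral_eq_zero_iff_of_nonneg (fun x => by positivity) hint] at hzero
    have hfun := (hr.ae_eq_iff_eq volume continuous_zero).mp hzero
    intro i x
    have h0 : ‖u x‖ ^ (p + 1) = 0 := congrFun hfun x
    rw [Real.rpow_eq_zero (norm_nonneg _) (by linarith), norm_eq_zero] at h0
    simp [h0]
end
end
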